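/- (Alphabet Soup Theorem) Assume GRH, and assume the weak abc conjecture: there exists κ₁ > 0 such that for every ε > 0 there are only finitely many primitive integer solutions (A,B,C) of A+B=C with ABC ≠ 0 and R(A,B,C) ≤ H(A,B,C)^{κ₁−ε}. Then there exists a real constant κ₀ with 0 < κ₀ < ∞ such that: (a) for each ε > 0 there are only finitely many primitive integer solutions (X,Y,Z) of X+Y=Z with XYZ ≠ 0 and S(X,Y,Z) < (log H(X,Y,Z))^{κ₀−ε}; and (b) for each ε > 0 there are infinitely many primitive integer solutions (X,Y,Z) of X+Y=Z with XYZ ≠ 0 and S(X,Y,Z) < (log H(X,Y,Z))^{κ₀+ε}. -/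

import Mathlib

noncomputable section

/-- The Generalized Riemann Hypothesis. -/
def GRH : Prop :=
  (∀ s : ℂ, 0 < s.re → s.re < 1 → riemannZeta s = 0 → s.re = 1 / 2) ∧
  (∀ (N : ℕ) [NeZero N] (χ : DirichletCharacter ℂ N) (s : ℂ),
    0 < s.re → s.re < 1 → DirichletCharacter.LFunction χ s = 0 → s.re = 1 / 2)

/-- Height of a triple: `max(|X|,|Y|,|Z|)`. -/
def height (X Y Z : ℤ) : ℤ := max |X| (max |Y| |Z|)

/-- Smoothness of a triple: the largest prime dividing `X*Y*Z`. -/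
def smoothness (X Y Z : ℤ) : ℕ := sSup {p : ℕ | p.Prime ∧ (p : ℤ) ∣ X * Y * Z}

/-- Radical of a triple: the product of the primes dividing `X*Y*Z`. -/
def radical (X Y Z : ℤ) : ℕ := ∏ p ∈ (X * Y * Z).natAbs.primeFactors, p

/-- A primitive nondegenerate solution of the abc equation. -/
def IsPrimitiveSolution (X Y Z : ℤ) : Prop :=
  X + Y = Z ∧ X * Y * Z ≠ 0 ∧ Int.gcd X (Int.gcd Y Z) = 1

noncomputable section
open Complex MeasureTheory Set Filter Topology

/-- The truncated Mellin transform `∫_{t > 1} b(t) t^{-(s+1)} dt`. -/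
def tailMellin (b : ℝ → ℂ) (s : ℂ) : ℂ := ∫ t in Ioi (1 : ℝ), b t * (t : ℂ) ^ (-(s + 1))

lemma tailMellin_eq_mellin (b : ℝ → ℂ) (s : ℂ) :
    tailMellin b s = mellin ((Ioi (1 : ℝ)).indicator b) (-s) := by
  unfold tailMellin mellin
  have h : ∀ t : ℝ, (t : ℂ) ^ (-s - 1) • (Ioi (1 : ℝ)).indicator b t
      = (Ioi (1 : ℝ)).indicator (fun t => b t * (t : ℂ) ^ (-(s + 1))) t := by
    intro t
    by_cases ht : t ∈ Ioi (1 : ℝ)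
    · simp only [indicator_of_mem ht, smul_eq_mul]
      rw [mul_comm]; congr 2; ring
    · simp [indicator_of_notMem ht]
  simp_rw [h]
  rw [setIntegral_indicator measurableSet_Ioi, inter_eq_self_of_subset_right]
  exact Ioi_subset_Ioi zero_le_one

lemma differentiableOn_tailMellin {b : ℝ → ℂ} (hb : Measurable b) {B : ℝ}
    (hB : ∀ t, ‖b t‖ ≤ B) : DifferentiableOn ℂ (tailMellin b) {s | 0 < s.re} := by
  intro s hs
  have hs : 0 < s.re := hs
  have hm : Measurable ((Ioi (1 : ℝ)).indicator b) := hb.indicator measurableSet_Ioi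
  have hle : ∀ t, ‖(Ioi (1 : ℝ)).indicator b t‖ ≤ B := fun t =>
    (norm_indicator_le_norm_self b t).trans (hB t)
  have h1 : DifferentiableAt ℂ (mellin ((Ioi (1 : ℝ)).indicator b)) (-s) := by
    refine mellin_differentiableAt_of_isBigO_rpow (a := 0) (b := -s.re - 1) ?_ ?_ (by simpa) ?_
      (by simp)
    · refine LocallyIntegrable.locallyIntegrableOn ?_ _
      intro x
      refine ⟨Icc (x-1) (x+1), Icc_mem_nhds (by linarith) (by linarith), ?_⟩
      exact Measure.integrableOn_of_bounded (M := B) (by simp) hm.aestronglyMeasurable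
        (by filter_upwards with t using hle t)
    · refine Asymptotics.IsBigO.of_bound B ?_
      filter_upwards with t
      simpa using hle t
    · refine Asymptotics.IsBigO.of_bound 1 ?_
      have : Ioo (0:ℝ) 1 ∈ 𝓝[>] (0:ℝ) := Ioo_mem_nhdsGT one_pos
      filter_upwards [this] with t ht
      rw [indicator_of_notMem (by simp; linarith [ht.2])]
      simp
  have h2 : tailMellin b = fun s => mellin ((Ioi (1 : ℝ)).indicator b) (-s) :=
    funext (tailMellin_eq_mellin b)
  rw [h2]
  exact (DifferentiableAt.comp s h1 differentiableAt_id.neg).differentiableWithinAt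

lemma norm_tailMellin_le {b : ℝ → ℂ} {B : ℝ} (hB : ∀ t, ‖b t‖ ≤ B) {s : ℂ} (hs : 0 < s.re) :
    ‖tailMellin b s‖ ≤ B / s.re := by
  have hlt : -(s.re + 1) < -1 := by linarith
  calc ‖tailMellin b s‖ ≤ ∫ t in Ioi (1 : ℝ), B * t ^ (-(s.re + 1)) := by
        refine norm_integral_le_of_norm_le ?_ ?_
        · exact (integrableOn_Ioi_rpow_of_lt hlt one_pos).const_mul B
        · refine (ae_restrict_iff' measurableSet_Ioi).2 ?_
          filter_upwards with t ht
          have ht0 : (0:ℝ) < t := lt_trans one_pos ht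
          rw [norm_mul, norm_cpow_eq_rpow_re_of_pos ht0]
          simp only [neg_re, add_re, one_re]
          gcongr
          exact hB t
    _ = B / s.re := by
        rw [integral_const_mul, integral_Ioi_rpow_of_lt hlt one_pos]
        simp; field_simp

lemma isPreconnected_re_pos : IsPreconnected {s : ℂ | 0 < s.re} :=
  (convex_halfSpace_re_gt 0).isPreconnected

lemma isOpen_re_pos : IsOpen {s : ℂ | 0 < s.re} := isOpen_lt continuous_const continuous_re

/-- Two functions holomorphic on `Re s > 0` that agree on `Re s > 1` agree on `Re s > 0`. -/
lemma eqOn_re_pos_of_eqOn_one_lt_re {f g : ℂ → ℂ} (hf : DifferentiableOn ℂ f {s | 0 < s.re})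
    (hg : DifferentiableOn ℂ g {s | 0 < s.re}) (h : ∀ s : ℂ, 1 < s.re → f s = g s)
    {s : ℂ} (hs : 0 < s.re) : f s = g s := by
  refine (hf.analyticOnNhd isOpen_re_pos).eqOn_of_preconnected_of_eventuallyEq
    (hg.analyticOnNhd isOpen_re_pos) isPreconnected_re_pos (z₀ := 2) (by simp) ?_ hs
  have : {s : ℂ | 1 < s.re} ∈ 𝓝 (2:ℂ) :=
    (isOpen_lt continuous_const continuous_re).mem_nhds (by simp)
  filter_upwards [this] with z hz using h z hz

end

noncomputable section
open Complex MeasureTheory Set Filter Topology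

lemma DirichletCharacter.sum_range_eq_zero {N : ℕ} [NeZero N] {χ : DirichletCharacter ℂ N}
    (hχ : χ ≠ 1) : ∑ k ∈ Finset.range N, χ (k : ZMod N) = 0 := by
  rw [← MulChar.sum_eq_zero_of_ne_one hχ]
  refine Finset.sum_bij' (fun k _ => (k : ZMod N)) (fun a _ => a.val) (by simp) ?_ ?_ (by simp)
    (by simp)
  · intro a _; simpa using ZMod.val_lt a
  · intro k hk; exact ZMod.val_cast_of_lt (by simpa using hk)

lemma DirichletCharacter.norm_sum_range_le {N : ℕ} [NeZero N] {χ : DirichletCharacter ℂ N}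
    (hχ : χ ≠ 1) (n : ℕ) : ‖∑ k ∈ Finset.range n, χ (k : ZMod N)‖ ≤ N := by
  induction n using Nat.strong_induction_on with
  | _ n ih =>
    by_cases h : n < N
    · calc _ ≤ ∑ k ∈ Finset.range n, (1:ℝ) := norm_sum_le_of_le _ fun k _ => χ.norm_le_one _
        _ = n := by simp
        _ ≤ N := by exact_mod_cast h.le
    · obtain ⟨m, rfl⟩ := Nat.exists_eq_add_of_le (not_lt.1 h)
      have hN : 0 < N := Nat.pos_of_ne_zero (NeZero.ne N)
      rw [Finset.sum_range_add, DirichletCharacter.sum_range_eq_zero hχ]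
      simpa using ih m (by omega)

lemma DirichletCharacter.norm_sum_Icc_le {N : ℕ} [NeZero N] {χ : DirichletCharacter ℂ N}
    (hχ : χ ≠ 1) (n : ℕ) : ‖∑ k ∈ Finset.Icc 1 n, χ (k : ZMod N)‖ ≤ 2 * N := by
  have h1 : ∑ k ∈ Finset.Icc 1 n, χ (k : ZMod N)
      = ∑ k ∈ Finset.range (n+1), χ (k : ZMod N) - χ ((0:ℕ) : ZMod N) := by
    rw [Finset.range_eq_Ico, Finset.sum_eq_sum_Ico_succ_bot (by omega)]
    simp only [Nat.cast_zero, zero_add, add_sub_cancel_left]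
    rfl
  have hN : (1:ℝ) ≤ N := by exact_mod_cast Nat.one_le_iff_ne_zero.2 (NeZero.ne N)
  rw [h1]
  calc _ ≤ ‖∑ k ∈ Finset.range (n+1), χ (k : ZMod N)‖ + ‖χ ((0:ℕ) : ZMod N)‖ := norm_sub_le _ _
    _ ≤ N + 1 := add_le_add (norm_sum_range_le hχ _) (χ.norm_le_one _)
    _ ≤ 2 * N := by linarith

lemma DirichletCharacter.LFunction_eq_tailMellin {N : ℕ} [NeZero N] {χ : DirichletCharacter ℂ N}
    (hχ : χ ≠ 1) {s : ℂ} (hs : 0 < s.re) :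
    DirichletCharacter.LFunction χ s =
      s * tailMellin (fun t => ∑ k ∈ Finset.Icc 1 ⌊t⌋₊, χ (k : ZMod N)) s := by
  have hb : Measurable (fun t : ℝ => ∑ k ∈ Finset.Icc 1 ⌊t⌋₊, χ (k : ZMod N)) :=
    (measurable_from_nat (f := fun n : ℕ => ∑ k ∈ Finset.Icc 1 n, χ (k : ZMod N))).comp
      Nat.measurable_floor
  refine eqOn_re_pos_of_eqOn_one_lt_re (f := DirichletCharacter.LFunction χ)
    (g := fun s => s * tailMellin (fun t => ∑ k ∈ Finset.Icc 1 ⌊t⌋₊, χ (k : ZMod N)) s)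
    (χ.differentiable_LFunction hχ).differentiableOn
    (differentiableOn_id.mul (differentiableOn_tailMellin hb fun t => norm_sum_Icc_le hχ _)) ?_ hs
  intro z hz
  rw [DirichletCharacter.LFunction_eq_LSeries χ hz]
  refine LSeries_eq_mul_integral _ le_rfl (by linarith) (χ.LSeriesSummable_of_one_lt_re hz) ?_
  refine Asymptotics.IsBigO.of_bound (2 * N) ?_
  filter_upwards with n
  simpa using norm_sum_Icc_le hχ n

lemma DirichletCharacter.norm_LFunction_le {N : ℕ} [NeZero N] {χ : DirichletCharacter ℂ N}
    (hχ : χ ≠ 1) {s : ℂ} (hs : 1 / 2 ≤ s.re) :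
    ‖DirichletCharacter.LFunction χ s‖ ≤ 4 * N * ‖s‖ := by
  have h0 : 0 < s.re := by linarith
  rw [LFunction_eq_tailMellin hχ h0, norm_mul]
  have h := norm_tailMellin_le (b := fun t => ∑ k ∈ Finset.Icc 1 ⌊t⌋₊, χ (k : ZMod N))
    (B := 2 * N) (fun t => norm_sum_Icc_le hχ _) h0
  have h2 : (2 * N : ℝ) / s.re ≤ 4 * N := by
    rw [div_le_iff₀ h0]; nlinarith [Nat.cast_nonneg (α := ℝ) N]
  calc _ ≤ ‖s‖ * (4 * N) := by gcongr; exact h.trans h2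
    _ = _ := by ring

/-- `(s - 1) ζ(s)`, continued holomorphically to `Re s > 0`. -/
def zetaMul (s : ℂ) : ℂ :=
  s - s * (s - 1) * tailMellin (fun t => if 1 ≤ t then ((t - ⌊t⌋₊ : ℝ) : ℂ) else 0) s

lemma norm_fractPart_le (t : ℝ) : ‖(if 1 ≤ t then ((t - ⌊t⌋₊ : ℝ) : ℂ) else 0)‖ ≤ 1 := by
  split_ifs with h
  · rw [norm_real, Real.norm_eq_abs, abs_le]
    constructor <;> linarith [Nat.floor_le (by linarith : 0 ≤ t), Nat.lt_floor_add_one t]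
  · simp

lemma measurable_fractPart :
    Measurable (fun t : ℝ => if 1 ≤ t then ((t - ⌊t⌋₊ : ℝ) : ℂ) else 0) := by
  refine Measurable.ite measurableSet_Ici ?_ measurable_const
  exact measurable_ofReal.comp (measurable_id.sub ((measurable_from_nat (f := fun n : ℕ => (n:ℝ))).comp
      Nat.measurable_floor))

lemma differentiableOn_zetaMul : DifferentiableOn ℂ zetaMul {s | 0 < s.re} := by
  have := differentiableOn_tailMellin measurable_fractPart norm_fractPart_le
  unfold zetaMul
  exact differentiableOn_id.sub
    ((differentiableOn_id.mul (differentiableOn_id.sub_const 1)).mul this)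

lemma norm_zetaMul_le {s : ℂ} (hs : 1 / 2 ≤ s.re) : ‖zetaMul s‖ ≤ 2 * ‖s‖ * (‖s‖ + 2) := by
  have h0 : 0 < s.re := by linarith
  have h := norm_tailMellin_le norm_fractPart_le h0
  have h2 : 1 / s.re ≤ 2 := by rw [div_le_iff₀ h0]; linarith
  unfold zetaMul
  calc _ ≤ ‖s‖ + ‖s‖ * ‖s - 1‖ * ‖tailMellin _ s‖ := by
        refine (norm_sub_le _ _).trans ?_; rw [norm_mul, norm_mul]
    _ ≤ ‖s‖ + ‖s‖ * (‖s‖ + 1) * 2 := by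
        gcongr
        · exact (norm_sub_le _ _).trans (by simp)
        · exact h.trans h2
    _ ≤ _ := by nlinarith [norm_nonneg s]

lemma zetaMul_eq_of_one_lt_re {s : ℂ} (hs : 1 < s.re) : zetaMul s = (s - 1) * riemannZeta s := by
  have hs0 : 0 < s.re := by linarith
  have h1 : riemannZeta s = s * ∫ t in Ioi (1 : ℝ), ((⌊t⌋₊ : ℂ)) * (t : ℂ) ^ (-(s + 1)) := by
    rw [← LSeries_one_eq_riemannZeta hs, LSeries_eq_mul_integral (r := 1) _ zero_le_one hs
      (LSeriesSummable_one_iff.2 hs)]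
    · simp
    · refine Asymptotics.IsBigO.of_bound 1 ?_
      filter_upwards with n
      simp
  have hre : (-(s+1)).re < -1 := by simp; linarith
  have hre' : (-s).re < -1 := by simp; linarith
  have hI : IntegrableOn (fun t : ℝ => (t:ℂ) * (t : ℂ) ^ (-(s + 1))) (Ioi 1) := by
    refine (integrableOn_Ioi_cpow_of_lt hre' one_pos).congr_fun ?_ measurableSet_Ioi
    intro t ht
    have ht0 : (t:ℂ) ≠ 0 := by exact_mod_cast (lt_trans one_pos ht).ne'
    simp only
    rw [show -s = 1 + -(s+1) by ring, cpow_add _ _ ht0, cpow_one]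
  have hb : IntegrableOn (fun t : ℝ => (if 1 ≤ t then ((t - ⌊t⌋₊ : ℝ) : ℂ) else 0) *
      (t : ℂ) ^ (-(s + 1))) (Ioi 1) := by
    refine (integrableOn_Ioi_cpow_of_lt hre one_pos).bdd_mul (c := 1)
      measurable_fractPart.aestronglyMeasurable ?_
    filter_upwards with t using norm_fractPart_le t
  have h2 : ∫ t in Ioi (1 : ℝ), ((⌊t⌋₊ : ℂ)) * (t : ℂ) ^ (-(s + 1)) =
      (∫ t in Ioi (1 : ℝ), (t:ℂ) * (t : ℂ) ^ (-(s + 1))) -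
      tailMellin (fun t => if 1 ≤ t then ((t - ⌊t⌋₊ : ℝ) : ℂ) else 0) s := by
    unfold tailMellin
    rw [← integral_sub hI hb]
    refine setIntegral_congr_fun measurableSet_Ioi ?_
    intro t ht
    have : (1:ℝ) ≤ t := le_of_lt ht
    simp only [this, if_true]; push_cast; ring
  have h3 : (∫ t in Ioi (1 : ℝ), (t:ℂ) * (t : ℂ) ^ (-(s + 1))) = 1 / (s - 1) := by
    have : ∫ t in Ioi (1 : ℝ), (t:ℂ) * (t : ℂ) ^ (-(s + 1)) = ∫ t in Ioi (1 : ℝ), (t : ℂ) ^ (-s) := by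
      refine setIntegral_congr_fun measurableSet_Ioi ?_
      intro t ht
      have ht0 : (t:ℂ) ≠ 0 := by exact_mod_cast (lt_trans one_pos ht).ne'
      simp only
      rw [show -s = 1 + -(s+1) by ring, cpow_add _ _ ht0, cpow_one]
    rw [this, integral_Ioi_cpow_of_lt hre' one_pos]
    simp only [ofReal_one, one_cpow]
    rw [show -s + 1 = -(s - 1) by ring, div_neg, neg_div, neg_neg]
  have hne : s - 1 ≠ 0 := by
    intro h; have := congrArg re h; simp at this; linarith
  rw [h1, h2, h3, zetaMul]
  field_simp

lemma zetaMul_eq {s : ℂ} (hs : 0 < s.re) (h1 : s ≠ 1) : zetaMul s = (s - 1) * riemannZeta s := by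
  have hA : Differentiable ℂ (DirichletCharacter.LFunctionTrivChar₁ 1) :=
    DirichletCharacter.differentiable_LFunctionTrivChar₁ 1
  have key : ∀ z : ℂ, z ≠ 1 → DirichletCharacter.LFunctionTrivChar₁ 1 z = (z - 1) * riemannZeta z := by
    intro z hz
    simp [DirichletCharacter.LFunctionTrivChar₁, Function.update_of_ne hz,
      DirichletCharacter.LFunctionTrivChar]
  rw [← key s h1]
  refine eqOn_re_pos_of_eqOn_one_lt_re differentiableOn_zetaMul hA.differentiableOn ?_ hs
  intro z hz
  rw [zetaMul_eq_of_one_lt_re hz, key]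
  rintro rfl; simp at hz

lemma zetaMul_one : zetaMul 1 = 1 := by simp [zetaMul]

end

noncomputable section
open Complex MeasureTheory Set Filter Topology Metric

/-- A nonvanishing holomorphic function on a disk has a holomorphic logarithm. -/
lemma exists_log_of_ne_zero {f : ℂ → ℂ} {R : ℝ} {s₀ : ℂ} (hR : 0 < R)
    (hf : DifferentiableOn ℂ f (ball s₀ R)) (h0 : ∀ z ∈ ball s₀ R, f z ≠ 0) :
    ∃ h : ℂ → ℂ, h s₀ = 0 ∧ (∀ z ∈ ball s₀ R, HasDerivAt h (deriv f z / f z) z) ∧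
      ∀ z ∈ ball s₀ R, f z = f s₀ * exp (h z) := by
  have hd : DifferentiableOn ℂ (fun z => deriv f z / f z) (ball s₀ R) :=
    (hf.deriv isOpen_ball).div hf h0
  obtain ⟨h, hh0, hh⟩ := hd.isExactOn_ball.with_val_at s₀ 0
  refine ⟨h, hh0, hh, fun z hz => ?_⟩
  have hder : ∀ w ∈ ball s₀ R, HasDerivAt (fun w => f w * exp (-h w)) 0 w := by
    intro w hw
    have h1 := (hf.differentiableAt (isOpen_ball.mem_nhds hw)).hasDerivAt
    have h2 := (hh w hw).neg.cexp
    have h3 := h1.mul h2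
    have hz : deriv f w * exp ((-h) w) + f w * (exp ((-h) w) * -(deriv f w / f w)) = 0 := by
      have := h0 w hw
      field_simp
      ring
    rw [hz] at h3
    exact h3
  have hconst := (convex_ball s₀ R).is_const_of_fderivWithin_eq_zero (𝕜 := ℂ)
    (f := fun w => f w * exp (-h w))
    (fun w hw => (hder w hw).differentiableAt.differentiableWithinAt)
    (fun w hw => by
      rw [fderivWithin_of_isOpen isOpen_ball hw]
      ext
      simpa using (hder w hw).deriv) hz (mem_ball_self hR)
  simp only [hh0, neg_zero, exp_zero, mul_one] at hconst
  rw [← hconst, mul_assoc, ← exp_add]; simp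

/-- Higher derivatives of the logarithmic derivative of a nonvanishing function of controlled
growth on a disk of radius `3/2`. -/
lemma norm_iteratedDeriv_logDeriv_le {f : ℂ → ℂ} {M : ℝ} (hM : 0 < M) {s₀ : ℂ}
    (hf : DifferentiableOn ℂ f (ball s₀ (3/2))) (h0 : ∀ z ∈ ball s₀ (3/2), f z ≠ 0)
    (hb : ∀ z ∈ ball s₀ (3/2), ‖f z‖ ≤ ‖f s₀‖ * Real.exp M) (j : ℕ) :
    ‖iteratedDeriv j (fun z => deriv f z / f z) s₀‖ ≤
      (j + 1).factorial * (298 * M) / (149 / 100) ^ (j + 1) := by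
  obtain ⟨h, hh0, hh, hexp⟩ := exists_log_of_ne_zero (by norm_num) hf h0
  have hball : s₀ ∈ ball s₀ (3/2 : ℝ) := mem_ball_self (by norm_num)
  have hre : ∀ z ∈ ball s₀ (3/2 : ℝ), (h z).re ≤ M := by
    intro z hz
    have h1 := hb z hz
    rw [hexp z hz, norm_mul, norm_exp] at h1
    have h2 : 0 < ‖f s₀‖ := norm_pos_iff.2 (h0 _ hball)
    exact Real.exp_le_exp.1 (le_of_mul_le_mul_left h1 h2)
  have hdiff : DifferentiableOn ℂ h (ball s₀ (3/2 : ℝ)) := fun z hz =>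
    (hh z hz).differentiableAt.differentiableWithinAt
  have hbc : ∀ z ∈ sphere s₀ (149/100 : ℝ), ‖h z‖ ≤ 298 * M := by
    intro z hz
    have hz' : ‖z - s₀‖ = 149/100 := by simpa [dist_eq_norm] using hz
    have hmaps : MapsTo (fun w : ℂ => w + s₀) (ball 0 (3/2 : ℝ)) (ball s₀ (3/2 : ℝ)) := by
      intro w hw; simpa [dist_eq_norm] using hw
    have := borelCaratheodory_zero (f := fun w => h (w + s₀)) (R := 3/2) (z := z - s₀) hM
      (hdiff.comp (differentiableOn_id.add_const s₀) hmaps)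
      (fun w hw => hre _ (hmaps hw)) (by norm_num)
      (by simp [hz']; norm_num) (by simp [hh0])
    simp only [sub_add_cancel, hz'] at this
    refine this.trans (le_of_eq ?_)
    norm_num; ring
  have hcl : DiffContOnCl ℂ h (ball s₀ (149/100 : ℝ)) := by
    refine DifferentiableOn.diffContOnCl ?_
    rw [closure_ball _ (by norm_num)]
    exact hdiff.mono (closedBall_subset_ball (by norm_num))
  have hc := norm_iteratedDeriv_le_of_forall_mem_sphere_norm_le (j + 1) (by norm_num) hcl hbc
  have heq : iteratedDeriv (j + 1) h s₀ = iteratedDeriv j (fun z => deriv f z / f z) s₀ := by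
    rw [iteratedDeriv_succ']
    refine Filter.EventuallyEq.iteratedDeriv_eq j ?_
    filter_upwards [isOpen_ball.mem_nhds hball] with z hz using (hh z hz).deriv
  rwa [heq] at hc

end

noncomputable section
open Complex MeasureTheory Set Filter Topology Metric

lemma logMul_iterate (f : ℕ → ℂ) (j n : ℕ) :
    (LSeries.logMul^[j] f) n = (Real.log n : ℂ) ^ j * f n := by
  induction j with
  | zero => simp
  | succ j ih =>
    rw [Function.iterate_succ_apply', LSeries.logMul, ih, pow_succ', mul_assoc, natCast_log]

lemma norm_LSeries_moebius_le {f : ℕ → ℂ} (hf : ∀ n, ‖f n‖ ≤ 1) {s : ℂ} (hs : s.re = 2) :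
    ‖LSeries f s‖ ≤ 2 := by
  have hsum : Summable fun n : ℕ => 1 / (n:ℝ) ^ 2 := Real.summable_one_div_nat_pow.2 (by norm_num)
  have hle : ∀ n : ℕ, ‖LSeries.term f s n‖ ≤ 1 / (n:ℝ) ^ 2 := by
    intro n
    rcases Nat.eq_zero_or_pos n with rfl | hn
    · simp
    · rw [LSeries.term_of_ne_zero hn.ne', norm_div, norm_natCast_cpow_of_pos hn, hs]
      norm_cast
      gcongr
      exact hf n
  calc ‖LSeries f s‖ ≤ ∑' n : ℕ, 1 / (n:ℝ) ^ 2 :=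
        tsum_of_norm_bounded hsum.hasSum hle
    _ = Real.pi ^ 2 / 6 := hasSum_zeta_two.tsum_eq
    _ ≤ 2 := by nlinarith [Real.pi_gt_three, Real.pi_lt_d2]

lemma re_gt_of_mem_ball {t : ℝ} {z : ℂ} (hz : z ∈ ball (2 + t * I : ℂ) (3/2)) : 1/2 < z.re := by
  have h := (abs_re_le_norm (z - (2 + t * I))).trans_lt (mem_ball_iff_norm.1 hz)
  have h2 := (abs_lt.1 h).1
  simp at h2; linarith

lemma norm_lt_of_mem_ball_two_add {t : ℝ} {z : ℂ} (hz : z ∈ ball (2 + t * I : ℂ) (3/2)) :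
    ‖z‖ < |t| + 4 := by
  have h := mem_ball_iff_norm.1 hz
  have h1 : ‖(2 + t * I : ℂ)‖ ≤ 2 + |t| := (norm_add_le _ _).trans (by simp)
  calc ‖z‖ = ‖(z - (2 + t * I)) + (2 + t * I)‖ := by ring_nf
    _ ≤ ‖z - (2 + t * I)‖ + ‖(2 + t * I : ℂ)‖ := norm_add_le _ _
    _ < _ := by linarith

lemma GRH.LFunction_ne_zero (h : GRH) {N : ℕ} [NeZero N] {χ : DirichletCharacter ℂ N}
    (hχ : χ ≠ 1) {s : ℂ} (hs : 1 / 2 < s.re) : DirichletCharacter.LFunction χ s ≠ 0 := by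
  intro h0
  by_cases h1 : 1 ≤ s.re
  · exact DirichletCharacter.LFunction_ne_zero_of_one_le_re χ (Or.inl hχ) h1 h0
  · have := h.2 N χ s (by linarith) (by linarith) h0
    linarith

lemma GRH.zetaMul_ne_zero (h : GRH) {s : ℂ} (hs : 1 / 2 < s.re) : zetaMul s ≠ 0 := by
  by_cases hs1 : s = 1
  · rw [hs1, zetaMul_one]; exact one_ne_zero
  rw [zetaMul_eq (by linarith) hs1]
  refine mul_ne_zero (sub_ne_zero.2 hs1) fun h0 => ?_
  by_cases h1 : 1 ≤ s.re
  · exact riemannZeta_ne_zero_of_one_le_re h1 h0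
  · have := h.1 s (by linarith) (by linarith) h0
    linarith

/-- Under GRH, smooth sums of `χ(n) Λ(n) n^{-it}` have power-saving cancellation. -/
lemma GRH.norm_LSeries_twist_le (h : GRH) {N : ℕ} [NeZero N] {χ : DirichletCharacter ℂ N}
    (hχ : χ ≠ 1) (t : ℝ) (j : ℕ) :
    ‖LSeries (LSeries.logMul^[j] fun n => χ n * (ArithmeticFunction.vonMangoldt n : ℂ))
      (2 + t * I)‖ ≤
      (j + 1).factorial * (596 * Real.log (8 * N * (|t| + 6))) / (149 / 100) ^ (j + 1) := by
  set s₀ : ℂ := 2 + t * I with hs₀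
  have hre : s₀.re = 2 := by simp [hs₀]
  have hN : (1:ℝ) ≤ N := by exact_mod_cast Nat.one_le_iff_ne_zero.2 (NeZero.ne N)
  have habs := abs_nonneg t
  set M := Real.log (8 * N * (|t| + 6)) with hMdef
  have hpos : (1:ℝ) < 8 * N * (|t| + 6) := by nlinarith
  have hM : 0 < M := Real.log_pos hpos
  have hlow : 1 / 2 ≤ ‖DirichletCharacter.LFunction χ s₀‖ := by
    have h1 := DirichletCharacter.LSeries.mul_mu_eq_one χ (s := s₀) (by rw [hre]; norm_num)
    have h2 := norm_LSeries_moebius_le (s := s₀)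
      (f := (fun n : ℕ => χ n) * fun n : ℕ => (ArithmeticFunction.moebius n : ℂ)) (fun n => by
        simp only [Pi.mul_apply, norm_mul]
        refine mul_le_one₀ (χ.norm_le_one _) (norm_nonneg _) ?_
        have := @ArithmeticFunction.abs_moebius_le_one n
        rw [norm_intCast]
        exact_mod_cast this) hre
    rw [DirichletCharacter.LFunction_eq_LSeries χ (by rw [hre]; norm_num)]
    have h3 := congrArg norm h1
    rw [norm_mul, norm_one] at h3
    nlinarith [norm_nonneg (LSeries (fun n : ℕ => χ n) s₀)]
  have hmain := norm_iteratedDeriv_logDeriv_le (f := DirichletCharacter.LFunction χ) hM (s₀ := s₀)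
    (χ.differentiable_LFunction hχ).differentiableOn
    (fun z hz => h.LFunction_ne_zero hχ (re_gt_of_mem_ball hz))
    (fun z hz => by
      rw [hMdef, Real.exp_log (by linarith)]
      have h1 := DirichletCharacter.norm_LFunction_le hχ (re_gt_of_mem_ball hz).le
      have h2 := norm_lt_of_mem_ball_two_add hz
      calc _ ≤ 4 * N * ‖z‖ := h1
        _ ≤ 4 * N * (|t| + 6) := by gcongr; linarith
        _ = 1 / 2 * (8 * N * (|t| + 6)) := by ring
        _ ≤ _ := by gcongr) j
  have habsc : LSeries.abscissaOfAbsConv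
      (fun n : ℕ => χ n * (ArithmeticFunction.vonMangoldt n : ℂ)) < s₀.re := by
    have h1 : LSeries.abscissaOfAbsConv
      (fun n : ℕ => χ n * (ArithmeticFunction.vonMangoldt n : ℂ)) ≤ (1:ℝ) := by
      refine LSeries.abscissaOfAbsConv_le_of_forall_lt_LSeriesSummable fun y hy => ?_
      exact DirichletCharacter.LSeriesSummable_twist_vonMangoldt χ (by simpa using hy)
    refine h1.trans_lt ?_
    rw [hre]; exact_mod_cast one_lt_two
  have hit := LSeries_iteratedDeriv j habsc
  have heq : iteratedDeriv j (LSeries fun n : ℕ => χ n * (ArithmeticFunction.vonMangoldt n : ℂ)) s₀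
      = iteratedDeriv j (fun z => -(deriv (DirichletCharacter.LFunction χ) z /
        DirichletCharacter.LFunction χ z)) s₀ := by
    refine Filter.EventuallyEq.iteratedDeriv_eq j ?_
    have hopen : IsOpen {z : ℂ | 1 < z.re} := isOpen_lt continuous_const continuous_re
    filter_upwards [hopen.mem_nhds (show 1 < s₀.re by rw [hre]; norm_num)] with z hz
    have h1 := DirichletCharacter.LSeries_twist_vonMangoldt_eq χ (s := z) hz
    have h2 : deriv (LSeries fun n : ℕ => χ n) z = deriv (DirichletCharacter.LFunction χ) z := by
      refine Filter.EventuallyEq.deriv_eq ?_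
      filter_upwards [hopen.mem_nhds hz] with w hw
      rw [DirichletCharacter.LFunction_eq_LSeries χ hw]
    rw [h2, ← DirichletCharacter.LFunction_eq_LSeries χ hz, neg_div] at h1
    exact h1
  rw [iteratedDeriv_fun_neg] at heq
  rw [heq] at hit
  have hn := congrArg norm hit
  rw [norm_neg, norm_mul, norm_pow, norm_neg, norm_one, one_pow, one_mul] at hn
  rw [← hn]
  refine hmain.trans ?_
  gcongr
  linarith

/-- Under RH, smooth sums of `Λ(n) n^{-it}` are well approximated by the contribution of the
pole of `ζ`. -/
lemma GRH.norm_LSeries_vonMangoldt_sub_le (h : GRH) (t : ℝ) (j : ℕ) :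
    ‖LSeries (LSeries.logMul^[j] fun n => (ArithmeticFunction.vonMangoldt n : ℂ))
      (2 + t * I) - j.factorial / (1 + t * I) ^ (j + 1)‖ ≤
      (j + 1).factorial * (596 * Real.log (8 * (|t| + 6))) / (149 / 100) ^ (j + 1) := by
  set s₀ : ℂ := 2 + t * I with hs₀
  have hre : s₀.re = 2 := by simp [hs₀]
  have habs := abs_nonneg t
  set M := 2 * Real.log (8 * (|t| + 6)) with hMdef
  have hpos : (1:ℝ) < 8 * (|t| + 6) := by nlinarith
  have hM : 0 < M := mul_pos two_pos (Real.log_pos hpos)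
  have hone : 1 ≤ ‖s₀ - 1‖ := by
    have := abs_re_le_norm (s₀ - 1)
    simp [hre] at this
    refine le_trans ?_ this
    norm_num
  have hlow : 1 / 2 ≤ ‖zetaMul s₀‖ := by
    have h1 := ArithmeticFunction.LSeries_zeta_mul_Lseries_moebius (s := s₀) (by rw [hre]; norm_num)
    rw [ArithmeticFunction.LSeries_zeta_eq_riemannZeta (by rw [hre]; norm_num)] at h1
    have h2 := norm_LSeries_moebius_le (s := s₀)
      (f := fun n : ℕ => (ArithmeticFunction.moebius n : ℂ)) (fun n => by
        have := @ArithmeticFunction.abs_moebius_le_one n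
        rw [norm_intCast]
        exact_mod_cast this) hre
    rw [zetaMul_eq_of_one_lt_re (by rw [hre]; norm_num), norm_mul]
    have h3 := congrArg norm h1
    rw [norm_mul, norm_one] at h3
    nlinarith [norm_nonneg (riemannZeta s₀)]
  have hsub : ball s₀ (3/2) ⊆ {s : ℂ | 0 < s.re} := fun z hz => by
    have := re_gt_of_mem_ball hz
    show 0 < z.re; linarith
  have hmain := norm_iteratedDeriv_logDeriv_le (f := zetaMul) hM (s₀ := s₀)
    (differentiableOn_zetaMul.mono hsub)
    (fun z hz => h.zetaMul_ne_zero (re_gt_of_mem_ball hz))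
    (fun z hz => by
      rw [hMdef, two_mul, Real.exp_add, Real.exp_log (by linarith)]
      have h1 := norm_zetaMul_le (re_gt_of_mem_ball hz).le
      have h2 := norm_lt_of_mem_ball_two_add hz
      calc _ ≤ 2 * ‖z‖ * (‖z‖ + 2) := h1
        _ ≤ 2 * (|t| + 6) * (|t| + 6) := mul_le_mul (by linarith) (by linarith)
          (by positivity) (by positivity)
        _ ≤ 1 / 2 * (8 * (|t| + 6) * (8 * (|t| + 6))) := by nlinarith
        _ ≤ _ := by gcongr) j
  have habsc : LSeries.abscissaOfAbsConv
      (fun n : ℕ => (ArithmeticFunction.vonMangoldt n : ℂ)) < s₀.re := by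
    have h1 : LSeries.abscissaOfAbsConv
      (fun n : ℕ => (ArithmeticFunction.vonMangoldt n : ℂ)) ≤ (1:ℝ) := by
      refine LSeries.abscissaOfAbsConv_le_of_forall_lt_LSeriesSummable fun y hy => ?_
      exact ArithmeticFunction.LSeriesSummable_vonMangoldt (by simpa using hy)
    refine h1.trans_lt ?_
    rw [hre]; exact_mod_cast one_lt_two
  have hit := LSeries_iteratedDeriv j habsc
  have hopen : IsOpen {z : ℂ | 1 < z.re} := isOpen_lt continuous_const continuous_re
  have hs₀1 : s₀ ∈ {z : ℂ | 1 < z.re} := show 1 < s₀.re by rw [hre]; norm_num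
  have heq : iteratedDeriv j (LSeries fun n : ℕ => (ArithmeticFunction.vonMangoldt n : ℂ)) s₀
      = iteratedDeriv j ((fun z => (1 * z - 1)⁻¹) - fun z => deriv zetaMul z / zetaMul z) s₀ := by
    refine Filter.EventuallyEq.iteratedDeriv_eq j ?_
    filter_upwards [hopen.mem_nhds hs₀1] with z hz
    have hz1 : z - 1 ≠ 0 := by
      intro h0; have := congrArg re h0; simp at this
      have hz : 1 < z.re := hz
      linarith
    rw [ArithmeticFunction.LSeries_vonMangoldt_eq_deriv_riemannZeta_div hz]
    have hd : deriv zetaMul z = riemannZeta z + (z - 1) * deriv riemannZeta z := by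
      have : deriv zetaMul z = deriv (fun w => (w - 1) * riemannZeta w) z := by
        refine Filter.EventuallyEq.deriv_eq ?_
        filter_upwards [hopen.mem_nhds hz] with w hw
        exact zetaMul_eq_of_one_lt_re hw
      rw [this]
      have h2 := ((hasDerivAt_id z).sub_const 1).mul
        (differentiableAt_riemannZeta (sub_ne_zero.1 hz1)).hasDerivAt
      have h3 := h2.deriv
      simp only [id, one_mul] at h3
      exact h3
    simp only [Pi.sub_apply]
    rw [hd, zetaMul_eq_of_one_lt_re hz]
    have := riemannZeta_ne_zero_of_one_lt_re hz
    rw [one_mul]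
    field_simp
    ring
  have hball : s₀ ∈ ball s₀ (3/2 : ℝ) := mem_ball_self (by norm_num)
  have hcd : ContDiffAt ℂ j (fun z => deriv zetaMul z / zetaMul z) s₀ := by
    have hz := differentiableOn_zetaMul.mono hsub
    exact (((hz.deriv isOpen_ball).div hz
      (fun z hz => h.zetaMul_ne_zero (re_gt_of_mem_ball hz))).analyticAt
        (isOpen_ball.mem_nhds hball)).contDiffAt
  have hne : (1:ℂ) * s₀ - 1 ≠ 0 := by
    intro h0; have := congrArg re h0; simp [hre] at this; norm_num at this
  have hcd1 : ContDiffAt ℂ j (fun z : ℂ => (1 * z - 1)⁻¹) s₀ :=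
    ((contDiffAt_const.mul contDiffAt_id).sub contDiffAt_const).inv hne
  rw [iteratedDeriv_sub hcd1 hcd, iteratedDeriv_eq_iterate (f := fun z : ℂ => (1 * z - 1)⁻¹),
    iter_deriv_inv_linear_sub] at heq
  rw [heq] at hit
  have h1t : (1 * s₀ - 1 : ℂ) = 1 + t * I := by rw [hs₀]; ring
  have hsgn : ((-1 : ℂ) ^ j) * (-1) ^ j = 1 := by rw [← mul_pow]; simp
  have hzp : (1 + t * I : ℂ) ^ (-1 - (j:ℤ)) = 1 / (1 + t * I) ^ (j + 1) := by
    rw [show (-1 - (j:ℤ)) = -((j + 1 : ℕ) : ℤ) by push_cast; ring, zpow_neg, zpow_natCast, one_div]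
  have hfin : LSeries (LSeries.logMul^[j] fun n => (ArithmeticFunction.vonMangoldt n : ℂ)) s₀
      - j.factorial / (1 + t * I) ^ (j + 1) =
      -((-1) ^ j * iteratedDeriv j (fun z => deriv zetaMul z / zetaMul z) s₀) := by
    simp only [h1t, one_pow, mul_one] at hit
    rw [hzp] at hit
    have := congrArg (fun z => (-1 : ℂ) ^ j * z) hit
    rw [← mul_assoc ((-1:ℂ)^j) ((-1)^j), hsgn, one_mul] at this
    rw [← this]
    linear_combination ((j.factorial:ℂ) / (1 + t * I) ^ (j + 1)) * hsgn
  rw [hfin, norm_neg, norm_mul, norm_pow, norm_neg, norm_one, one_pow, one_mul]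
  refine hmain.trans (le_of_eq ?_)
  rw [hMdef]; ring

end

noncomputable section
open Complex MeasureTheory Set Filter Topology Metric
open scoped ArithmeticFunction.vonMangoldt

/-- The weight `Λ(n) n^{-2} (log n)^j / j!`. -/
def gammaWeight (j n : ℕ) : ℝ := Λ n * (n : ℝ) ^ (-2 : ℝ) * (Real.log n ^ j / j.factorial)

lemma gammaWeight_nonneg (j n : ℕ) : 0 ≤ gammaWeight j n := by
  unfold gammaWeight
  have := Real.log_natCast_nonneg n
  have := ArithmeticFunction.vonMangoldt_nonneg (n := n)
  positivity

lemma log_pow_div_factorial_le {θ : ℝ} (hθ : 0 < θ) (j : ℕ) {n : ℕ} (hn : 0 < n) :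
    Real.log n ^ j / j.factorial ≤ θ⁻¹ ^ j * (n : ℝ) ^ θ := by
  have hl := Real.log_natCast_nonneg n
  have h := Real.pow_div_factorial_le_exp (θ * Real.log n) (by positivity) j
  rw [Real.rpow_def_of_pos (by exact_mod_cast hn), mul_comm (Real.log n)]
  calc Real.log n ^ j / j.factorial
      = θ⁻¹ ^ j * ((θ * Real.log n) ^ j / j.factorial) := by
        rw [mul_pow, inv_pow]; field_simp
    _ ≤ _ := by gcongr

lemma gammaWeight_le {θ : ℝ} (hθ : 0 < θ) (j n : ℕ) :
    gammaWeight j n ≤ θ⁻¹ ^ j * (Λ n * (n : ℝ) ^ (θ - 2)) := by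
  rcases Nat.eq_zero_or_pos n with rfl | hn
  · simp [gammaWeight]
  have h := log_pow_div_factorial_le hθ j hn
  have h0 := ArithmeticFunction.vonMangoldt_nonneg (n := n)
  have hn' : (0:ℝ) < n := by exact_mod_cast hn
  calc gammaWeight j n ≤ Λ n * (n : ℝ) ^ (-2 : ℝ) * (θ⁻¹ ^ j * (n : ℝ) ^ θ) := by
        unfold gammaWeight; gcongr
    _ = _ := by
        rw [show θ - 2 = -2 + θ by ring, Real.rpow_add hn']; ring

lemma summable_vonMangoldt_rpow {a : ℝ} (ha : a < -1) :
    Summable fun n : ℕ => Λ n * (n : ℝ) ^ a := by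
  have h := (ArithmeticFunction.LSeriesSummable_vonMangoldt (s := ((-a : ℝ) : ℂ))
    (by simp; linarith)).norm
  refine h.congr fun n => ?_
  rcases Nat.eq_zero_or_pos n with rfl | hn
  · simp
  rw [LSeries.term_of_ne_zero hn.ne', norm_div, norm_natCast_cpow_of_pos hn, norm_real,
    Real.norm_of_nonneg ArithmeticFunction.vonMangoldt_nonneg]
  simp [Real.rpow_neg, div_eq_mul_inv]

/-- `Λ` restricted to proper prime powers. -/
def properPowWeight (n : ℕ) : ℝ := if n.Prime then 0 else Λ n * (n : ℝ) ^ (-(51/100) : ℝ)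

lemma properPowWeight_nonneg (n : ℕ) : 0 ≤ properPowWeight n := by
  unfold properPowWeight
  have := ArithmeticFunction.vonMangoldt_nonneg (n := n)
  split_ifs <;> positivity

lemma summable_properPowWeight : Summable properPowWeight := by
  have hinj : Function.Injective (Subtype.val : {n : ℕ // IsPrimePow n} → ℕ) :=
    Subtype.val_injective
  rw [← hinj.summable_iff (by
    intro n hn
    have : ¬ IsPrimePow n := fun h => hn ⟨⟨n, h⟩, rfl⟩
    simp [properPowWeight, ArithmeticFunction.vonMangoldt_eq_zero_iff.2 this]),
    ← Nat.Primes.prodNatEquiv.summable_iff]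
  have hs1 : Summable fun p : Nat.Primes => ((p : ℕ) : ℝ) ^ (-(101/100) : ℝ) :=
    (Real.summable_nat_rpow.2 (by norm_num)).subtype _
  have hs2 : Summable fun k : ℕ => ((2:ℝ) ^ (-(51/100) : ℝ)) ^ k := by
    refine summable_geometric_of_lt_one (by positivity) ?_
    exact Real.rpow_lt_one_of_one_lt_of_neg (by norm_num) (by norm_num)
  have hs := (hs1.mul_of_nonneg hs2 (fun p => by positivity) (fun k => by positivity)).mul_left
    (100 * (2:ℝ) ^ (51/100 : ℝ))
  refine Summable.of_nonneg_of_le (fun _ => properPowWeight_nonneg _) (fun ⟨p, k⟩ => ?_) hs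
  have hp := p.2
  have hp0 : (0:ℝ) < (p:ℕ) := by exact_mod_cast hp.pos
  have hp2 : (2:ℝ) ≤ (p:ℕ) := by exact_mod_cast hp.two_le
  simp only [Function.comp_apply, Nat.Primes.prodNatEquiv_apply]
  rcases Nat.eq_zero_or_pos k with rfl | hk
  · have : properPowWeight ((p:ℕ) ^ (0 + 1)) = 0 := by simp [properPowWeight, hp]
    rw [this]; positivity
  have h1 : properPowWeight ((p:ℕ) ^ (k + 1)) ≤
      Real.log (p:ℕ) * (((p:ℕ):ℝ) ^ (k + 1)) ^ (-(51/100) : ℝ) := by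
    unfold properPowWeight
    split_ifs with hpr
    · have := Real.log_natCast_nonneg (p:ℕ); positivity
    · rw [ArithmeticFunction.vonMangoldt_apply_pow (by omega),
        ArithmeticFunction.vonMangoldt_apply_prime hp]
      push_cast; rfl
  have h2 : Real.log (p:ℕ) ≤ 100 * ((p:ℕ):ℝ) ^ (1/100 : ℝ) := by
    have := Real.log_le_rpow_div hp0.le (show (0:ℝ) < 1/100 by norm_num)
    linarith
  have h3 : (((p:ℕ):ℝ) ^ (k + 1)) ^ (-(51/100) : ℝ) ≤
      ((p:ℕ):ℝ) ^ (-(102/100) : ℝ) * ((2:ℝ) ^ (51/100 : ℝ) * ((2:ℝ) ^ (-(51/100) : ℝ)) ^ k) := by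
    obtain ⟨m, rfl⟩ : ∃ m, k = m + 1 := ⟨k - 1, by omega⟩
    have e1 : (((p:ℕ):ℝ) ^ (m + 1 + 1)) ^ (-(51/100) : ℝ) =
        ((p:ℕ):ℝ) ^ (-(102/100) : ℝ) * (((p:ℕ):ℝ) ^ (-(51/100) : ℝ)) ^ m := by
      rw [← Real.rpow_natCast, ← Real.rpow_mul hp0.le, ← Real.rpow_natCast (_ ^ _) m,
        ← Real.rpow_mul hp0.le, ← Real.rpow_add hp0]
      congr 1; push_cast; ring
    have e2 : (2:ℝ) ^ (51/100 : ℝ) * ((2:ℝ) ^ (-(51/100) : ℝ)) ^ (m + 1) =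
        ((2:ℝ) ^ (-(51/100) : ℝ)) ^ m := by
      rw [pow_succ, Real.rpow_neg (by norm_num)]
      field_simp
    rw [e1, e2]
    have e3 : ((p:ℕ):ℝ) ^ (-(51/100) : ℝ) ≤ (2:ℝ) ^ (-(51/100) : ℝ) :=
      Real.rpow_le_rpow_of_nonpos (by norm_num) hp2 (by norm_num)
    gcongr
  calc _ ≤ _ := h1
    _ ≤ 100 * ((p:ℕ):ℝ) ^ (1/100 : ℝ) * (((p:ℕ):ℝ) ^ (-(102/100) : ℝ) *
        ((2:ℝ) ^ (51/100 : ℝ) * ((2:ℝ) ^ (-(51/100) : ℝ)) ^ k)) := by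
        gcongr
    _ = _ := by
        rw [show (-(101/100) : ℝ) = 1/100 + -(102/100) by norm_num, Real.rpow_add hp0]; ring

/-- The primes in `(e^{j/4}, e^{4 j}]`. -/
def primeRange (j : ℕ) : Finset ℕ :=
  (Finset.range (⌊Real.exp (4 * j)⌋₊ + 1)).filter fun p => p.Prime ∧ Real.exp (j / 4) < p

lemma mem_primeRange {j p : ℕ} :
    p ∈ primeRange j ↔ p.Prime ∧ Real.exp (j / 4) < p ∧ (p : ℝ) ≤ Real.exp (4 * j) := by
  have : p < ⌊Real.exp (4 * j)⌋₊ + 1 ↔ (p : ℝ) ≤ Real.exp (4 * j) := by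
    rw [Nat.lt_succ_iff, Nat.le_floor_iff (Real.exp_pos _).le]
  simp only [primeRange, Finset.mem_filter, Finset.mem_range, this]
  tauto

lemma gammaWeight_le_of_notMem {j n : ℕ} (hn : n ∉ primeRange j) :
    gammaWeight j n ≤ (100 / 149) ^ j * (Λ n * (n : ℝ) ^ (-(5/4) : ℝ) + properPowWeight n) := by
  have hΛ := ArithmeticFunction.vonMangoldt_nonneg (n := n)
  rcases Nat.eq_zero_or_pos n with rfl | hn0
  · simp [gammaWeight, properPowWeight]
  have hn' : (0:ℝ) < n := by exact_mod_cast hn0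
  by_cases hp : n.Prime
  · have hprop : properPowWeight n = 0 := by simp [properPowWeight, hp]
    rw [hprop, add_zero]
    rw [mem_primeRange] at hn
    by_cases hlow : Real.exp (j / 4) < n
    · have hhigh : Real.exp (4 * j) < n := by
        by_contra hc; exact hn ⟨hp, hlow, not_lt.1 hc⟩
      have h1 := gammaWeight_le (θ := 1/4) (by norm_num) j n
      have h2 : (n:ℝ) ^ (-(1/2) : ℝ) ≤ Real.exp (-2) ^ j := by
        calc (n:ℝ) ^ (-(1/2) : ℝ) ≤ Real.exp (4 * j) ^ (-(1/2) : ℝ) :=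
              Real.rpow_le_rpow_of_nonpos (Real.exp_pos _) hhigh.le (by norm_num)
          _ = Real.exp (-2) ^ j := by
              rw [← Real.exp_mul, ← Real.exp_nat_mul]; congr 1; ring
      calc gammaWeight j n ≤ _ := h1
        _ = (1/4 : ℝ)⁻¹ ^ j * (n:ℝ) ^ (-(1/2) : ℝ) * (Λ n * (n : ℝ) ^ (-(5/4) : ℝ)) := by
            rw [show (1/4 - 2 : ℝ) = -(1/2) + -(5/4) by norm_num, Real.rpow_add hn']; ring
        _ ≤ (1/4 : ℝ)⁻¹ ^ j * Real.exp (-2) ^ j * (Λ n * (n : ℝ) ^ (-(5/4) : ℝ)) := by gcongr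
        _ ≤ _ := by
            rw [← mul_pow]
            gcongr
            have : Real.exp (-2) ≤ 25/149 := by
              rw [Real.exp_neg, inv_le_comm₀ (Real.exp_pos _) (by norm_num),
                show (2:ℝ) = 1 + 1 by norm_num, Real.exp_add]
              nlinarith [Real.exp_one_gt_d9]
            norm_num; linarith
    · have h1 := gammaWeight_le (θ := 3) (by norm_num) j n
      have h2 : (n:ℝ) ^ (9/4 : ℝ) ≤ Real.exp (9/16) ^ j := by
        calc (n:ℝ) ^ (9/4 : ℝ) ≤ Real.exp (j / 4) ^ (9/4 : ℝ) := by
              gcongr; exact not_lt.1 hlow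
          _ = Real.exp (9/16) ^ j := by
              rw [← Real.exp_mul, ← Real.exp_nat_mul]; congr 1; ring
      calc gammaWeight j n ≤ _ := h1
        _ = (3 : ℝ)⁻¹ ^ j * (n:ℝ) ^ (9/4 : ℝ) * (Λ n * (n : ℝ) ^ (-(5/4) : ℝ)) := by
            rw [show (3 - 2 : ℝ) = 9/4 + -(5/4) by norm_num, Real.rpow_add hn']; ring
        _ ≤ (3 : ℝ)⁻¹ ^ j * Real.exp (9/16) ^ j * (Λ n * (n : ℝ) ^ (-(5/4) : ℝ)) := by gcongr
        _ ≤ _ := by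
            rw [← mul_pow]
            gcongr
            have h16 : Real.exp (9/16) ≤ 2 := by
              refine le_of_pow_le_pow_left₀ (n := 16) (by norm_num) (by norm_num) ?_
              rw [← Real.exp_nat_mul]
              norm_num
              have := Real.exp_one_lt_d9
              calc Real.exp 9 = Real.exp 1 ^ 9 := by rw [← Real.exp_nat_mul]; norm_num
                _ ≤ 2.7182818286 ^ 9 := by gcongr
                _ ≤ _ := by norm_num
            norm_num; linarith
  · have h1 := gammaWeight_le (θ := 149/100) (by norm_num) j n
    have h2 : Λ n * (n:ℝ) ^ (149/100 - 2 : ℝ) = properPowWeight n := by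
      rw [properPowWeight, if_neg hp]; norm_num
    rw [h2] at h1
    norm_num at h1 ⊢
    refine h1.trans ?_
    gcongr
    have : 0 ≤ Λ n * (n : ℝ) ^ (-(5/4) : ℝ) := by positivity
    norm_num at this
    linarith

end

noncomputable section
open Complex MeasureTheory Set Filter Topology Metric
open scoped ArithmeticFunction.vonMangoldt

lemma summable_gammaWeight (j : ℕ) : Summable (gammaWeight j) :=
  Summable.of_nonneg_of_le (gammaWeight_nonneg j) (gammaWeight_le (θ := 1/2) (by norm_num) j)
    ((summable_vonMangoldt_rpow (by norm_num)).mul_left _)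

/-- The implied constant in the truncation of `gammaWeight` to `primeRange`. -/
def tailConst : ℝ := ∑' n : ℕ, (Λ n * (n : ℝ) ^ (-(5/4) : ℝ) + properPowWeight n)

lemma summable_tail : Summable fun n : ℕ => Λ n * (n : ℝ) ^ (-(5/4) : ℝ) + properPowWeight n :=
  (summable_vonMangoldt_rpow (by norm_num)).add summable_properPowWeight

lemma tail_nonneg (n : ℕ) : 0 ≤ Λ n * (n : ℝ) ^ (-(5/4) : ℝ) + properPowWeight n := by
  have := ArithmeticFunction.vonMangoldt_nonneg (n := n)
  have := properPowWeight_nonneg n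
  positivity

lemma tailConst_nonneg : 0 ≤ tailConst := tsum_nonneg tail_nonneg

lemma norm_sum_primeRange_sub_tsum_le (j : ℕ) {φ : ℕ → ℂ} (hφ : ∀ n, ‖φ n‖ ≤ 1) :
    ‖∑ p ∈ primeRange j, gammaWeight j p * φ p - ∑' n : ℕ, gammaWeight j n * φ n‖ ≤
      tailConst * (100 / 149) ^ j := by
  have hs : Summable fun n : ℕ => (gammaWeight j n : ℂ) * φ n := by
    refine Summable.of_norm_bounded (summable_gammaWeight j) fun n => ?_
    rw [norm_mul, norm_real, Real.norm_of_nonneg (gammaWeight_nonneg j n)]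
    exact mul_le_of_le_one_right (gammaWeight_nonneg j n) (hφ n)
  rw [← hs.sum_add_tsum_subtype_compl (primeRange j), sub_add_cancel_left, norm_neg]
  have hs2 := (summable_tail.mul_left ((100 / 149 : ℝ) ^ j))
  have hs3 := hs2.subtype (fun x => x ∉ primeRange j)
  refine (tsum_of_norm_bounded hs3.hasSum fun n => ?_).trans ?_
  · rw [norm_mul, norm_real, Real.norm_of_nonneg (gammaWeight_nonneg j n)]
    exact (mul_le_of_le_one_right (gammaWeight_nonneg j n) (hφ n)).trans
      (gammaWeight_le_of_notMem n.2)
  · rw [mul_comm, tailConst, ← tsum_mul_left]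
    exact hs2.tsum_subtype_le _ _ (fun n => by have := tail_nonneg n; positivity)

lemma LSeries_logMul_eq_tsum (j : ℕ) (φ : ℕ → ℂ) (t : ℝ) :
    LSeries (LSeries.logMul^[j] fun n => φ n * (Λ n : ℂ)) (2 + t * I) =
      j.factorial * ∑' n : ℕ, gammaWeight j n * (φ n * (n : ℂ) ^ (-(t * I))) := by
  rw [LSeries, ← tsum_mul_left]
  congr 1; ext n
  rcases Nat.eq_zero_or_pos n with rfl | hn
  · simp [gammaWeight]
  rw [LSeries.term_of_ne_zero hn.ne', logMul_iterate]
  have hn' : (n : ℂ) ≠ 0 := by exact_mod_cast hn.ne'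
  rw [cpow_add _ _ hn', cpow_neg]
  have : (n : ℂ) ^ (2 : ℂ) ≠ 0 := by simp [hn']
  have : (n : ℂ) ^ (t * I) ≠ 0 := by simp [hn']
  have hf : (j.factorial : ℂ) ≠ 0 := by exact_mod_cast j.factorial_ne_zero
  have h2 : (((n : ℝ) ^ (-2 : ℝ) : ℝ) : ℂ) = ((n : ℂ) ^ (2 : ℂ))⁻¹ := by
    rw [ofReal_cpow (Nat.cast_nonneg n)]; push_cast; rw [cpow_neg]
  simp only [gammaWeight, ofReal_mul, ofReal_div, ofReal_pow, ofReal_natCast, h2]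
  field_simp

lemma norm_natCast_cpow_mul_I_le_one (n : ℕ) (t : ℝ) : ‖(n : ℂ) ^ (-(t * I))‖ ≤ 1 := by
  rcases Nat.eq_zero_or_pos n with rfl | hn
  · by_cases h : -(t * I) = 0
    · simp [h]
    · rw [Nat.cast_zero, zero_cpow h]; simp
  · rw [norm_natCast_cpow_of_pos hn]; simp

lemma GRH.norm_sum_twist_le (h : GRH) {N : ℕ} [NeZero N] {χ : DirichletCharacter ℂ N}
    (hχ : χ ≠ 1) (t : ℝ) (j : ℕ) :
    ‖∑ p ∈ primeRange j, gammaWeight j p * (χ p * (p : ℂ) ^ (-(t * I)))‖ ≤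
      (tailConst + (j + 1) * (596 * Real.log (8 * N * (|t| + 6)))) * (100 / 149) ^ j := by
  have h1 := norm_sum_primeRange_sub_tsum_le j (φ := fun n => χ n * (n : ℂ) ^ (-(t * I)))
    (fun n => by
      rw [norm_mul]
      exact mul_le_one₀ (DirichletCharacter.norm_le_one χ _) (norm_nonneg _)
        (norm_natCast_cpow_mul_I_le_one n t))
  have h2 := h.norm_LSeries_twist_le hχ t j
  rw [LSeries_logMul_eq_tsum j (fun n => χ n), norm_mul, norm_natCast] at h2
  have hf : (0:ℝ) < j.factorial := by exact_mod_cast j.factorial_pos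
  have hlog : 0 ≤ Real.log (8 * N * (|t| + 6)) := by
    refine Real.log_nonneg ?_
    have : (1:ℝ) ≤ N := by exact_mod_cast NeZero.one_le
    nlinarith [abs_nonneg t]
  have h3 : ‖∑' n : ℕ, gammaWeight j n * (χ n * (n : ℂ) ^ (-(t * I)))‖ ≤
      (j + 1) * (596 * Real.log (8 * N * (|t| + 6))) * (100 / 149) ^ j := by
    refine le_of_mul_le_mul_left (h2.trans ?_) hf
    rw [Nat.factorial_succ, pow_succ]
    push_cast
    rw [show (100/149 : ℝ) = (149/100)⁻¹ by norm_num, inv_pow]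
    rw [div_le_iff₀ (by positivity)]
    have : ((149/100 : ℝ) ^ j)⁻¹ * (149/100) ^ j = 1 := inv_mul_cancel₀ (by positivity)
    calc _ = (j.factorial:ℝ) * ((j + 1) * (596 * Real.log (8 * N * (|t| + 6)))) * 1 := by ring
      _ ≤ (j.factorial:ℝ) * ((j + 1) * (596 * Real.log (8 * N * (|t| + 6)))) * (149/100) := by
        gcongr; norm_num
      _ = _ := by
        linear_combination (-(j.factorial:ℝ) * ((j + 1) * (596 * Real.log (8 * N * (|t| + 6)))) *
          (149/100)) * this
  rw [← sub_add_cancel (∑ p ∈ primeRange j, (gammaWeight j p : ℂ) * (χ p * (p : ℂ) ^ (-(t * I))))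
    (∑' n : ℕ, (gammaWeight j n : ℂ) * (χ n * (n : ℂ) ^ (-(t * I)))), add_mul]
  exact (norm_add_le _ _).trans (add_le_add h1 h3)

lemma GRH.norm_tsum_sub_le (h : GRH) (t : ℝ) (j : ℕ) :
    ‖∑' n : ℕ, gammaWeight j n * (n : ℂ) ^ (-(t * I)) - 1 / (1 + t * I) ^ (j + 1)‖ ≤
      (j + 1) * (596 * Real.log (8 * (|t| + 6))) * (100 / 149) ^ j := by
  have h2 := h.norm_LSeries_vonMangoldt_sub_le t j
  have e1 := LSeries_logMul_eq_tsum j (fun _ => 1) t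
  simp only [one_mul] at e1
  rw [e1, show (j.factorial : ℂ) * ∑' n : ℕ, gammaWeight j n * (n : ℂ) ^ (-(t * I)) -
    j.factorial / (1 + t * I) ^ (j + 1) = j.factorial * (∑' n : ℕ, gammaWeight j n *
    (n : ℂ) ^ (-(t * I)) - 1 / (1 + t * I) ^ (j + 1)) by ring, norm_mul, norm_natCast] at h2
  have hf : (0:ℝ) < j.factorial := by exact_mod_cast j.factorial_pos
  have hlog : 0 ≤ Real.log (8 * (|t| + 6)) :=
    Real.log_nonneg (by nlinarith [abs_nonneg t])
  refine le_of_mul_le_mul_left (h2.trans ?_) hf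
  rw [Nat.factorial_succ, pow_succ]
  push_cast
  rw [show (100/149 : ℝ) = (149/100)⁻¹ by norm_num, inv_pow]
  rw [div_le_iff₀ (by positivity)]
  have : ((149/100 : ℝ) ^ j)⁻¹ * (149/100) ^ j = 1 := inv_mul_cancel₀ (by positivity)
  calc _ = (j.factorial:ℝ) * ((j + 1) * (596 * Real.log (8 * (|t| + 6)))) * 1 := by ring
    _ ≤ (j.factorial:ℝ) * ((j + 1) * (596 * Real.log (8 * (|t| + 6)))) * (149/100) := by
      gcongr; norm_num
    _ = _ := by
      linear_combination (-(j.factorial:ℝ) * ((j + 1) * (596 * Real.log (8 * (|t| + 6)))) *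
          (149/100)) * this

lemma GRH.norm_sum_cpow_sub_le (h : GRH) (t : ℝ) (j : ℕ) :
    ‖∑ p ∈ primeRange j, gammaWeight j p * (p : ℂ) ^ (-(t * I)) - 1 / (1 + t * I) ^ (j + 1)‖ ≤
      (tailConst + (j + 1) * (596 * Real.log (8 * (|t| + 6)))) * (100 / 149) ^ j := by
  have h1 := norm_sum_primeRange_sub_tsum_le j (φ := fun n => (n : ℂ) ^ (-(t * I)))
    (fun n => norm_natCast_cpow_mul_I_le_one n t)
  have h2 := h.norm_tsum_sub_le t j
  rw [add_mul]
  refine le_trans ?_ (add_le_add h1 h2)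
  refine le_trans (le_of_eq ?_) (norm_add_le _ _)
  congr 1; ring

end

noncomputable section
open Complex MeasureTheory Set Filter Topology Metric
open scoped ArithmeticFunction.vonMangoldt

/-- A probability weight `ν` on a set `P` of primes in `(e^{j/4}, e^{4 j}]`, against which all
Dirichlet characters and Archimedean characters of moderate conductor nearly cancel. -/
structure GoodWeight (j : ℕ) (P : Finset ℕ) (ν : ℕ → ℝ) : Prop where
  prime : ∀ p ∈ P, p.Prime
  lower : ∀ p ∈ P, Real.exp (j / 4) < p
  upper : ∀ p ∈ P, (p : ℝ) ≤ Real.exp (4 * j)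
  nonneg : ∀ p, 0 ≤ ν p
  sum_eq_one : ∑ p ∈ P, ν p = 1
  le_div : ∀ p ∈ P, ν p ≤ 8 * j / p
  le_pow : ∀ p ∈ P, ν p ≤ 8 * j * (1 / 2) ^ j
  sum_log : ∑ p ∈ P, ν p * Real.log p ≤ 1005 / 1000 * j
  twist : ∀ (r : ℕ) [NeZero r] (χ : DirichletCharacter ℂ r), χ ≠ 1 → ∀ t : ℝ,
    Real.log (8 * r * (|t| + 6)) ≤ Real.exp (5 / 1000 * j) →
    ‖∑ p ∈ P, ν p * (χ p * (p : ℂ) ^ (-(t * I)))‖ ≤ Real.exp (-(39 / 100) * j)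
  cpow : ∀ t : ℝ, 2 ≤ |t| → Real.log (8 * (|t| + 6)) ≤ Real.exp (5 / 1000 * j) →
    ‖∑ p ∈ P, ν p * (p : ℂ) ^ (-(t * I))‖ ≤ Real.exp (-(39 / 100) * j)

lemma exp_le_149 : Real.exp (396/1000) ≤ 149/100 := by
  refine le_of_pow_le_pow_left₀ (n := 250) (by norm_num) (by norm_num) ?_
  rw [← Real.exp_nat_mul]
  norm_num
  have := Real.exp_one_lt_d9
  calc Real.exp 99 = Real.exp 1 ^ 99 := by rw [← Real.exp_nat_mul]; norm_num
    _ ≤ 2.7182818286 ^ 99 := by gcongr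
    _ ≤ _ := by norm_num

lemma pow_100_149_le (j : ℕ) : (100/149 : ℝ) ^ j ≤ Real.exp (-(396/1000) * j) := by
  rw [mul_comm, Real.exp_nat_mul]
  gcongr
  rw [Real.exp_neg, le_inv_comm₀ (by norm_num) (Real.exp_pos _)]
  have := exp_le_149
  norm_num at this ⊢
  exact this

lemma eventually_mul_exp_le (a b : ℝ) {c d : ℝ} (hc : d < c) :
    ∀ᶠ j : ℕ in atTop, (a + b * j) * Real.exp (-c * j) ≤ Real.exp (-d * j) := by
  have h1 : Tendsto (fun x : ℝ => x ^ 1 * Real.exp (-(c - d) * x)) atTop (𝓝 0) := by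
    have := Real.tendsto_pow_mul_exp_neg_atTop_nhds_zero 1
    have h2 := this.comp (tendsto_id.const_mul_atTop (sub_pos.2 hc))
    have h3 := h2.const_mul (c - d)⁻¹
    rw [mul_zero] at h3
    refine h3.congr fun x => ?_
    have : c - d ≠ 0 := by linarith
    simp only [Function.comp, id, pow_one, neg_mul]
    field_simp
  have h2 : Tendsto (fun x : ℝ => Real.exp (-(c - d) * x)) atTop (𝓝 0) := by
    refine Real.tendsto_exp_atBot.comp ?_
    exact tendsto_id.const_mul_atTop_of_neg (by linarith)
  have h3 := ((h2.const_mul a).add (h1.const_mul b)).comp tendsto_natCast_atTop_atTop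
  simp only [mul_zero, add_zero] at h3
  filter_upwards [h3.eventually (eventually_le_nhds zero_lt_one)] with j hj
  simp only [Function.comp, pow_one] at hj
  have : Real.exp (-c * j) = Real.exp (-(c - d) * j) * Real.exp (-d * j) := by
    rw [← Real.exp_add]; congr 1; ring
  rw [this]
  have := mul_le_mul_of_nonneg_right hj (Real.exp_pos (-d * j)).le
  linarith

lemma GRH.sum_gammaWeight_near (h : GRH) : ∀ᶠ j : ℕ in atTop,
    |∑ p ∈ primeRange j, gammaWeight j p - 1| ≤ 1 / 1000 := by
  filter_upwards [eventually_mul_exp_le (1000 * (tailConst + 596 * Real.log 48))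
    (1000 * (596 * Real.log 48)) (show (0:ℝ) < 396/1000 by norm_num)] with j hj
  have h1 := h.norm_sum_cpow_sub_le 0 j
  simp only [abs_zero, ofReal_zero, zero_mul, neg_zero, cpow_zero, mul_one, add_zero, one_pow,
    div_one, zero_add] at h1
  have e : (∑ p ∈ primeRange j, (gammaWeight j p : ℂ)) - 1 =
      ((∑ p ∈ primeRange j, gammaWeight j p - 1 : ℝ) : ℂ) := by push_cast; rfl
  rw [e, norm_real, Real.norm_eq_abs, show (8 * 6 : ℝ) = 48 by norm_num] at h1
  have h2 := pow_100_149_le j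
  have hl : 0 < Real.log 48 := Real.log_pos (by norm_num)
  have := tailConst_nonneg
  have h3 : (tailConst + (j + 1) * (596 * Real.log 48)) * (100 / 149) ^ j ≤
    (tailConst + (j + 1) * (596 * Real.log 48)) * Real.exp (-(396/1000) * j) := by gcongr
  rw [neg_zero, zero_mul, Real.exp_zero] at hj
  nlinarith

lemma sum_gammaWeight_log_le (h : GRH) : ∀ᶠ j : ℕ in atTop,
    ∑ p ∈ primeRange j, gammaWeight j p * Real.log p ≤ (j + 1) * (1001 / 1000) := by
  have h0 : ∀ᶠ j : ℕ in atTop, ∑' n, gammaWeight j n ≤ 1001 / 1000 := by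
    filter_upwards [eventually_mul_exp_le (1000 * (596 * Real.log 48))
      (1000 * (596 * Real.log 48)) (show (0:ℝ) < 396/1000 by norm_num)] with j hj
    have h1 := h.norm_tsum_sub_le 0 j
    simp only [abs_zero, ofReal_zero, zero_mul, neg_zero, cpow_zero, mul_one, add_zero, one_pow,
      div_one, zero_add] at h1
    have e : (∑' n, (gammaWeight j n : ℂ)) - 1 = ((∑' n, gammaWeight j n - 1 : ℝ) : ℂ) := by
      push_cast; rfl
    rw [e, norm_real, Real.norm_eq_abs, show (8 * 6 : ℝ) = 48 by norm_num] at h1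
    have h2 := pow_100_149_le j
    have hl : 0 < Real.log 48 := Real.log_pos (by norm_num)
    have h3 : ((j + 1) * (596 * Real.log 48)) * (100 / 149) ^ j ≤
      ((j + 1) * (596 * Real.log 48)) * Real.exp (-(396/1000) * j) := by gcongr
    rw [neg_zero, zero_mul, Real.exp_zero] at hj
    have := le_abs_self (∑' n, gammaWeight j n - 1)
    nlinarith
  filter_upwards [(tendsto_add_atTop_nat 1).eventually h0] with j hj
  calc ∑ p ∈ primeRange j, gammaWeight j p * Real.log p
      = (j + 1) * ∑ p ∈ primeRange j, gammaWeight (j + 1) p := by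
        rw [Finset.mul_sum]
        refine Finset.sum_congr rfl fun p _ => ?_
        unfold gammaWeight
        rw [Nat.factorial_succ, pow_succ]
        push_cast
        field_simp
    _ ≤ (j + 1) * ∑' n, gammaWeight (j + 1) n := by
        gcongr
        exact (summable_gammaWeight _).sum_le_tsum _ fun _ _ => gammaWeight_nonneg _ _
    _ ≤ _ := by gcongr

theorem GRH.exists_goodWeight (h : GRH) : ∀ᶠ j : ℕ in atTop, ∃ P ν, GoodWeight j P ν := by
  have hK := tailConst_nonneg
  filter_upwards [h.sum_gammaWeight_near, sum_gammaWeight_log_le h,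
    eventually_mul_exp_le (2 * (tailConst + 1 + 596)) (2 * 596)
      (show (390/1000:ℝ) < 391/1000 by norm_num), eventually_ge_atTop 1000] with j hZ hlog hE hj
  set Z := ∑ p ∈ primeRange j, gammaWeight j p with hZdef
  have hZ1 : 999 / 1000 ≤ Z := by linarith [(abs_le.1 hZ).1]
  have hj' : (1000:ℝ) ≤ j := by exact_mod_cast hj
  have hZ0 : 0 < Z := by linarith
  have hZi : Z⁻¹ ≤ 1000 / 999 := by
    rw [inv_le_comm₀ hZ0 (by norm_num)]; norm_num; linarith
  have hZi0 : 0 < Z⁻¹ := inv_pos.2 hZ0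
  have hfinal : ∀ l : ℝ, 0 ≤ l → l ≤ Real.exp (5 / 1000 * j) →
      Z⁻¹ * ((tailConst + 1 + (j + 1) * (596 * l)) * (100 / 149) ^ j) ≤
        Real.exp (-(39 / 100) * j) := by
    intro l hl0 hl
    have h1 : (1:ℝ) ≤ Real.exp (5 / 1000 * j) := Real.one_le_exp (by positivity)
    calc Z⁻¹ * ((tailConst + 1 + (j + 1) * (596 * l)) * (100 / 149) ^ j)
        ≤ 2 * ((tailConst + 1 + (j + 1) * 596) * Real.exp (5 / 1000 * j) *
            Real.exp (-(396/1000) * j)) := by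
          gcongr
          · linarith
          · nlinarith [mul_le_mul_of_nonneg_left hl (show (0:ℝ) ≤ (j + 1) * 596 by positivity)]
          · exact pow_100_149_le j
      _ = (2 * (tailConst + 1 + 596) + 2 * 596 * j) * Real.exp (-(391/1000) * j) := by
          rw [mul_assoc (_ : ℝ) (Real.exp _), ← Real.exp_add,
            show 5 / 1000 * (j:ℝ) + -(396/1000) * j = -(391/1000) * j by ring]
          ring
      _ ≤ _ := hE.trans (le_of_eq (by congr 1; ring))
  have hsum : ∀ φ : ℕ → ℂ, ∑ p ∈ primeRange j, ((Z⁻¹ * gammaWeight j p : ℝ) : ℂ) * φ p =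
      (Z⁻¹ : ℝ) * ∑ p ∈ primeRange j, gammaWeight j p * φ p := by
    intro φ; rw [Finset.mul_sum]; refine Finset.sum_congr rfl fun p _ => ?_
    push_cast; ring
  have hlogp : ∀ p ∈ primeRange j, Real.log p ≤ 4 * j := fun p hp => by
    have hp' := mem_primeRange.1 hp
    rw [Real.log_le_iff_le_exp (by exact_mod_cast hp'.1.pos)]; exact hp'.2.2
  refine ⟨primeRange j, fun p => Z⁻¹ * gammaWeight j p, ?_⟩
  refine ⟨fun p hp => (mem_primeRange.1 hp).1, fun p hp => (mem_primeRange.1 hp).2.1,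
    fun p hp => (mem_primeRange.1 hp).2.2, fun p => ?_, ?_, fun p hp => ?_, fun p hp => ?_, ?_,
    ?_, ?_⟩
  · have := gammaWeight_nonneg j p; positivity
  · rw [← Finset.mul_sum]; exact inv_mul_cancel₀ hZ0.ne'
  · have hp' := mem_primeRange.1 hp
    have hpos : (0:ℝ) < p := by exact_mod_cast hp'.1.pos
    have h1 := gammaWeight_le one_pos j p
    rw [ArithmeticFunction.vonMangoldt_apply_prime hp'.1, inv_one, one_pow, one_mul,
      show (1 - 2 : ℝ) = -1 by norm_num, Real.rpow_neg_one] at h1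
    calc Z⁻¹ * gammaWeight j p ≤ 2 * (4 * j * (p:ℝ)⁻¹) := by
          gcongr
          · exact gammaWeight_nonneg _ _
          · linarith
          · exact h1.trans (by gcongr; exact hlogp p hp)
      _ = _ := by field_simp; ring
  · have hp' := mem_primeRange.1 hp
    have h1 := gammaWeight_le two_pos j p
    rw [ArithmeticFunction.vonMangoldt_apply_prime hp'.1, sub_self, Real.rpow_zero, mul_one] at h1
    calc Z⁻¹ * gammaWeight j p ≤ 2 * ((2:ℝ)⁻¹ ^ j * (4 * j)) := by
          gcongr
          · exact gammaWeight_nonneg _ _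
          · linarith
          · exact h1.trans (by gcongr; exact hlogp p hp)
      _ = _ := by rw [one_div]; ring
  · calc ∑ p ∈ primeRange j, Z⁻¹ * gammaWeight j p * Real.log p
        = Z⁻¹ * ∑ p ∈ primeRange j, gammaWeight j p * Real.log p := by
          rw [Finset.mul_sum]; simp only [mul_assoc]
      _ ≤ 1000 / 999 * ((j + 1) * (1001 / 1000)) := by
          gcongr
          exact Finset.sum_nonneg fun p _ =>
            mul_nonneg (gammaWeight_nonneg j p) (Real.log_natCast_nonneg p)
      _ ≤ _ := by linarith
  · intro r hr χ hχ t ht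
    rw [hsum, norm_mul, norm_real, Real.norm_of_nonneg hZi0.le]
    have hr1 : (1:ℝ) ≤ r := by exact_mod_cast NeZero.one_le
    have hl0 : 0 ≤ Real.log (8 * r * (|t| + 6)) :=
      Real.log_nonneg (by nlinarith [abs_nonneg t])
    refine le_trans ?_ (hfinal _ hl0 ht)
    gcongr
    refine (h.norm_sum_twist_le hχ t j).trans ?_
    gcongr
    linarith
  · intro t ht2 ht
    rw [hsum, norm_mul, norm_real, Real.norm_of_nonneg hZi0.le]
    have hl0 : 0 ≤ Real.log (8 * (|t| + 6)) :=
      Real.log_nonneg (by nlinarith [abs_nonneg t])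
    refine le_trans ?_ (hfinal _ hl0 ht)
    gcongr
    have h1 := h.norm_sum_cpow_sub_le t j
    have h2 : ‖1 / (1 + t * I) ^ (j + 1)‖ ≤ (100 / 149) ^ j := by
      have h3 : 149/100 ≤ ‖(1 + t * I : ℂ)‖ := by
        refine le_trans ?_ (abs_im_le_norm _)
        simp; linarith
      rw [norm_div, norm_one, norm_pow, one_div, ← inv_pow]
      calc (‖(1 + t * I : ℂ)‖⁻¹) ^ (j + 1) ≤ (100 / 149) ^ (j + 1) := by
            gcongr
            rw [inv_le_comm₀ (by linarith) (by norm_num)]; norm_num; linarith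
        _ ≤ _ := pow_le_pow_of_le_one (by norm_num) (by norm_num) (by omega)
    have h4 := norm_le_norm_sub_add (∑ p ∈ primeRange j, (gammaWeight j p : ℂ) *
      (p : ℂ) ^ (-(t * I))) (1 / (1 + t * I) ^ (j + 1))
    linarith

end

noncomputable section
open Complex MeasureTheory Set Filter Topology Metric

/-- Averaging of `n ↦ h (p n)` over `p ∈ P` with weight `ν`. -/
def avgOp (P : Finset ℕ) (ν : ℕ → ℝ) : Module.End ℂ (ℕ → ℂ) where
  toFun h n := ∑ p ∈ P, ν p * h (p * n)
  map_add' h h' := by ext n; simp [mul_add, Finset.sum_add_distrib]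
  map_smul' c h := by
    ext n; simp only [Pi.smul_apply, smul_eq_mul, RingHom.id_apply, Finset.mul_sum]
    exact Finset.sum_congr rfl fun p _ => by ring

lemma avgOp_apply (P : Finset ℕ) (ν : ℕ → ℝ) (h : ℕ → ℂ) (n : ℕ) :
    avgOp P ν h n = ∑ p ∈ P, ν p * h (p * n) := rfl

lemma avgOp_commute (P P' : Finset ℕ) (ν : ℕ → ℝ) : Commute (avgOp P ν) (avgOp P' ν) := by
  refine LinearMap.ext fun h => funext fun n => ?_
  simp only [Module.End.mul_apply, avgOp_apply, Finset.mul_sum]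
  rw [Finset.sum_comm]
  refine Finset.sum_congr rfl fun p _ => Finset.sum_congr rfl fun q _ => ?_
  rw [mul_left_comm p q n]; ring

lemma avgOp_filter_add (P : Finset ℕ) (ν : ℕ → ℝ) (s : ℕ → Prop) [DecidablePred s] :
    avgOp (P.filter s) ν + avgOp (P.filter fun p => ¬ s p) ν = avgOp P ν := by
  refine LinearMap.ext fun h => funext fun n => ?_
  simp only [LinearMap.add_apply, Pi.add_apply, avgOp_apply]
  exact Finset.sum_filter_add_sum_filter_not _ _ _

lemma avgOp_pow_succ_apply (P : Finset ℕ) (ν : ℕ → ℝ) (k : ℕ) (h : ℕ → ℂ) (n : ℕ) :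
    (avgOp P ν ^ (k + 1)) h n = ∑ p ∈ P, ν p * (avgOp P ν ^ k) h (p * n) := by
  rw [pow_succ', Module.End.mul_apply, avgOp_apply]

lemma avgOp_pow_apply_of_mul {P : Finset ℕ} {ν : ℕ → ℝ} {φ : ℕ → ℂ}
    (hφ : ∀ p ∈ P, ∀ n, φ (p * n) = φ p * φ n) (k n : ℕ) :
    (avgOp P ν ^ k) φ n = (∑ p ∈ P, ν p * φ p) ^ k * φ n := by
  induction k generalizing n with
  | zero => simp
  | succ k ih =>
    rw [avgOp_pow_succ_apply, pow_succ, mul_assoc, mul_comm (∑ p ∈ P, _) (φ n), ← mul_assoc,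
      Finset.mul_sum]
    refine Finset.sum_congr rfl fun p hp => ?_
    rw [ih, hφ p hp]; ring

lemma avgOp_pow_apply_mul (P : Finset ℕ) (ν : ℕ → ℝ) (k : ℕ) (h : ℕ → ℂ) (d n : ℕ) :
    (avgOp P ν ^ k) h (d * n) = (avgOp P ν ^ k) (fun m => h (d * m)) n := by
  induction k generalizing n with
  | zero => simp
  | succ k ih =>
    simp only [avgOp_pow_succ_apply]
    refine Finset.sum_congr rfl fun p _ => ?_
    rw [mul_left_comm, ih]

lemma avgOp_pow_congr {P : Finset ℕ} {ν : ℕ → ℝ} {r : ℕ} (hP : ∀ p ∈ P, p.Coprime r)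
    {h h' : ℕ → ℂ} (hh : ∀ n : ℕ, n.Coprime r → h n = h' n) (k : ℕ) {n : ℕ} (hn : n.Coprime r) :
    (avgOp P ν ^ k) h n = (avgOp P ν ^ k) h' n := by
  induction k generalizing n with
  | zero => simpa using hh n hn
  | succ k ih =>
    simp only [avgOp_pow_succ_apply]
    exact Finset.sum_congr rfl fun p hp => by rw [ih (Nat.Coprime.mul_left (hP p hp) hn)]

lemma avgOp_pow_integral {P : Finset ℕ} {ν : ℕ → ℝ} {α : Type*} [MeasurableSpace α]
    {μ : Measure α} {w : α → ℕ → ℂ} (hw : ∀ n, Integrable (fun ξ => w ξ n) μ) (k n : ℕ) :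
    Integrable (fun ξ => (avgOp P ν ^ k) (w ξ) n) μ ∧
    (avgOp P ν ^ k) (fun m => ∫ ξ, w ξ m ∂μ) n = ∫ ξ, (avgOp P ν ^ k) (w ξ) n ∂μ := by
  induction k generalizing n with
  | zero => exact ⟨by simpa using hw n, by simp⟩
  | succ k ih =>
    simp only [avgOp_pow_succ_apply]
    refine ⟨integrable_finsetSum _ fun p _ => (ih _).1.const_mul _, ?_⟩
    rw [integral_finsetSum _ fun p _ => (ih _).1.const_mul _]
    refine Finset.sum_congr rfl fun p _ => ?_
    rw [integral_const_mul, (ih _).2]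

/-- The distribution of a product of `k` independent `ν`-random elements of `P`. -/
def mulCoeff (P : Finset ℕ) (ν : ℕ → ℝ) : ℕ → (ℕ →₀ ℝ)
  | 0 => Finsupp.single 1 1
  | k + 1 => ∑ p ∈ P, ν p • (mulCoeff P ν k).mapDomain (p * ·)

lemma mulCoeff_succ (P : Finset ℕ) (ν : ℕ → ℝ) (k : ℕ) :
    mulCoeff P ν (k + 1) = ∑ p ∈ P, ν p • (mulCoeff P ν k).mapDomain (p * ·) := rfl

lemma mulCoeff_succ_sum {E : Type*} [AddCommGroup E] [Module ℝ E] (P : Finset ℕ) (ν : ℕ → ℝ)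
    (k : ℕ) (h : ℕ → E) :
    ((mulCoeff P ν (k + 1)).sum fun n a => a • h n) =
      ∑ p ∈ P, ν p • (mulCoeff P ν k).sum fun n a => a • h (p * n) := by
  rw [mulCoeff_succ, ← Finsupp.sum_finsetSum_index (by simp) (by intros; rw [add_smul])]
  refine Finset.sum_congr rfl fun p _ => ?_
  rw [Finsupp.sum_smul_index (by simp), Finsupp.sum_mapDomain_index (by simp)
    (by intros; rw [mul_add, add_smul]), Finsupp.smul_sum]
  simp only [mul_smul]

lemma avgOp_pow_apply_one (P : Finset ℕ) (ν : ℕ → ℝ) (k : ℕ) (h : ℕ → ℂ) :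
    (avgOp P ν ^ k) h 1 = (mulCoeff P ν k).sum fun n a => a • h n := by
  induction k generalizing h with
  | zero => simp [mulCoeff]
  | succ k ih =>
    rw [mulCoeff_succ_sum, avgOp_pow_succ_apply]
    refine Finset.sum_congr rfl fun p _ => ?_
    have := avgOp_pow_apply_mul P ν k h p 1
    rw [this, ih, real_smul]

lemma mulCoeff_nonneg {P : Finset ℕ} {ν : ℕ → ℝ} (hν : ∀ p, 0 ≤ ν p) (k n : ℕ) :
    0 ≤ mulCoeff P ν k n := by
  induction k generalizing n with
  | zero => rw [mulCoeff, Finsupp.single_apply]; split_ifs <;> norm_num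
  | succ k ih =>
    rw [mulCoeff_succ, Finsupp.finsetSum_apply]
    refine Finset.sum_nonneg fun p _ => ?_
    rw [Finsupp.smul_apply, smul_eq_mul]
    refine mul_nonneg (hν p) ?_
    rw [Finsupp.mapDomain, Finsupp.sum_apply]
    exact Finset.sum_nonneg fun m _ => by
      dsimp only
      rw [Finsupp.single_apply]; split_ifs
      exacts [ih m, le_rfl]

lemma exists_of_mem_support_mulCoeff_succ {P : Finset ℕ} {ν : ℕ → ℝ} {k n : ℕ}
    (hn : n ∈ (mulCoeff P ν (k + 1)).support) :
    ∃ p ∈ P, ∃ m ∈ (mulCoeff P ν k).support, n = p * m := by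
  classical
  have h1 := Finset.mem_biUnion.1 (Finsupp.support_finsetSum hn)
  obtain ⟨p, hp, h2⟩ := h1
  have h3 := Finsupp.mapDomain_support (Finsupp.support_smul h2)
  obtain ⟨m, hm, rfl⟩ := Finset.mem_image.1 h3
  exact ⟨p, hp, m, hm, rfl⟩

lemma sum_mulCoeff {P : Finset ℕ} {ν : ℕ → ℝ} (h1 : ∑ p ∈ P, ν p = 1) (k : ℕ) :
    ((mulCoeff P ν k).sum fun _ a => a) = 1 := by
  induction k with
  | zero => simp [mulCoeff]
  | succ k ih =>
    have := mulCoeff_succ_sum P ν k (fun _ => (1:ℝ))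
    simp only [smul_eq_mul, mul_one] at this
    rw [this, ih]; simpa using h1

lemma sum_mulCoeff_log {P : Finset ℕ} {ν : ℕ → ℝ} (hP : ∀ p ∈ P, 0 < p)
    (h1 : ∑ p ∈ P, ν p = 1) (k : ℕ) :
    ((mulCoeff P ν k).sum fun n a => a * Real.log n) = k * ∑ p ∈ P, ν p * Real.log p := by
  have hpos : ∀ k, ∀ n ∈ (mulCoeff P ν k).support, 0 < n := by
    intro k
    induction k with
    | zero =>
      intro n hn
      have := Finsupp.support_single_subset hn
      simp at this; omega
    | succ k ih =>
      intro n hn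
      obtain ⟨p, hp, m, hm, rfl⟩ := exists_of_mem_support_mulCoeff_succ hn
      exact Nat.mul_pos (hP p hp) (ih m hm)
  induction k with
  | zero => simp [mulCoeff]
  | succ k ih =>
    have := mulCoeff_succ_sum P ν k (fun n => Real.log n)
    simp only [smul_eq_mul] at this
    rw [this]
    have h2 : ∀ p ∈ P, ν p * ((mulCoeff P ν k).sum fun n a => a * Real.log ((p * n : ℕ) : ℝ)) =
        ν p * Real.log p + ν p * (k * ∑ p ∈ P, ν p * Real.log p) := by
      intro p hp
      rw [← mul_add, ← ih]
      congr 1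
      have e : ∀ n ∈ (mulCoeff P ν k).support, (mulCoeff P ν k n) * Real.log ((p * n : ℕ) : ℝ) =
          Real.log p * (mulCoeff P ν k n) + (mulCoeff P ν k n) * Real.log n := by
        intro n hn
        have := hpos k n hn
        have := hP p hp
        rw [Nat.cast_mul, Real.log_mul (by positivity) (by positivity)]; ring
      rw [Finsupp.sum, Finset.sum_congr rfl e, Finset.sum_add_distrib, ← Finset.mul_sum]
      have := sum_mulCoeff h1 k
      rw [Finsupp.sum] at this
      rw [this, mul_one, Finsupp.sum]
    rw [Finset.sum_congr rfl h2, Finset.sum_add_distrib, ← Finset.sum_mul, h1]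
    push_cast; ring

lemma mulCoeff_succ_apply_le {P : Finset ℕ} {ν : ℕ → ℝ} (hP : ∀ p ∈ P, 0 < p)
    (k n : ℕ) : mulCoeff P ν (k + 1) n =
      ∑ p ∈ P with p ∣ n, ν p * mulCoeff P ν k (n / p) := by
  rw [mulCoeff_succ, Finsupp.finsetSum_apply, Finset.sum_filter]
  refine Finset.sum_congr rfl fun p hp => ?_
  have hinj : Function.Injective (p * · : ℕ → ℕ) := fun a b h => Nat.eq_of_mul_eq_mul_left (hP p hp) h
  rw [Finsupp.smul_apply, smul_eq_mul]
  split_ifs with hd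
  · obtain ⟨m, rfl⟩ := hd
    rw [Nat.mul_div_cancel_left _ (hP p hp)]
    congr 1
    exact Finsupp.mapDomain_apply hinj _ _
  · rw [Finsupp.mapDomain_of_notMem_range, mul_zero]
    rintro ⟨m, rfl⟩
    exact hd ⟨m, rfl⟩

lemma mul_mulCoeff_le {P : Finset ℕ} {ν : ℕ → ℝ} (hν : ∀ p, 0 ≤ ν p)
    (hP : ∀ p ∈ P, p.Prime) {A : ℝ} (hA : ∀ p ∈ P, ν p ≤ A / p) (hA0 : 0 ≤ A) (k : ℕ) {n : ℕ}
    (hn : 0 < n) :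
    n * mulCoeff P ν k n ≤ (A * n.primeFactors.card) ^ k := by
  induction k generalizing n with
  | zero =>
    rw [mulCoeff, Finsupp.single_apply, pow_zero]
    split_ifs with h
    · subst h; simp
    · simp
  | succ k ih =>
    rw [mulCoeff_succ_apply_le (fun p hp => (hP p hp).pos), Finset.mul_sum]
    calc ∑ p ∈ P with p ∣ n, n * (ν p * mulCoeff P ν k (n / p))
        ≤ ∑ p ∈ P with p ∣ n, A * (A * n.primeFactors.card) ^ k := by
          refine Finset.sum_le_sum fun p hp => ?_
          obtain ⟨hpP, m, rfl⟩ := Finset.mem_filter.1 hp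
          have hp0 := (hP p hpP).pos
          rw [Nat.mul_div_cancel_left _ hp0]
          have hm : 0 < m := Nat.pos_of_mul_pos_left hn
          have hp0' : (0:ℝ) < p := by exact_mod_cast hp0
          have h1 := hA p hpP
          rw [le_div_iff₀ hp0'] at h1
          have h2 := ih hm
          have h3 : (m.primeFactors.card : ℝ) ≤ (p * m).primeFactors.card := by
            exact_mod_cast Finset.card_le_card
              (Nat.primeFactors_mono (Dvd.intro_left p rfl) hn.ne')
          have h4 := mulCoeff_nonneg (P := P) hν k m
          calc ((p * m : ℕ) : ℝ) * (ν p * mulCoeff P ν k m)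
              = (ν p * p) * (m * mulCoeff P ν k m) := by push_cast; ring
            _ ≤ A * (A * m.primeFactors.card) ^ k := by gcongr
            _ ≤ _ := by gcongr
      _ ≤ n.primeFactors.card • (A * (A * n.primeFactors.card) ^ k) := by
          rw [Finset.sum_const]
          refine nsmul_le_nsmul_left (by positivity) (Finset.card_le_card fun p hp => ?_)
          obtain ⟨hpP, hd⟩ := Finset.mem_filter.1 hp
          exact Nat.mem_primeFactors.2 ⟨hP p hpP, hd, hn.ne'⟩
      _ = _ := by rw [nsmul_eq_mul, pow_succ]; ring

end

noncomputable section
open Complex MeasureTheory Set Filter Topology Metric FourierTransform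
open scoped ContDiff

/-- The oscillating factor `e(θ e^v)`. -/
def expPhase (θ v : ℝ) : ℂ := cexp (2 * Real.pi * I * (θ * Real.exp v : ℝ))

lemma norm_expPhase (θ v : ℝ) : ‖expPhase θ v‖ = 1 := by
  rw [expPhase, show (2 * Real.pi * I * (θ * Real.exp v : ℝ) : ℂ) =
    ((2 * Real.pi * (θ * Real.exp v) : ℝ) : ℂ) * I by push_cast; ring]
  exact norm_exp_ofReal_mul_I _

/-- Multiplication by `2 π i e^v`. -/
def expMul (u : ℝ → ℂ) (v : ℝ) : ℂ := 2 * Real.pi * I * (Real.exp v : ℝ) * u v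

lemma contDiff_ofReal_exp : ContDiff ℝ ∞ fun v : ℝ => ((Real.exp v : ℝ) : ℂ) :=
  ofRealCLM.contDiff.comp Real.contDiff_exp

lemma hasDerivAt_expPhase (θ v : ℝ) :
    HasDerivAt (expPhase θ) (θ * (2 * Real.pi * I * (Real.exp v : ℝ)) * expPhase θ v) v := by
  have h1 : HasDerivAt (fun v : ℝ => ((θ * Real.exp v : ℝ) : ℂ)) ((θ * Real.exp v : ℝ) : ℂ) v :=
    ((Real.hasDerivAt_exp v).const_mul θ).ofReal_comp
  have h2 := (h1.const_mul (2 * Real.pi * I : ℂ)).cexp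
  refine h2.congr_deriv ?_
  simp only [expPhase]
  push_cast; ring

lemma contDiff_expPhase (θ : ℝ) : ContDiff ℝ ∞ (expPhase θ) := by
  have h1 : ContDiff ℝ ∞ fun v : ℝ => ((θ * Real.exp v : ℝ) : ℂ) :=
    ofRealCLM.contDiff.comp (contDiff_const.mul Real.contDiff_exp)
  exact (contDiff_const.mul h1).cexp

/-- Smooth compactly supported functions. -/
def IsTest (u : ℝ → ℂ) : Prop := ContDiff ℝ ∞ u ∧ HasCompactSupport u

lemma IsTest.derivative {u : ℝ → ℂ} (hu : IsTest u) : IsTest (deriv u) :=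
  ⟨(contDiff_infty_iff_deriv.1 hu.1).2, hu.2.deriv⟩

lemma IsTest.mul_left {u f : ℝ → ℂ} (hu : IsTest u) (hf : ContDiff ℝ ∞ f) :
    IsTest fun v => f v * u v := ⟨hf.mul hu.1, hu.2.mul_left⟩

lemma IsTest.expMul_left {u : ℝ → ℂ} (hu : IsTest u) : IsTest (expMul u) :=
  hu.mul_left (contDiff_const.mul contDiff_ofReal_exp)

lemma IsTest.integrable {u : ℝ → ℂ} (hu : IsTest u) : Integrable u :=
  hu.1.continuous.integrable_of_hasCompactSupport hu.2

lemma IsTest.mul_expPhase {u : ℝ → ℂ} (hu : IsTest u) (θ : ℝ) :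
    IsTest fun v => expPhase θ v * u v := hu.mul_left (contDiff_expPhase θ)

lemma norm_fourier_expPhase_le (u : ℝ → ℂ) (θ ξ : ℝ) :
    ‖𝓕 (fun v => expPhase θ v * u v) ξ‖ ≤ ∫ v, ‖u v‖ := by
  refine (VectorFourier.norm_fourierIntegral_le_integral_norm _ _ _ _ _).trans (le_of_eq ?_)
  simp [norm_expPhase]

lemma IsTest.fourier_identity {u : ℝ → ℂ} (hu : IsTest u) (θ ξ : ℝ) :
    (2 * Real.pi * I * ξ) * 𝓕 (fun v => expPhase θ v * u v) ξ =
      𝓕 (fun v => expPhase θ v * deriv u v) ξ + θ * 𝓕 (fun v => expPhase θ v * expMul u v) ξ := by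
  have h1 := hu.mul_expPhase θ
  have h2 := congrFun (Real.fourier_deriv h1.integrable (h1.1.differentiable (by simp))
    h1.derivative.integrable) ξ
  have h2' : 𝓕 (deriv fun v => expPhase θ v * u v) ξ =
    (2 * Real.pi * I * ξ) * 𝓕 (fun v => expPhase θ v * u v) ξ := h2
  rw [← h2']
  have h3 : deriv (fun v => expPhase θ v * u v) =
      (fun v => expPhase θ v * deriv u v) + (θ : ℂ) • fun v => expPhase θ v * expMul u v := by
    ext v
    have h4 := ((hasDerivAt_expPhase θ v).mul
      ((hu.1.differentiable (by simp)) v).hasDerivAt).deriv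
    rw [show deriv (fun v => expPhase θ v * u v) v = deriv (expPhase θ * u) v from rfl, h4]
    simp only [Pi.add_apply, Pi.smul_apply, smul_eq_mul, expMul]
    ring
  have hi1 := (hu.derivative.mul_expPhase θ).integrable
  have hi2 := (hu.expMul_left.mul_expPhase θ).integrable
  rw [h3]
  have e1 := congrFun (VectorFourier.fourierIntegral_add (L := innerₗ ℝ)
    Real.continuous_fourierChar (by exact continuous_inner) hi1 (hi2.smul (θ:ℂ))) ξ
  have e2 := congrFun (VectorFourier.fourierIntegral_const_smul Real.fourierChar volume (innerₗ ℝ)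
    (fun v => expPhase θ v * expMul u v) (θ:ℂ)) ξ
  rw [Pi.add_apply, e2] at e1
  exact e1

lemma IsTest.norm_fourier_identity {u : ℝ → ℂ} (hu : IsTest u) (θ ξ : ℝ) :
    2 * Real.pi * |ξ| * ‖𝓕 (fun v => expPhase θ v * u v) ξ‖ ≤
      ‖𝓕 (fun v => expPhase θ v * deriv u v) ξ‖ +
        |θ| * ‖𝓕 (fun v => expPhase θ v * expMul u v) ξ‖ := by
  have h := congrArg norm (hu.fourier_identity θ ξ)
  have e : ‖(2 * Real.pi * I * ξ : ℂ)‖ = 2 * Real.pi * |ξ| := by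
    simp [abs_of_pos Real.pi_pos]
  rw [norm_mul, e] at h
  rw [h]
  refine (norm_add_le _ _).trans ?_
  simp

lemma integral_inv_one_add_div_sq {a : ℝ} (ha : 0 < a) :
    ∫ x : ℝ, (1 + (x / a) ^ 2)⁻¹ = Real.pi * a := by
  rw [Measure.integral_comp_div (fun x : ℝ => (1 + x ^ 2)⁻¹) a, integral_univ_inv_one_add_sq,
    abs_of_pos ha, smul_eq_mul, mul_comm]

lemma integrable_inv_one_add_div_sq {a : ℝ} (ha : 0 < a) :
    Integrable fun x : ℝ => (1 + (x / a) ^ 2)⁻¹ :=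
  Integrable.comp_div (g := fun x : ℝ => (1 + x ^ 2)⁻¹) integrable_inv_one_add_sq ha.ne'

/-- Quadratic decay of the Fourier transform of `u(v) e(θ e^v)`. -/
lemma IsTest.exists_decay {u : ℝ → ℂ} (hu : IsTest u) : ∃ C, 0 ≤ C ∧ ∀ θ ξ : ℝ,
    ‖𝓕 (fun v => expPhase θ v * u v) ξ‖ ≤ C * (1 + (ξ / (1 + |θ|)) ^ 2)⁻¹ := by
  set n : (ℝ → ℂ) → ℝ := fun f => ∫ v, ‖f v‖ with hn
  have hn0 : ∀ f, 0 ≤ n f := fun f => integral_nonneg fun _ => norm_nonneg _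
  set C := n u + n (deriv (deriv u)) + n (expMul (deriv u)) + n (deriv (expMul u)) +
    n (expMul (expMul u)) with hC
  have hC0 : 0 ≤ C := by simp only [hC]; have := hn0; positivity
  refine ⟨2 * C, by positivity, fun θ ξ => ?_⟩
  set F := ‖𝓕 (fun v => expPhase θ v * u v) ξ‖ with hF
  have h0 : F ≤ n u := norm_fourier_expPhase_le u θ ξ
  have h1 := hu.norm_fourier_identity θ ξ
  have h2 := hu.derivative.norm_fourier_identity θ ξ
  have h3 := hu.expMul_left.norm_fourier_identity θ ξ
  have b1 := norm_fourier_expPhase_le (deriv (deriv u)) θ ξ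
  have b2 := norm_fourier_expPhase_le (expMul (deriv u)) θ ξ
  have b3 := norm_fourier_expPhase_le (deriv (expMul u)) θ ξ
  have b4 := norm_fourier_expPhase_le (expMul (expMul u)) θ ξ
  have hθ := abs_nonneg θ
  have hπ : 1 ≤ 2 * Real.pi := by linarith [Real.pi_gt_three]
  have hξ := abs_nonneg ξ
  have hF0 : 0 ≤ F := norm_nonneg _
  have h4 : |ξ| ^ 2 * F ≤ C * (1 + |θ|) ^ 2 := by
    have k2 := h2.trans (add_le_add b1 (mul_le_mul_of_nonneg_left b2 hθ))
    have k3 := h3.trans (add_le_add b3 (mul_le_mul_of_nonneg_left b4 hθ))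
    have hsq : |ξ| ^ 2 * F ≤ 2 * Real.pi * |ξ| * (2 * Real.pi * |ξ| * F) := by
      have : 1 ≤ (2 * Real.pi) ^ 2 := one_le_pow₀ hπ
      have h5 : 0 ≤ |ξ| ^ 2 * F := by positivity
      nlinarith
    have k1 := mul_le_mul_of_nonneg_left h1 (show 0 ≤ 2 * Real.pi * |ξ| by positivity)
    have k3' := mul_le_mul_of_nonneg_left k3 hθ
    calc |ξ| ^ 2 * F ≤ n (deriv (deriv u)) + |θ| * n (expMul (deriv u)) +
          |θ| * (n (deriv (expMul u)) + |θ| * n (expMul (expMul u))) := by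
          simp only [hn]; linarith
      _ ≤ C * (1 + |θ|) ^ 2 := by
          have a0 := hn0 u
          have a1 := hn0 (deriv (deriv u))
          have a2 := hn0 (expMul (deriv u))
          have a3 := hn0 (deriv (expMul u))
          have a4 := hn0 (expMul (expMul u))
          simp only [hC]
          nlinarith [mul_nonneg hθ a0, mul_nonneg hθ a1, mul_nonneg hθ a2, mul_nonneg hθ a3,
            mul_nonneg hθ a4, mul_nonneg (sq_nonneg |θ|) a0, mul_nonneg (sq_nonneg |θ|) a1,
            mul_nonneg (sq_nonneg |θ|) a2, mul_nonneg (sq_nonneg |θ|) a3]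
  have ha : 0 < 1 + |θ| := by positivity
  rw [← div_eq_mul_inv, le_div_iff₀ (by positivity)]
  have h5 : F * (ξ / (1 + |θ|)) ^ 2 ≤ C := by
    rw [div_pow, mul_div_assoc', div_le_iff₀ (by positivity), ← sq_abs ξ]
    linarith
  have h6 : F ≤ C := by
    have := hn0 (deriv (deriv u)); have := hn0 (expMul (deriv u))
    have := hn0 (deriv (expMul u)); have := hn0 (expMul (expMul u))
    linarith
  linarith

/-- A smooth bump on `[-1, 1]`, equal to `1` on `[-1/2, 1/2]`. -/
def bump : ContDiffBump (0 : ℝ) := ⟨1/2, 1, by norm_num, by norm_num⟩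

lemma isTest_bump : IsTest fun v => (bump v : ℂ) := by
  refine ⟨ofRealCLM.contDiff.comp bump.contDiff, ?_⟩
  exact bump.hasCompactSupport.comp_left (g := fun x : ℝ => (x : ℂ)) (by simp)


/-- The Fourier transform of `v ↦ bump(v) e(θ e^v)`. -/
def bumpFourier (θ : ℝ) : ℝ → ℂ := 𝓕 (fun v => expPhase θ v * bump v)

lemma continuous_bumpFourier (θ : ℝ) : Continuous (bumpFourier θ) :=
  VectorFourier.fourierIntegral_continuous (L := innerₗ ℝ)
    Real.continuous_fourierChar (by exact continuous_inner)
    (isTest_bump.mul_expPhase θ).integrable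

lemma integrable_bumpFourier (θ : ℝ) : Integrable (bumpFourier θ) := by
  obtain ⟨C, hC, h⟩ := isTest_bump.exists_decay
  exact ((integrable_inv_one_add_div_sq (by positivity)).const_mul C).mono'
    (continuous_bumpFourier θ).aestronglyMeasurable (Eventually.of_forall (h θ))

lemma bump_mul_expPhase_eq (θ v : ℝ) :
    expPhase θ v * bump v = ∫ ξ, bumpFourier θ ξ * cexp (2 * Real.pi * I * (ξ * v)) := by
  have hi := isTest_bump.mul_expPhase θ
  have h := congrFun (hi.1.continuous.fourierInv_fourier_eq hi.integrable
    (integrable_bumpFourier θ)) v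
  rw [Real.fourierInv_eq'] at h
  rw [← h]
  refine integral_congr_ae (Eventually.of_forall fun ξ => ?_)
  simp only [smul_eq_mul, bumpFourier, RCLike.inner_apply, conj_trivial]
  rw [mul_comm]
  congr 2
  push_cast; ring

theorem exists_bumpFourier_bound : ∃ C, 1 ≤ C ∧ ∀ θ : ℝ,
    (∫ ξ, ‖bumpFourier θ ξ‖ ≤ C * (1 + |θ|)) ∧
    (∀ T, 1 ≤ T → ∫ ξ in {ξ : ℝ | T < |ξ|}, ‖bumpFourier θ ξ‖ ≤ C * (1 + |θ|) ^ 2 / T) ∧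
    (1 + |θ|) * ∫ ξ in {ξ : ℝ | |ξ| ≤ 1}, ‖bumpFourier θ ξ‖ ≤ C := by
  obtain ⟨C, hC, h⟩ := isTest_bump.exists_decay
  have hu : IsTest fun v => (2 * Real.pi * I * (Real.exp v : ℝ))⁻¹ * (bump v : ℂ) := by
    refine isTest_bump.mul_left (ContDiff.inv (contDiff_const.mul contDiff_ofReal_exp) fun v => ?_)
    simp [Real.pi_ne_zero]
  set u : ℝ → ℂ := fun v => (2 * Real.pi * I * (Real.exp v : ℝ))⁻¹ * (bump v : ℂ) with hudef
  have hexpMul : expMul u = fun v => (bump v : ℂ) := by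
    ext v
    simp only [expMul, hudef]
    rw [mul_inv_cancel_left₀]
    simp [Real.pi_ne_zero]
  set D := (∫ v, ‖deriv u v‖) + 2 * Real.pi * ∫ v, ‖u v‖ with hD
  have hD0 : 0 ≤ D := by
    have : 0 ≤ ∫ v, ‖deriv u v‖ := integral_nonneg fun _ => norm_nonneg _
    have : 0 ≤ ∫ v, ‖u v‖ := integral_nonneg fun _ => norm_nonneg _
    positivity
  refine ⟨1 + 2 * C * Real.pi + 2 * (C + D),
    by have := Real.pi_pos; nlinarith [mul_nonneg hC this.le],
    fun θ => ⟨?_, fun T hT => ?_, ?_⟩⟩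
  · have ha : 0 < 1 + |θ| := by positivity
    calc ∫ ξ, ‖bumpFourier θ ξ‖ ≤ ∫ ξ, C * (1 + (ξ / (1 + |θ|)) ^ 2)⁻¹ :=
          integral_mono (integrable_bumpFourier θ).norm
            ((integrable_inv_one_add_div_sq ha).const_mul C) (h θ)
      _ = C * Real.pi * (1 + |θ|) := by
          rw [integral_const_mul, integral_inv_one_add_div_sq ha]; ring
      _ ≤ _ := by
          gcongr
          nlinarith [mul_nonneg hC Real.pi_pos.le]
  · have hT0 : 0 < T := by linarith
    have ha : 0 < 1 + |θ| := by positivity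
    have hint := ((integrable_inv_one_add_div_sq hT0).const_mul (2 * C * (1 + |θ|) ^ 2 / T ^ 2))
    calc ∫ ξ in {ξ : ℝ | T < |ξ|}, ‖bumpFourier θ ξ‖
        ≤ ∫ ξ in {ξ : ℝ | T < |ξ|}, 2 * C * (1 + |θ|) ^ 2 / T ^ 2 * (1 + (ξ / T) ^ 2)⁻¹ := by
          refine setIntegral_mono_on (integrable_bumpFourier θ).norm.integrableOn
            hint.integrableOn (measurableSet_lt measurable_const measurable_norm) fun ξ hξ => ?_
          have hξ : T < |ξ| := hξ
          have hξ0 : 0 < |ξ| := by linarith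
          refine (h θ ξ).trans ?_
          have e1 : (1 + (ξ / (1 + |θ|)) ^ 2)⁻¹ ≤ (1 + |θ|) ^ 2 / |ξ| ^ 2 := by
            rw [inv_le_comm₀ (by positivity) (by positivity), inv_div, div_pow, sq_abs]
            linarith
          have e2 : 1 / |ξ| ^ 2 ≤ 2 / T ^ 2 * (1 + (ξ / T) ^ 2)⁻¹ := by
            rw [div_pow, ← sq_abs ξ, ← div_eq_mul_inv, div_div,
              show T ^ 2 * (1 + |ξ| ^ 2 / T ^ 2) = T ^ 2 + |ξ| ^ 2 by field_simp,
              div_le_div_iff₀ (by positivity) (by positivity)]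
            nlinarith
          calc C * (1 + (ξ / (1 + |θ|)) ^ 2)⁻¹ ≤ C * ((1 + |θ|) ^ 2 * (1 / |ξ| ^ 2)) := by
                rw [mul_one_div]; gcongr
            _ ≤ C * ((1 + |θ|) ^ 2 * (2 / T ^ 2 * (1 + (ξ / T) ^ 2)⁻¹)) := by gcongr
            _ = _ := by ring
      _ ≤ ∫ ξ, 2 * C * (1 + |θ|) ^ 2 / T ^ 2 * (1 + (ξ / T) ^ 2)⁻¹ :=
          setIntegral_le_integral hint (Eventually.of_forall fun ξ => by positivity)
      _ = 2 * C * Real.pi * (1 + |θ|) ^ 2 / T := by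
          rw [integral_const_mul, integral_inv_one_add_div_sq hT0]; field_simp
      _ ≤ _ := by
          gcongr
          linarith
  · have hb : ∀ ξ ∈ {ξ : ℝ | |ξ| ≤ 1}, (1 + |θ|) * ‖bumpFourier θ ξ‖ ≤ C + D := by
      intro ξ hξ
      have hξ : |ξ| ≤ 1 := hξ
      have h1 := hu.fourier_identity θ ξ
      rw [hexpMul] at h1
      have h2 : |θ| * ‖bumpFourier θ ξ‖ ≤ D := by
        have h3 : (θ : ℂ) * bumpFourier θ ξ = (2 * Real.pi * I * ξ) *
          𝓕 (fun v => expPhase θ v * u v) ξ - 𝓕 (fun v => expPhase θ v * deriv u v) ξ := by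
          rw [h1, add_sub_cancel_left]; rfl
        have h4 := congrArg norm h3
        rw [norm_mul, norm_real, Real.norm_eq_abs] at h4
        rw [h4]
        refine (norm_sub_le _ _).trans ?_
        have e : ‖(2 * Real.pi * I * ξ : ℂ)‖ = 2 * Real.pi * |ξ| := by
          simp [abs_of_pos Real.pi_pos]
        rw [norm_mul, e, hD, add_comm]
        have b1 := norm_fourier_expPhase_le u θ ξ
        have b2 := norm_fourier_expPhase_le (deriv u) θ ξ
        refine add_le_add b2 ?_
        calc 2 * Real.pi * |ξ| * ‖𝓕 (fun v => expPhase θ v * u v) ξ‖ ≤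
            2 * Real.pi * 1 * ∫ v, ‖u v‖ := by have := Real.pi_pos; gcongr
          _ = _ := by ring
      have h5 : ‖bumpFourier θ ξ‖ ≤ C := (h θ ξ).trans
        (mul_le_of_le_one_right hC (inv_le_one_of_one_le₀ (by nlinarith [sq_nonneg (ξ / (1 + |θ|))])))
      linarith
    have hset : {ξ : ℝ | |ξ| ≤ 1} = Icc (-1) 1 := by ext ξ; exact abs_le (a := ξ)
    rw [← integral_const_mul]
    calc ∫ ξ in {ξ : ℝ | |ξ| ≤ 1}, (1 + |θ|) * ‖bumpFourier θ ξ‖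
        ≤ ∫ ξ in {ξ : ℝ | |ξ| ≤ 1}, C + D := by
          refine setIntegral_mono_on ((integrable_bumpFourier θ).norm.const_mul _).integrableOn
            ?_ (by rw [hset]; exact measurableSet_Icc) hb
          rw [hset]; simp
      _ = 2 * (C + D) := by
          rw [hset]; simp; norm_num
      _ ≤ _ := by have := Real.pi_pos; nlinarith [mul_nonneg hC this.le]

end

noncomputable section
open Complex MeasureTheory Set Filter Topology Metric
open scoped ArithmeticFunction.Moebius

lemma sum_nthRootsFinset_one {n : ℕ} (hn : 0 < n) :
    ∑ z ∈ Polynomial.nthRootsFinset n (1 : ℂ), z = if n = 1 then 1 else 0 := by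
  split_ifs with h
  · subst h
    have h1 : Polynomial.nthRootsFinset 1 (1 : ℂ) = {1} := by
      ext z
      rw [Polynomial.mem_nthRootsFinset one_pos, pow_one, Finset.mem_singleton]
    rw [h1, Finset.sum_singleton]
  have hp := Complex.isPrimitiveRoot_exp n hn.ne'
  have : NeZero n := ⟨hn.ne'⟩
  set ζ := cexp (2 * Real.pi * I / n)
  have h1 := hp.geom_sum_eq_zero (by omega)
  rw [← h1]
  symm
  refine Finset.sum_bij (fun i _ => ζ ^ i) (fun i _ => ?_) (fun i hi k hk h => ?_)
    (fun z hz => ?_) (fun _ _ => rfl)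
  · rw [Polynomial.mem_nthRootsFinset hn, ← pow_mul, mul_comm, pow_mul, hp.pow_eq_one, one_pow]
  · exact hp.pow_inj (Finset.mem_range.1 hi) (Finset.mem_range.1 hk) h
  · obtain ⟨i, hi, h⟩ := hp.eq_pow_of_pow_eq_one ((Polynomial.mem_nthRootsFinset hn _).1 hz)
    exact ⟨i, Finset.mem_range.2 hi, h⟩

/-- The sum of the primitive `n`-th roots of unity is `μ(n)`. -/
lemma sum_primitiveRoots_eq_moebius {n : ℕ} (hn : 0 < n) :
    ∑ z ∈ primitiveRoots n ℂ, z = (μ n : ℂ) := by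
  have h := (ArithmeticFunction.sum_eq_iff_sum_mul_moebius_eq (R := ℂ)
    (f := fun n => ∑ z ∈ primitiveRoots n ℂ, z) (g := fun n => if n = 1 then 1 else 0)).1
    (fun n hn => by
      rw [← sum_nthRootsFinset_one hn]
      have := NeZero.mk hn.ne'
      rw [IsPrimitiveRoot.nthRoots_one_eq_biUnion_primitiveRoots, Finset.sum_biUnion]
      intro i _ k _ hik
      exact IsPrimitiveRoot.disjoint hik) n hn
  rw [← h, Finset.sum_eq_single (n, 1)]
  · simp
  · rintro ⟨a, b⟩ hab hne
    have := Nat.mem_divisorsAntidiagonal.1 hab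
    simp only at this
    rw [if_neg, mul_zero]
    rintro rfl
    exact hne (by simpa using this.1)
  · intro h
    exact absurd (Nat.mem_divisorsAntidiagonal.2 ⟨by simp, hn.ne'⟩) h

lemma sum_stdAddChar_units {r : ℕ} [NeZero r] {b : ZMod r} (hb : IsUnit b) :
    ∑ u : (ZMod r)ˣ, ZMod.stdAddChar (b * (u : ZMod r)) = (μ r : ℂ) := by
  rw [← sum_primitiveRoots_eq_moebius (NeZero.pos r)]
  have hmaps : ∀ u : (ZMod r)ˣ, ZMod.stdAddChar (b * (u : ZMod r)) ∈ primitiveRoots r ℂ := by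
    intro u
    obtain ⟨v, rfl⟩ := hb
    rw [mem_primitiveRoots (NeZero.pos r), ← Units.val_mul]
    set w := v * u
    have hw : ((w : ZMod r).val : ZMod r) = w := ZMod.natCast_zmod_val _
    have h1 := Complex.isPrimitiveRoot_exp_of_coprime (w : ZMod r).val r (NeZero.ne r)
      (ZMod.val_coe_unit_coprime w)
    have h2 := ZMod.stdAddChar_coe (N := r) ((w : ZMod r).val : ℤ)
    rw [Int.cast_natCast, hw] at h2
    rw [h2]
    push_cast
    rwa [← mul_div_assoc] at h1
  have hinj : Function.Injective fun u : (ZMod r)ˣ => ZMod.stdAddChar (b * (u : ZMod r)) := by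
    intro u v h
    have := ZMod.injective_stdAddChar h
    exact Units.ext (hb.mul_left_cancel this)
  rw [← Finset.sum_image (s := Finset.univ) (f := fun z => z) (hinj.injOn)]
  congr 1
  refine Finset.eq_of_subset_of_card_le (fun z hz => ?_) ?_
  · obtain ⟨u, _, rfl⟩ := Finset.mem_image.1 hz
    exact hmaps u
  · rw [Finset.card_image_of_injective _ hinj, Complex.card_primitiveRoots, Finset.card_univ,
      ZMod.card_units_eq_totient]

/-- Expansion of an additive character in Dirichlet characters. -/
theorem exists_char_expansion (r : ℕ) [NeZero r] {b : ℤ} (hb : IsUnit (b : ZMod r)) :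
    ∃ κ : DirichletCharacter ℂ r → ℂ, κ 1 = (μ r : ℂ) / r.totient ∧
      ∑ χ, ‖κ χ‖ ≤ √r ∧
      ∀ n : ℕ, n.Coprime r → cexp (2 * Real.pi * I * (b * n / r)) = ∑ χ, κ χ * χ n := by
  set e : ZMod r → ℂ := fun x => ZMod.stdAddChar ((b : ZMod r) * x) with he
  have hφ0 : 0 < r.totient := Nat.totient_pos.2 (NeZero.pos r)
  have hφ : (r.totient : ℂ) ≠ 0 := by exact_mod_cast hφ0.ne'
  set κ : DirichletCharacter ℂ r → ℂ :=
    fun χ => (r.totient : ℂ)⁻¹ * ∑ u : (ZMod r)ˣ, χ ((u : ZMod r)⁻¹) * e u with hκ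
  have hinv : ∀ v : (ZMod r)ˣ, ∑ χ, κ χ * χ (v : ZMod r) = e v := by
    intro v
    calc ∑ χ, κ χ * χ (v : ZMod r)
        = ∑ u : (ZMod r)ˣ, (r.totient : ℂ)⁻¹ * e u * ∑ χ : DirichletCharacter ℂ r,
            χ ((u : ZMod r)⁻¹) * χ (v : ZMod r) := by
          simp only [hκ, Finset.mul_sum, Finset.sum_mul]
          rw [Finset.sum_comm]
          refine Finset.sum_congr rfl fun u _ => Finset.sum_congr rfl fun χ _ => ?_
          ring
      _ = ∑ u : (ZMod r)ˣ, if u = v then e v else 0 := by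
          refine Finset.sum_congr rfl fun u _ => ?_
          rw [DirichletCharacter.sum_char_inv_mul_char_eq ℂ u.isUnit]
          simp only [Units.val_inj]
          split_ifs with h
          · subst h; field_simp
          · simp
      _ = e v := by simp
  have hnorm : ∑ χ, ‖κ χ‖ ^ 2 = 1 := by
    have h1 : ∑ χ, κ χ * star (κ χ) = 1 := by
      have h2 : ∀ χ : DirichletCharacter ℂ r, star (κ χ) =
          (r.totient : ℂ)⁻¹ * ∑ u : (ZMod r)ˣ, χ (u : ZMod r) * star (e u) := by
        intro χ
        simp only [hκ, star_mul', star_inv₀, star_natCast, star_sum]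
        congr 1
        refine Finset.sum_congr rfl fun u _ => ?_
        congr 1
        rw [MulChar.star_apply', ZMod.inv_coe_unit, MulChar.inv_apply, Ring.inverse_unit, inv_inv]
      calc ∑ χ, κ χ * star (κ χ) = (r.totient : ℂ)⁻¹ * ∑ u : (ZMod r)ˣ,
            (∑ χ, κ χ * χ (u : ZMod r)) * star (e u) := by
            simp only [h2, Finset.mul_sum, Finset.sum_mul]
            rw [Finset.sum_comm]
            refine Finset.sum_congr rfl fun u _ => Finset.sum_congr rfl fun χ _ => ?_
            ring
        _ = (r.totient : ℂ)⁻¹ * ∑ u : (ZMod r)ˣ, 1 := by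
            congr 1
            refine Finset.sum_congr rfl fun u _ => ?_
            rw [hinv]
            have h3 : ‖e u‖ = 1 := by
              simp only [he]; exact AddChar.norm_apply _ _
            have h4 := Complex.mul_conj' (e u)
            rw [h3] at h4
            simpa using h4
        _ = 1 := by
            rw [Finset.sum_const, Finset.card_univ, ZMod.card_units_eq_totient, nsmul_eq_mul,
              mul_one, inv_mul_cancel₀ hφ]
    have h5 : ((∑ χ, ‖κ χ‖ ^ 2 : ℝ) : ℂ) = 1 := by
      rw [← h1]; push_cast
      refine Finset.sum_congr rfl fun χ _ => ?_
      exact (Complex.mul_conj' (κ χ)).symm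
    exact_mod_cast h5
  refine ⟨κ, ?_, ?_, fun n hn => ?_⟩
  · simp only [hκ]
    rw [div_eq_inv_mul, ← sum_stdAddChar_units hb]
    congr 1
    refine Finset.sum_congr rfl fun u _ => ?_
    rw [ZMod.inv_coe_unit, MulChar.one_apply_coe, one_mul]
  · refine Real.le_sqrt_of_sq_le ?_
    refine sq_sum_le_card_mul_sum_sq.trans ?_
    rw [hnorm, mul_one, Finset.card_univ, ← Nat.card_eq_fintype_card,
      DirichletCharacter.card_eq_totient_of_hasEnoughRootsOfUnity]
    exact_mod_cast Nat.totient_le r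
  · have h1 := hinv (ZMod.unitOfCoprime n hn)
    rw [ZMod.coe_unitOfCoprime] at h1
    rw [h1]
    simp only [he]
    have h2 := ZMod.stdAddChar_coe (N := r) (b * n)
    push_cast at h2
    rw [h2]
    congr 1; ring

end

noncomputable section
open Complex MeasureTheory Set Filter Topology Metric

lemma avgOp_pow_congr_on {P : Finset ℕ} {ν : ℕ → ℝ} {s : Set ℕ}
    (hP : ∀ p ∈ P, ∀ n ∈ s, p * n ∈ s) {h h' : ℕ → ℂ} (hh : ∀ n ∈ s, h n = h' n) (k : ℕ)
    {n : ℕ} (hn : n ∈ s) : (avgOp P ν ^ k) h n = (avgOp P ν ^ k) h' n := by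
  induction k generalizing n with
  | zero => simpa using hh n hn
  | succ k ih =>
    simp only [avgOp_pow_succ_apply]
    exact Finset.sum_congr rfl fun p hp => by rw [ih (hP p hp n hn)]

lemma avgOp_pow_congr_ne_zero {P : Finset ℕ} {ν : ℕ → ℝ} (hP : ∀ p ∈ P, p ≠ 0)
    {h h' : ℕ → ℂ} (hh : ∀ n, n ≠ 0 → h n = h' n) (k : ℕ) {n : ℕ} (hn : n ≠ 0) :
    (avgOp P ν ^ k) h n = (avgOp P ν ^ k) h' n :=
  avgOp_pow_congr_on (s := {n | n ≠ 0}) (fun p hp _ hn => mul_ne_zero (hP p hp) hn) hh k hn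

/-- The function `n ↦ e(θ n / N)` with a smooth cutoff at `n ≍ N`. -/
def testFn (θ N : ℝ) (n : ℕ) : ℂ := expPhase θ (Real.log (n / N)) * bump (Real.log (n / N))

lemma norm_avgOp_pow_twist_le {P : Finset ℕ} {ν : ℕ → ℝ} (hP : ∀ p ∈ P, p ≠ 0)
    (hν : ∀ p, 0 ≤ ν p) (h1 : ∑ p ∈ P, ν p ≤ 1) {θ N : ℝ} (hN : 0 < N) {d : ℕ} (hd : d ≠ 0)
    {ψ : ℕ → ℂ} (hψ : ∀ m n, ψ (m * n) = ψ m * ψ n) (hψ1 : ∀ n, ‖ψ n‖ ≤ 1)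
    {A : Set ℝ} (hA : MeasurableSet A) {ρ : ℝ} (hρ : 0 ≤ ρ)
    (hb : ∀ ξ, ξ ∉ A →
      ‖∑ p ∈ P, ν p * (ψ p * (p : ℂ) ^ (-((-(2 * Real.pi * ξ) : ℝ) * I)))‖ ≤ ρ) (k : ℕ) :
    ‖(avgOp P ν ^ k) (fun m => ψ m * testFn θ N (d * m)) 1‖ ≤
      (∫ ξ in A, ‖bumpFourier θ ξ‖) + ρ ^ k * ∫ ξ, ‖bumpFourier θ ξ‖ := by
  have hF := integrable_bumpFourier θ
  set a : ℝ → ℂ := fun ξ => cexp (2 * Real.pi * I * (ξ * Real.log (d / N))) with ha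
  have hac : Continuous a := by fun_prop
  have hanorm : ∀ ξ, ‖a ξ‖ = 1 := fun ξ => by
    rw [ha]; simp only
    rw [show (2 * Real.pi * I * (ξ * Real.log (d / N)) : ℂ) =
      ((2 * Real.pi * (ξ * Real.log (d / N)) : ℝ) : ℂ) * I by push_cast; ring]
    exact norm_exp_ofReal_mul_I _
  set φ : ℝ → ℕ → ℂ := fun ξ m => ψ m * (m : ℂ) ^ (-((-(2 * Real.pi * ξ) : ℝ) * I)) with hφ
  have hφm : ∀ ξ m n, φ ξ (m * n) = φ ξ m * φ ξ n := fun ξ m n => by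
    simp only [hφ, hψ, Nat.cast_mul, natCast_mul_natCast_cpow]; ring
  have hφ1 : ∀ ξ n, ‖φ ξ n‖ ≤ 1 := fun ξ n => by
    simp only [hφ, norm_mul]
    exact mul_le_one₀ (hψ1 n) (norm_nonneg _) (norm_natCast_cpow_mul_I_le_one n _)
  have hexp : ∀ ξ : ℝ, ∀ m : ℕ, m ≠ 0 → (m : ℂ) ^ (-((-(2 * Real.pi * ξ) : ℝ) * I)) =
      cexp (2 * Real.pi * I * (ξ * Real.log m)) := fun ξ m hm => by
    rw [cpow_def_of_ne_zero (by exact_mod_cast hm), ← natCast_log]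
    congr 1; push_cast; ring
  set w : ℝ → ℕ → ℂ := fun ξ m => if m = 0 then 0 else bumpFourier θ ξ * a ξ * φ ξ m with hw
  have hwint : ∀ m, Integrable (fun ξ => w ξ m) := fun m => by
    by_cases hm : m = 0
    · simp [hw, hm]
    · simp only [hw, if_neg hm]
      refine hF.mono ?_ (Eventually.of_forall fun ξ => ?_)
      · refine Continuous.aestronglyMeasurable ?_
        refine ((continuous_bumpFourier θ).mul hac).mul (continuous_const.mul ?_)
        simp only [hexp _ m hm]
        fun_prop
      · rw [norm_mul, norm_mul, hanorm, mul_one]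
        exact mul_le_of_le_one_right (norm_nonneg _) (hφ1 _ _)
  have hrepr : ∀ m : ℕ, m ≠ 0 → ψ m * testFn θ N (d * m) = ∫ ξ, w ξ m := fun m hm => by
    rw [testFn, bump_mul_expPhase_eq, ← integral_const_mul]
    refine integral_congr_ae (Eventually.of_forall fun ξ => ?_)
    simp only [hw, if_neg hm, hφ, hexp ξ m hm, ha]
    have hlog : Real.log ((d * m : ℕ) / N) = Real.log (d / N) + Real.log m := by
      rw [← Real.log_mul (by positivity) (by positivity)]
      congr 1; push_cast; ring
    rw [hlog]; push_cast
    rw [mul_add, mul_add, Complex.exp_add]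
    ring
  rw [avgOp_pow_congr_ne_zero hP hrepr k one_ne_zero, (avgOp_pow_integral hwint k 1).2]
  have hval : ∀ ξ, (avgOp P ν ^ k) (w ξ) 1 =
      bumpFourier θ ξ * a ξ * ((∑ p ∈ P, ν p * φ ξ p) ^ k * φ ξ 1) := fun ξ => by
    rw [avgOp_pow_congr_ne_zero hP (h' := (bumpFourier θ ξ * a ξ) • φ ξ)
      (fun m hm => by simp [hw, hm]) k one_ne_zero, map_smul, Pi.smul_apply, smul_eq_mul,
      avgOp_pow_apply_of_mul (fun p _ n => hφm ξ p n)]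
  have hsum1 : ∀ ξ, ‖∑ p ∈ P, ν p * φ ξ p‖ ≤ 1 := fun ξ => by
    refine (norm_sum_le _ _).trans (le_trans (Finset.sum_le_sum fun p _ => ?_) h1)
    rw [norm_mul, norm_real, Real.norm_of_nonneg (hν p)]
    exact mul_le_of_le_one_right (hν p) (hφ1 _ _)
  have hbd : ∀ ξ, ‖(avgOp P ν ^ k) (w ξ) 1‖ ≤ A.indicator (fun ξ => ‖bumpFourier θ ξ‖) ξ +
      ρ ^ k * ‖bumpFourier θ ξ‖ := fun ξ => by
    rw [hval, norm_mul, norm_mul, hanorm, mul_one, norm_mul, norm_pow]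
    have h0 := norm_nonneg (bumpFourier θ ξ)
    by_cases hξ : ξ ∈ A
    · rw [indicator_of_mem hξ]
      have : ‖∑ p ∈ P, ν p * φ ξ p‖ ^ k * ‖φ ξ 1‖ ≤ 1 :=
        mul_le_one₀ (pow_le_one₀ (norm_nonneg _) (hsum1 ξ)) (norm_nonneg _) (hφ1 _ _)
      have : 0 ≤ ρ ^ k * ‖bumpFourier θ ξ‖ := by positivity
      nlinarith
    · rw [indicator_of_notMem hξ, zero_add, mul_comm]
      refine mul_le_mul_of_nonneg_right ?_ h0
      exact (mul_le_of_le_one_right (by positivity) (hφ1 _ _)).trans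
        (pow_le_pow_left₀ (norm_nonneg _) (hb ξ hξ) k)
  refine (norm_integral_le_integral_norm _).trans ?_
  have hi1 := hF.norm.indicator hA
  have hi2 := hF.norm.const_mul (ρ ^ k)
  refine (integral_mono (avgOp_pow_integral hwint k 1).1.norm (hi1.add hi2) hbd).trans_eq ?_
  rw [integral_add' hi1 hi2, integral_indicator hA, integral_const_mul]

end

noncomputable section
open Complex MeasureTheory Set Filter Topology Metric
open scoped ArithmeticFunction.Moebius

/-- The constant in the bounds for the Fourier transform of the twisted bump. -/
def bumpConst : ℝ := exists_bumpFourier_bound.choose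

lemma one_le_bumpConst : 1 ≤ bumpConst := exists_bumpFourier_bound.choose_spec.1

lemma integral_bumpFourier_le (θ : ℝ) : ∫ ξ, ‖bumpFourier θ ξ‖ ≤ bumpConst * (1 + |θ|) :=
  (exists_bumpFourier_bound.choose_spec.2 θ).1

lemma integral_bumpFourier_tail_le (θ : ℝ) {T : ℝ} (hT : 1 ≤ T) :
    ∫ ξ in {ξ : ℝ | T < |ξ|}, ‖bumpFourier θ ξ‖ ≤ bumpConst * (1 + |θ|) ^ 2 / T :=
  (exists_bumpFourier_bound.choose_spec.2 θ).2.1 T hT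

lemma integral_bumpFourier_center_le (θ : ℝ) :
    ∫ ξ in {ξ : ℝ | |ξ| ≤ 1}, ‖bumpFourier θ ξ‖ ≤ bumpConst / (1 + |θ|) := by
  rw [le_div_iff₀ (by positivity), mul_comm]
  exact (exists_bumpFourier_bound.choose_spec.2 θ).2.2

/-- The normalized Ramanujan sum `μ(r)/φ(r)`. -/
def ramCoeff (r : ℕ) : ℂ := (μ r : ℂ) / r.totient

/-- The error term in the evaluation of averages of the test function. -/
def avgErr (θ T ρ : ℝ) (k : ℕ) : ℝ :=
  bumpConst * (1 + |θ|) ^ 2 / T + ρ ^ k * (bumpConst * (1 + |θ|))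

lemma avgErr_nonneg (θ : ℝ) {T ρ : ℝ} (hT : 1 ≤ T) (hρ : 0 ≤ ρ) (k : ℕ) :
    0 ≤ avgErr θ T ρ k := by
  have := one_le_bumpConst
  unfold avgErr; positivity

lemma GoodWeight.norm_filter_sum_le {j : ℕ} {P : Finset ℕ} {ν : ℕ → ℝ} (hG : GoodWeight j P ν)
    (s : ℕ → Prop) [DecidablePred s] {z : ℕ → ℂ} (hz : ∀ p, ‖z p‖ ≤ 1) :
    ‖∑ p ∈ P.filter (fun p => ¬ s p), ν p * z p‖ ≤
      ‖∑ p ∈ P, ν p * z p‖ + ∑ p ∈ P.filter s, ν p := by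
  have h := Finset.sum_filter_add_sum_filter_not P s (fun p => ν p * z p)
  rw [← eq_sub_iff_add_eq'] at h
  rw [h]
  refine (norm_sub_le _ _).trans (add_le_add_right ((norm_sum_le _ _).trans
    (Finset.sum_le_sum fun p _ => ?_)) _)
  rw [norm_mul, norm_real, Real.norm_of_nonneg (hG.nonneg p)]
  exact mul_le_of_le_one_right (hG.nonneg p) (hz p)

lemma GoodWeight.sum_filter_le_one {j : ℕ} {P : Finset ℕ} {ν : ℕ → ℝ} (hG : GoodWeight j P ν)
    (s : ℕ → Prop) [DecidablePred s] : ∑ p ∈ P.filter s, ν p ≤ 1 := by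
  rw [← hG.sum_eq_one]
  exact Finset.sum_le_sum_of_subset_of_nonneg (Finset.filter_subset _ _) fun p _ _ => hG.nonneg p

lemma GoodWeight.ne_zero {j : ℕ} {P : Finset ℕ} {ν : ℕ → ℝ} (hG : GoodWeight j P ν) :
    ∀ p ∈ P, p ≠ 0 := fun p hp => (hG.prime p hp).ne_zero

lemma GoodWeight.norm_avgOp_testFn_le {j : ℕ} {P : Finset ℕ} {ν : ℕ → ℝ} (hG : GoodWeight j P ν)
    (s : ℕ → Prop) [DecidablePred s] {θ N T ρ : ℝ} (hN : 0 < N) (hT : 1 ≤ T)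
    (hTj : Real.log (8 * (2 * Real.pi * T + 6)) ≤ Real.exp (5 / 1000 * j))
    (hρ : Real.exp (-(39 / 100) * j) + ∑ p ∈ P.filter s, ν p ≤ ρ) (k : ℕ) {d : ℕ} (hd : d ≠ 0) :
    ‖(avgOp (P.filter fun p => ¬ s p) ν ^ k) (testFn θ N) d‖ ≤
      bumpConst / (1 + |θ|) + avgErr θ T ρ k := by
  have hρ0 : 0 ≤ ρ := le_trans (add_nonneg (Real.exp_pos _).le
    (Finset.sum_nonneg fun p _ => hG.nonneg p)) hρ
  have hA1 : MeasurableSet {ξ : ℝ | |ξ| ≤ 1} := measurableSet_le (by fun_prop) (by fun_prop)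
  have hA2 : MeasurableSet {ξ : ℝ | T < |ξ|} := measurableSet_lt (by fun_prop) (by fun_prop)
  have h := norm_avgOp_pow_twist_le (P := P.filter fun p => ¬ s p)
    (fun p hp => hG.ne_zero p (Finset.mem_filter.1 hp).1) hG.nonneg
    (hG.sum_filter_le_one _) (θ := θ) hN hd (ψ := fun _ => 1) (by simp) (by simp)
    (hA1.union hA2) hρ0 (fun ξ hξ => ?_) k
  · simp only [one_mul] at h
    rw [← avgOp_pow_apply_mul, mul_one] at h
    refine h.trans ?_
    have hF := (integrable_bumpFourier θ).norm
    have hdisj : Disjoint {ξ : ℝ | |ξ| ≤ 1} {ξ : ℝ | T < |ξ|} :=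
      Set.disjoint_left.2 fun ξ (h1 : |ξ| ≤ 1) (h2 : T < |ξ|) => by linarith
    rw [setIntegral_union hdisj hA2 hF.integrableOn hF.integrableOn, add_assoc, avgErr]
    exact add_le_add (integral_bumpFourier_center_le θ) (add_le_add
      (integral_bumpFourier_tail_le θ hT)
      (mul_le_mul_of_nonneg_left (integral_bumpFourier_le θ) (by positivity)))
  · simp only [mem_union, not_or, not_le, not_lt, mem_ofPred_eq] at hξ
    simp only [one_mul]
    refine (hG.norm_filter_sum_le s (fun p => norm_natCast_cpow_mul_I_le_one p _)).trans
      (le_trans (add_le_add_left (hG.cpow _ ?_ ?_) _) hρ)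
    · rw [abs_neg, abs_mul, abs_of_pos Real.two_pi_pos]
      nlinarith [Real.pi_gt_three, hξ.1]
    · refine le_trans (Real.log_le_log (by positivity) ?_) hTj
      rw [abs_neg, abs_mul, abs_of_pos Real.two_pi_pos]
      have := mul_le_mul_of_nonneg_left hξ.2 Real.two_pi_pos.le
      linarith

theorem GoodWeight.norm_avgOp_exp_sub_le {j : ℕ} {P : Finset ℕ} {ν : ℕ → ℝ}
    (hG : GoodWeight j P ν) (r : ℕ) [NeZero r] {b : ℤ} (hb : IsUnit (b : ZMod r))
    {θ N T ρ : ℝ} (hN : 0 < N) (hT : 1 ≤ T)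
    (hTj : Real.log (8 * r * (2 * Real.pi * T + 6)) ≤ Real.exp (5 / 1000 * j))
    (hρ : Real.exp (-(39 / 100) * j) + ∑ p ∈ P.filter (· ∣ r), ν p ≤ ρ) (k : ℕ)
    {d : ℕ} (hd : d ≠ 0) :
    ‖(avgOp (P.filter fun p => ¬ p ∣ r) ν ^ k)
        (fun n => cexp (2 * Real.pi * I * (b * n / r)) * testFn θ N n) d -
      ramCoeff (r / r.gcd d) * (avgOp (P.filter fun p => ¬ p ∣ r) ν ^ k) (testFn θ N) d‖ ≤
      √r * avgErr θ T ρ k := by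
  have hρ0 : 0 ≤ ρ := le_trans (add_nonneg (Real.exp_pos _).le
    (Finset.sum_nonneg fun p _ => hG.nonneg p)) hρ
  set P' := P.filter fun p => ¬ p ∣ r with hP'
  set g := r.gcd d with hg
  have hr0 : r ≠ 0 := NeZero.ne r
  have hg0 : 0 < g := Nat.gcd_pos_of_pos_left _ (NeZero.pos r)
  set r' := r / g with hr'
  set d' := d / g with hd'
  have hrg : r = g * r' := (Nat.mul_div_cancel' (Nat.gcd_dvd_left r d)).symm
  have hdg : d = g * d' := (Nat.mul_div_cancel' (Nat.gcd_dvd_right r d)).symm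
  have hr'0 : r' ≠ 0 := fun h => hr0 (by rw [hrg, h, mul_zero])
  have : NeZero r' := ⟨hr'0⟩
  have hcop : r'.Coprime d' := Nat.coprime_div_gcd_div_gcd hg0
  have hr'r : r' ∣ r := ⟨g, by rw [mul_comm]; exact hrg⟩
  have hunit : IsUnit (((b * d' : ℤ)) : ZMod r') := by
    push_cast
    refine IsUnit.mul ?_ ((ZMod.isUnit_iff_coprime d' r').2 hcop.symm)
    have := hb.map (ZMod.castHom hr'r (ZMod r'))
    rwa [map_intCast] at this
  obtain ⟨κ, hκ1, hκsum, hκ⟩ := exists_char_expansion r' hunit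
  have hP'cop : ∀ p ∈ P', p.Coprime r' := fun p hp => by
    obtain ⟨h1, h2⟩ := Finset.mem_filter.1 hp
    exact Nat.Coprime.coprime_dvd_right hr'r (((hG.prime p h1).coprime_iff_not_dvd).2 h2)
  set X : DirichletCharacter ℂ r' → ℂ := fun χ =>
    (avgOp P' ν ^ k) (fun m => χ m * testFn θ N (d * m)) 1 with hX
  have hexp : (avgOp P' ν ^ k)
      (fun n => cexp (2 * Real.pi * I * (b * n / r)) * testFn θ N n) d = ∑ χ, κ χ * X χ := by
    conv_lhs => rw [← mul_one d]
    rw [avgOp_pow_apply_mul, avgOp_pow_congr hP'cop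
      (h' := ∑ χ, κ χ • fun m : ℕ => χ m * testFn θ N (d * m)) (fun m hm => ?_) k
      (Nat.coprime_one_left r'), map_sum, Finset.sum_apply]
    · simp only [map_smul, Pi.smul_apply, smul_eq_mul, hX]
    · have h1 := hκ m hm
      have h2 : (2 * Real.pi * I * (b * ((d * m : ℕ) : ℂ) / r) : ℂ) =
          2 * Real.pi * I * ((b * d' : ℤ) * m / r') := by
        have e1 : (r : ℂ) = g * r' := by exact_mod_cast hrg
        have e2 : (d : ℂ) = g * d' := by exact_mod_cast hdg
        have e3 : (g : ℂ) ≠ 0 := by exact_mod_cast hg0.ne'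
        have e4 : (r' : ℂ) ≠ 0 := by exact_mod_cast hr'0
        push_cast
        rw [e1, e2]
        field_simp
      rw [h2, h1, Finset.sum_apply, Finset.sum_mul]
      exact Finset.sum_congr rfl fun χ _ => by simp [mul_assoc]
  have hX1 : X 1 = (avgOp P' ν ^ k) (testFn θ N) d := by
    conv_rhs => rw [← mul_one d]
    rw [avgOp_pow_apply_mul]
    refine avgOp_pow_congr hP'cop (fun m hm => ?_) k (Nat.coprime_one_left r')
    rw [MulChar.one_apply ((ZMod.isUnit_iff_coprime m r').2 hm), one_mul]
  have hXle : ∀ χ, χ ≠ 1 → ‖X χ‖ ≤ avgErr θ T ρ k := fun χ hχ => by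
    have hA2 : MeasurableSet {ξ : ℝ | T < |ξ|} := measurableSet_lt (by fun_prop) (by fun_prop)
    refine (norm_avgOp_pow_twist_le (P := P')
      (fun p hp => hG.ne_zero p (Finset.mem_filter.1 hp).1) hG.nonneg
      (hG.sum_filter_le_one _) (θ := θ) hN hd (ψ := fun m : ℕ => χ m) (by simp)
      (fun n => χ.norm_le_one _) hA2 hρ0 (fun ξ hξ => ?_) k).trans (add_le_add
      (integral_bumpFourier_tail_le θ hT)
      (mul_le_mul_of_nonneg_left (integral_bumpFourier_le θ) (by positivity)))
    simp only [not_lt, mem_ofPred_eq] at hξ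
    refine (hG.norm_filter_sum_le (· ∣ r) (fun p => ?_)).trans
      (le_trans (add_le_add_left (hG.twist r' χ hχ _ ?_) _) hρ)
    · rw [norm_mul]
      exact mul_le_one₀ (χ.norm_le_one _) (norm_nonneg _) (norm_natCast_cpow_mul_I_le_one p _)
    · refine le_trans (Real.log_le_log (by positivity) ?_) hTj
      rw [abs_neg, abs_mul, abs_of_pos Real.two_pi_pos]
      have h1 := mul_le_mul_of_nonneg_left hξ Real.two_pi_pos.le
      have h2 : (r' : ℝ) ≤ r := by exact_mod_cast Nat.le_of_dvd (NeZero.pos r) hr'r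
      gcongr
  rw [hexp, ← Finset.add_sum_erase _ _ (Finset.mem_univ (1 : DirichletCharacter ℂ r')), hκ1, hX1,
    ramCoeff, add_sub_cancel_left]
  have he := avgErr_nonneg θ hT hρ0 k
  calc ‖∑ χ ∈ Finset.univ.erase 1, κ χ * X χ‖
      ≤ ∑ χ ∈ Finset.univ.erase 1, ‖κ χ‖ * avgErr θ T ρ k := by
        refine (norm_sum_le _ _).trans (Finset.sum_le_sum fun χ hχ => ?_)
        rw [norm_mul]
        exact mul_le_mul_of_nonneg_left (hXle χ (Finset.ne_of_mem_erase hχ)) (norm_nonneg _)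
    _ ≤ ∑ χ, ‖κ χ‖ * avgErr θ T ρ k :=
        Finset.sum_le_sum_of_subset_of_nonneg (Finset.erase_subset _ _)
          fun χ _ _ => mul_nonneg (norm_nonneg _) he
    _ = (∑ χ, ‖κ χ‖) * avgErr θ T ρ k := by rw [Finset.sum_mul]
    _ ≤ √r * avgErr θ T ρ k := by
        refine mul_le_mul_of_nonneg_right (hκsum.trans (Real.sqrt_le_sqrt ?_)) he
        exact_mod_cast Nat.le_of_dvd (NeZero.pos r) hr'r

end

noncomputable section
open Complex MeasureTheory Set Filter Topology Metric
open scoped ArithmeticFunction.Moebius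

lemma rpow_three_quarters_le {p : ℕ} (hp : p.Prime) :
    (p : ℝ) ^ (3/4 : ℝ) ≤
      (p - 1 : ℕ) * ((if p = 2 then 2 else 1) * (if p = 3 then 2 else 1)) := by
  have key : ∀ y : ℝ, 0 ≤ y → (p : ℝ) ^ 3 ≤ y ^ 4 → (p : ℝ) ^ (3/4 : ℝ) ≤ y := fun y hy h => by
    calc (p : ℝ) ^ (3/4 : ℝ) = ((p : ℝ) ^ 3) ^ (1/4 : ℝ) := by
          rw [← Real.rpow_natCast, ← Real.rpow_mul (by positivity)]; norm_num
      _ ≤ (y ^ 4) ^ (1/4 : ℝ) := Real.rpow_le_rpow (by positivity) h (by norm_num)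
      _ = y := by rw [← Real.rpow_natCast, ← Real.rpow_mul hy]; norm_num
  refine key _ (by positivity) ?_
  have h2 := hp.two_le
  by_cases h2' : p = 2
  · subst h2'; norm_num
  by_cases h3 : p = 3
  · subst h3; norm_num
  rw [if_neg h2', if_neg h3, mul_one, mul_one]
  have h5 : 5 ≤ p := by
    by_contra h
    have : p = 4 := by omega
    subst this
    exact absurd hp (by decide)
  obtain ⟨q, rfl⟩ : ∃ q, p = q + 5 := ⟨p - 5, by omega⟩
  have : q + 5 - 1 = q + 4 := rfl
  rw [this]
  have : (q + 5) ^ 3 ≤ (q + 4) ^ 4 := by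
    nlinarith [Nat.zero_le q, Nat.zero_le (q^2), Nat.zero_le (q^3), Nat.zero_le (q^4)]
  exact_mod_cast this

lemma norm_ramCoeff_le (r : ℕ) : ‖ramCoeff r‖ ≤ 4 * (r : ℝ) ^ (-(3/4) : ℝ) := by
  rcases Nat.eq_zero_or_pos r with rfl | hr
  · simp [ramCoeff]
  by_cases hsq : Squarefree r
  swap
  · rw [ramCoeff, ArithmeticFunction.moebius_eq_zero_of_not_squarefree hsq]
    simp only [Int.cast_zero, zero_div, norm_zero]; positivity
  have hμ : ‖(μ r : ℂ)‖ = 1 := by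
    have := ArithmeticFunction.abs_moebius_eq_one_of_squarefree hsq
    rw [Complex.norm_intCast, ← Int.cast_abs, this, Int.cast_one]
  rw [ramCoeff, norm_div, hμ, Complex.norm_natCast, Real.rpow_neg (by positivity),
    ← div_eq_mul_inv]
  have hφ0 : 0 < r.totient := Nat.totient_pos.2 hr
  rw [div_le_div_iff₀ (by positivity) (by positivity), one_mul]
  have hr1 : r = ∏ p ∈ r.primeFactors, p := (Nat.prod_primeFactors_of_squarefree hsq).symm
  have hφ1 : r.totient = ∏ p ∈ r.primeFactors, (p - 1) := by
    rw [Nat.totient_eq_div_primeFactors_mul, ← hr1, Nat.div_self hr, one_mul]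
  calc (r : ℝ) ^ (3/4 : ℝ) = ∏ p ∈ r.primeFactors, (p : ℝ) ^ (3/4 : ℝ) := by
        rw [Real.finsetProd_rpow _ _ (fun p _ => by positivity)]
        rw [← Nat.cast_prod, ← hr1]
    _ ≤ ∏ p ∈ r.primeFactors, (((p - 1 : ℕ) : ℝ) *
          ((if p = 2 then 2 else 1) * (if p = 3 then 2 else 1))) :=
        Finset.prod_le_prod (fun p _ => by positivity)
          fun p hp => rpow_three_quarters_le (Nat.prime_of_mem_primeFactors hp)
    _ = r.totient * ((if 2 ∈ r.primeFactors then 2 else 1) *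
          (if 3 ∈ r.primeFactors then 2 else 1)) := by
        rw [Finset.prod_mul_distrib, Finset.prod_mul_distrib, Finset.prod_ite_eq',
          Finset.prod_ite_eq', hφ1]
        push_cast
        rfl
    _ ≤ r.totient * (2 * 2) := by
        gcongr <;> split_ifs <;> norm_num
    _ = 4 * r.totient := by ring

lemma norm_ramCoeff_le_one (r : ℕ) : ‖ramCoeff r‖ ≤ 1 := by
  rcases Nat.eq_zero_or_pos r with rfl | hr
  · simp [ramCoeff]
  have hφ0 : (1 : ℝ) ≤ r.totient := by exact_mod_cast Nat.totient_pos.2 hr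
  have hμ : ‖(μ r : ℂ)‖ ≤ 1 := by
    rw [Complex.norm_intCast]
    exact_mod_cast ArithmeticFunction.abs_moebius_le_one
  rw [ramCoeff, norm_div, Complex.norm_natCast]
  exact div_le_one_of_le₀ (hμ.trans hφ0) (by positivity)

lemma norm_avgOp_pow_le_add {P : Finset ℕ} {ν : ℕ → ℝ} (hP : ∀ p ∈ P, p ≠ 0)
    (hν : ∀ p, 0 ≤ ν p) {g : ℕ → ℝ} (hg : ∀ p ∈ P, ∀ n, g (p * n) = g p * g n) {h : ℕ → ℂ}
    {B D : ℝ} (hh : ∀ n, n ≠ 0 → ‖h n‖ ≤ B * g n + D) (k : ℕ) {n : ℕ} (hn : n ≠ 0) :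
    ‖(avgOp P ν ^ k) h n‖ ≤ B * (∑ p ∈ P, ν p * g p) ^ k * g n + D * (∑ p ∈ P, ν p) ^ k := by
  induction k generalizing n with
  | zero => simpa using hh n hn
  | succ k ih =>
    rw [avgOp_pow_succ_apply]
    refine (norm_sum_le _ _).trans ?_
    have e : B * (∑ p ∈ P, ν p * g p) ^ (k + 1) * g n + D * (∑ p ∈ P, ν p) ^ (k + 1) =
        ∑ p ∈ P, ν p * (B * (∑ p ∈ P, ν p * g p) ^ k * (g p * g n) + D * (∑ p ∈ P, ν p) ^ k) := by
      simp only [mul_add, Finset.sum_add_distrib, pow_succ]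
      rw [← Finset.sum_mul, mul_comm (∑ p ∈ P, ν p) (D * _), mul_assoc D,
        show B * ((∑ p ∈ P, ν p * g p) ^ k * ∑ p ∈ P, ν p * g p) * g n =
          (∑ p ∈ P, ν p * g p) * (B * (∑ p ∈ P, ν p * g p) ^ k * g n) by ring]
      nth_rewrite 1 [Finset.sum_mul]
      congr 1
      exact Finset.sum_congr rfl fun p _ => by ring
    rw [e]
    refine Finset.sum_le_sum fun p hp => ?_
    rw [norm_mul, norm_real, Real.norm_of_nonneg (hν p), ← hg p hp n]
    exact mul_le_mul_of_nonneg_left (ih (mul_ne_zero (hP p hp) hn)) (hν p)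

/-- The exponential sum over smooth numbers of size about `N`. -/
def soup (P : Finset ℕ) (ν : ℕ → ℝ) (J : ℕ) (N α : ℝ) : ℂ :=
  (avgOp P ν ^ J) (fun n => cexp (2 * Real.pi * I * (α * n)) * bump (Real.log (n / N))) 1

lemma testFn_eq {N : ℝ} (hN : 0 < N) (β : ℝ) {n : ℕ} (hn : n ≠ 0) :
    testFn (β * N) N n = cexp (2 * Real.pi * I * (β * n)) * bump (Real.log (n / N)) := by
  rw [testFn, expPhase, Real.exp_log (by positivity)]
  congr 3
  push_cast
  have : (N : ℂ) ≠ 0 := by exact_mod_cast hN.ne'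
  field_simp

lemma soup_eq_avgOp_testFn {P : Finset ℕ} (hP : ∀ p ∈ P, p ≠ 0) (ν : ℕ → ℝ) (J : ℕ) {N : ℝ}
    (hN : 0 < N) (β : ℝ) : soup P ν J N β = (avgOp P ν ^ J) (testFn (β * N) N) 1 :=
  avgOp_pow_congr_ne_zero hP (fun _ hn => (testFn_eq hN β hn).symm) J one_ne_zero

lemma soup_eq_avgOp_exp {P : Finset ℕ} (hP : ∀ p ∈ P, p ≠ 0) (ν : ℕ → ℝ) (J : ℕ) {N : ℝ}
    (hN : 0 < N) (b : ℤ) (r : ℕ) (β : ℝ) : soup P ν J N (b / r + β) =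
      (avgOp P ν ^ J) (fun n => cexp (2 * Real.pi * I * (b * n / r)) * testFn (β * N) N n) 1 := by
  refine avgOp_pow_congr_ne_zero hP (fun n hn => ?_) J one_ne_zero
  rw [testFn_eq hN β hn, ← mul_assoc (cexp _), ← Complex.exp_add]
  congr 2
  push_cast; ring

theorem GoodWeight.norm_soup_sub_le {j : ℕ} {P : Finset ℕ} {ν : ℕ → ℝ}
    (hG : GoodWeight j P ν) {r : ℕ} [NeZero r] (hPr : ∀ p ∈ P, ¬ p ∣ r) {b : ℤ}
    (hb : IsUnit (b : ZMod r)) (β : ℝ) {N T : ℝ} (hN : 0 < N) (hT : 1 ≤ T)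
    (hTj : Real.log (8 * r * (2 * Real.pi * T + 6)) ≤ Real.exp (5 / 1000 * j)) (J : ℕ) :
    ‖soup P ν J N (b / r + β) - ramCoeff r * soup P ν J N β‖ ≤
      √r * avgErr (β * N) T (Real.exp (-(39 / 100) * j)) J := by
  have hf : P.filter (fun p => ¬ p ∣ r) = P := Finset.filter_true_of_mem hPr
  have hf' : P.filter (· ∣ r) = ∅ := Finset.filter_false_of_mem hPr
  have h := hG.norm_avgOp_exp_sub_le r hb (θ := β * N) hN hT hTj le_rfl J one_ne_zero
  rw [hf, hf', Finset.sum_empty, add_zero, Nat.gcd_one_right, Nat.div_one] at h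
  rw [soup_eq_avgOp_exp hG.ne_zero ν J hN, soup_eq_avgOp_testFn hG.ne_zero ν J hN]
  exact h

theorem GoodWeight.norm_soup_le {j : ℕ} {P : Finset ℕ} {ν : ℕ → ℝ}
    (hG : GoodWeight j P ν) (r : ℕ) [NeZero r] {b : ℤ}
    (hb : IsUnit (b : ZMod r)) (β : ℝ) {N T : ℝ} (hN : 0 < N) (hT : 1 ≤ T)
    (hTj : Real.log (8 * r * (2 * Real.pi * T + 6)) ≤ Real.exp (5 / 1000 * j)) (J : ℕ) :
    ‖soup P ν J N (b / r + β)‖ ≤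
      4 * (r : ℝ) ^ (-(3/4) : ℝ) * (bumpConst / (1 + |β * N|)) *
        (1 + ∑ p ∈ P.filter (· ∣ r), ν p * (p : ℝ) ^ (3/4 : ℝ)) ^ J +
      2 * √r * (bumpConst * (1 + |β * N|) ^ 2 / T * (1 + ∑ p ∈ P.filter (· ∣ r), ν p) ^ J +
        bumpConst * (1 + |β * N|) * (Real.exp (-(39 / 100) * j) +
          2 * ∑ p ∈ P.filter (· ∣ r), ν p) ^ J) := by
  set θ := β * N
  set m1 := ∑ p ∈ P.filter (· ∣ r), ν p with hm1
  set m2 := ∑ p ∈ P.filter (· ∣ r), ν p * (p : ℝ) ^ (3/4 : ℝ) with hm2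
  set ρ := Real.exp (-(39 / 100) * j) + m1 with hρ
  have hm10 : 0 ≤ m1 := Finset.sum_nonneg fun p _ => hG.nonneg p
  have hρ0 : 0 ≤ ρ := add_nonneg (Real.exp_pos _).le hm10
  have hC := one_le_bumpConst
  have hr1 : (1 : ℝ) ≤ r := by exact_mod_cast NeZero.pos r
  have hTj' : Real.log (8 * (2 * Real.pi * T + 6)) ≤ Real.exp (5 / 1000 * j) := by
    refine le_trans (Real.log_le_log (by positivity) ?_) hTj
    have : 0 ≤ 2 * Real.pi * T + 6 := by positivity
    nlinarith
  set T₁ := avgOp (P.filter (· ∣ r)) ν with hT₁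
  set T₂ := avgOp (P.filter fun p => ¬ p ∣ r) ν with hT₂
  set H : ℕ → ℂ := fun n => cexp (2 * Real.pi * I * (b * n / r)) * testFn θ N n with hH
  set M := 4 * (r : ℝ) ^ (-(3/4) : ℝ) * (bumpConst / (1 + |θ|)) with hM
  have hM0 : 0 ≤ M := by positivity
  have hpt : ∀ k d : ℕ, d ≠ 0 → ‖(T₂ ^ k) H d‖ ≤
      M * (d : ℝ) ^ (3/4 : ℝ) + 2 * √r * avgErr θ T ρ k := fun k d hd => by
    have h1 := hG.norm_avgOp_exp_sub_le r hb (θ := θ) hN hT hTj le_rfl k hd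
    have h2 := hG.norm_avgOp_testFn_le (· ∣ r) (θ := θ) hN hT hTj' (ρ := ρ) le_rfl k hd
    have h3 := norm_ramCoeff_le_one (r / r.gcd d)
    have h4 := norm_ramCoeff_le (r / r.gcd d)
    have he := avgErr_nonneg θ hT hρ0 k
    have hg0 : 0 < r.gcd d := Nat.gcd_pos_of_pos_left _ (NeZero.pos r)
    have h5 : (((r / r.gcd d : ℕ) : ℝ)) ^ (-(3/4) : ℝ) ≤
        (r : ℝ) ^ (-(3/4) : ℝ) * (d : ℝ) ^ (3/4 : ℝ) := by
      rw [Nat.cast_div (Nat.gcd_dvd_left r d) (by exact_mod_cast hg0.ne'),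
        Real.div_rpow (by positivity) (by positivity), div_eq_mul_inv,
        ← Real.rpow_neg (by positivity), neg_neg]
      gcongr
      exact Nat.le_of_dvd (Nat.pos_of_ne_zero hd) (Nat.gcd_dvd_right r d)
    have h6 : 1 ≤ √r := by rwa [Real.one_le_sqrt]
    calc ‖(T₂ ^ k) H d‖ ≤ √r * avgErr θ T ρ k +
          ‖ramCoeff (r / r.gcd d)‖ * ‖(T₂ ^ k) (testFn θ N) d‖ := by
          rw [← norm_mul]
          have := norm_le_norm_sub_add ((T₂ ^ k) H d) (ramCoeff (r / r.gcd d) * (T₂ ^ k) (testFn θ N) d)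
          linarith
      _ ≤ √r * avgErr θ T ρ k +
          ‖ramCoeff (r / r.gcd d)‖ * (bumpConst / (1 + |θ|) + avgErr θ T ρ k) := by gcongr
      _ = √r * avgErr θ T ρ k + (‖ramCoeff (r / r.gcd d)‖ * (bumpConst / (1 + |θ|)) +
          ‖ramCoeff (r / r.gcd d)‖ * avgErr θ T ρ k) := by ring
      _ ≤ √r * avgErr θ T ρ k + (4 * ((r : ℝ) ^ (-(3/4) : ℝ) * (d : ℝ) ^ (3/4 : ℝ)) *
          (bumpConst / (1 + |θ|)) + √r * avgErr θ T ρ k) := by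
          gcongr
          · exact h4.trans (by gcongr)
          · exact h3.trans h6
      _ = _ := by rw [hM]; ring
  have hterm : ∀ i k : ℕ, ‖(T₁ ^ i) ((T₂ ^ k) H) 1‖ ≤
      M * m2 ^ i + 2 * √r * avgErr θ T ρ k * m1 ^ i := fun i k => by
    have h := norm_avgOp_pow_le_add (P := P.filter (· ∣ r)) (ν := ν)
      (fun p hp => hG.ne_zero p (Finset.mem_filter.1 hp).1) hG.nonneg
      (g := fun n : ℕ => (n : ℝ) ^ (3/4 : ℝ))
      (fun p _ n => by push_cast; exact Real.mul_rpow (by positivity) (by positivity))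
      (hpt k) i one_ne_zero
    simpa using h
  have hsplit : (avgOp P ν ^ J) H 1 =
      ∑ i ∈ Finset.range (J + 1), (J.choose i : ℂ) * (T₁ ^ i) ((T₂ ^ (J - i)) H) 1 := by
    rw [← avgOp_filter_add P ν (· ∣ r), (avgOp_commute _ _ ν).add_pow, LinearMap.sum_apply,
      Finset.sum_apply]
    refine Finset.sum_congr rfl fun i _ => ?_
    rw [← Nat.cast_comm, ← nsmul_eq_mul, LinearMap.smul_apply, Pi.smul_apply, nsmul_eq_mul,
      Module.End.mul_apply]
  rw [soup_eq_avgOp_exp hG.ne_zero ν J hN, hsplit]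
  calc _ ≤ ∑ i ∈ Finset.range (J + 1), (J.choose i : ℝ) *
        (M * m2 ^ i + 2 * √r * avgErr θ T ρ (J - i) * m1 ^ i) := by
        refine (norm_sum_le _ _).trans (Finset.sum_le_sum fun i _ => ?_)
        rw [norm_mul, Complex.norm_natCast]
        exact mul_le_mul_of_nonneg_left (hterm i _) (by positivity)
    _ = M * (m2 + 1) ^ J + 2 * √r * (bumpConst * (1 + |θ|) ^ 2 / T * (m1 + 1) ^ J +
        bumpConst * (1 + |θ|) * (m1 + ρ) ^ J) := by
        rw [add_pow m2 1 J, add_pow m1 1 J, add_pow m1 ρ J]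
        simp only [Finset.mul_sum, ← Finset.sum_add_distrib, one_pow]
        exact Finset.sum_congr rfl fun i _ => by rw [avgErr]; ring
    _ = _ := by
        rw [hρ, add_comm m2, add_comm m1 1, show m1 + (Real.exp (-(39 / 100) * j) + m1) =
          Real.exp (-(39 / 100) * j) + 2 * m1 by ring]

end

noncomputable section
open Complex MeasureTheory Set Filter Topology Metric

lemma card_primeFactors_le_log {r : ℕ} (hr : r ≠ 0) :
    (r.primeFactors.card : ℝ) ≤ 3 / 2 * Real.log r := by
  have h1 : 2 ^ r.primeFactors.card ≤ r := by
    calc 2 ^ r.primeFactors.card = ∏ p ∈ r.primeFactors, 2 := by simp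
      _ ≤ ∏ p ∈ r.primeFactors, p :=
        Finset.prod_le_prod' fun p hp => (Nat.prime_of_mem_primeFactors hp).two_le
      _ ≤ r := Nat.le_of_dvd (Nat.pos_of_ne_zero hr) (Nat.prod_primeFactors_dvd r)
  have h2 : (2 : ℝ) ^ r.primeFactors.card ≤ r := by exact_mod_cast h1
  have h3 := Real.log_le_log (by positivity) h2
  rw [Real.log_pow] at h3
  have := Real.log_two_gt_d9
  have h4 : (0 : ℝ) ≤ r.primeFactors.card := by positivity
  nlinarith

/-- The number of prime factors used. -/
def numFactors (j : ℕ) : ℕ := ⌈Real.exp (j / 1000)⌉₊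

/-- The logarithm of the typical size of the products. -/
def logSize (j : ℕ) : ℝ := j * numFactors j

lemma one_le_numFactors (j : ℕ) : 1 ≤ numFactors j := Nat.one_le_iff_ne_zero.2
  (Nat.ceil_pos.2 (Real.exp_pos _)).ne'

lemma le_logSize (j : ℕ) : (j : ℝ) ≤ logSize j := by
  rw [logSize]
  have : (1 : ℝ) ≤ numFactors j := by exact_mod_cast one_le_numFactors j
  nlinarith [(Nat.cast_nonneg j : (0 : ℝ) ≤ j)]

lemma exp_le_numFactors (j : ℕ) : Real.exp (j / 1000) ≤ numFactors j := Nat.le_ceil _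

lemma exp_logSize (c : ℝ) (j : ℕ) :
    Real.exp (c * j) ^ numFactors j = Real.exp (c * logSize j) := by
  rw [← Real.exp_nat_mul, logSize]; ring_nf

lemma eventually_linear_le (a b : ℝ) {c : ℝ} (hc : 0 < c) :
    ∀ᶠ j : ℕ in atTop, a + b * j ≤ Real.exp (c * j) := by
  filter_upwards [eventually_mul_exp_le a b hc] with j hj
  rw [neg_zero, zero_mul, Real.exp_zero, neg_mul, Real.exp_neg, ← div_eq_mul_inv,
    div_le_one (Real.exp_pos _)] at hj
  exact hj

lemma eventually_numFactors_le :
    ∀ᶠ j : ℕ in atTop, (numFactors j : ℝ) ≤ Real.exp (11 / 10000 * j) := by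
  filter_upwards [eventually_linear_le 2 0 (c := 1/10000) (by norm_num)] with j hj
  have h1 := (Nat.ceil_lt_add_one (Real.exp_pos ((j : ℝ) / 1000)).le).le
  have h2 : 1 ≤ Real.exp ((j : ℝ) / 1000) := Real.one_le_exp (by positivity)
  calc (numFactors j : ℝ) ≤ 2 * Real.exp (j / 1000) := by rw [numFactors]; linarith
    _ ≤ Real.exp (1 / 10000 * j) * Real.exp (j / 1000) := by gcongr; linarith
    _ = _ := by rw [← Real.exp_add]; ring_nf

lemma eventually_logSize_le :
    ∀ᶠ j : ℕ in atTop, logSize j ≤ Real.exp (2 / 1000 * j) := by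
  filter_upwards [eventually_numFactors_le,
    eventually_linear_le 0 1 (c := 9/10000) (by norm_num)] with j h1 h2
  calc logSize j ≤ Real.exp (9 / 10000 * j) * Real.exp (11 / 10000 * j) := by
        rw [logSize]; gcongr; linarith
    _ = _ := by rw [← Real.exp_add]; ring_nf

lemma eventually_le_exp_logSize (a : ℝ) {c : ℝ} (hc : 0 < c) :
    ∀ᶠ j : ℕ in atTop, a ≤ Real.exp (c * logSize j) := by
  filter_upwards [eventually_linear_le a 0 hc] with j hj
  rw [zero_mul, add_zero] at hj
  exact hj.trans (Real.exp_le_exp.2 (mul_le_mul_of_nonneg_left (le_logSize j) hc.le))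

/-- The major and minor arc bounds for the exponential sum. -/
structure ArcBounds (j : ℕ) (P : Finset ℕ) (ν : ℕ → ℝ) (N : ℝ) : Prop where
  norm_le : ∀ (r : ℕ) [NeZero r] (b : ℤ), IsUnit (b : ZMod r) → (r : ℝ) ≤ N ^ (2/3 : ℝ) →
    ∀ β : ℝ, |β| ≤ 2 / (r * N ^ (2/3 : ℝ)) → ‖soup P ν (numFactors j) N (b / r + β)‖ ≤
      12 * bumpConst * (r : ℝ) ^ (-(3/4) : ℝ) / (1 + |β| * N) + Real.exp (-(3/100) * logSize j)
  norm_sub_le : ∀ (r : ℕ) [NeZero r] (b : ℤ), IsUnit (b : ZMod r) → (r : ℝ) ≤ N ^ (2/3 : ℝ) →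
    (r : ℝ) ≤ Real.exp (j / 4) →
    ∀ β : ℝ, |β| ≤ 2 / (r * N ^ (2/3 : ℝ)) → ‖soup P ν (numFactors j) N (b / r + β) -
      ramCoeff r * soup P ν (numFactors j) N β‖ ≤ Real.exp (-(3/100) * logSize j)

lemma GoodWeight.sum_filter_dvd_le {j : ℕ} {P : Finset ℕ} {ν : ℕ → ℝ} (hG : GoodWeight j P ν)
    {r : ℕ} (hr : r ≠ 0) {z : ℕ → ℝ} {A : ℝ} (hA : 0 ≤ A) (hz : ∀ p ∈ P, z p ≤ A) :
    ∑ p ∈ P.filter (· ∣ r), z p ≤ 3 / 2 * Real.log r * A := by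
  refine (Finset.sum_le_card_nsmul _ _ A fun p hp => hz p (Finset.mem_filter.1 hp).1).trans ?_
  rw [nsmul_eq_mul]
  refine mul_le_mul_of_nonneg_right (le_trans ?_ (card_primeFactors_le_log hr)) hA
  exact_mod_cast Finset.card_le_card fun p hp => by
    obtain ⟨h1, h2⟩ := Finset.mem_filter.1 hp
    exact Nat.mem_primeFactors.2 ⟨hG.prime p h1, h2, hr⟩

lemma GoodWeight.mul_rpow_le {j : ℕ} {P : Finset ℕ} {ν : ℕ → ℝ} (hG : GoodWeight j P ν)
    {p : ℕ} (hp : p ∈ P) : ν p * (p : ℝ) ^ (3/4 : ℝ) ≤ 8 * j * Real.exp (-(1/16) * j) := by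
  have hp0 : (0 : ℝ) < p := by exact_mod_cast (hG.prime p hp).pos
  calc ν p * (p : ℝ) ^ (3/4 : ℝ) ≤ 8 * j / p * (p : ℝ) ^ (3/4 : ℝ) := by
        gcongr; exact hG.le_div p hp
    _ = 8 * j * (p : ℝ) ^ (-(1/4) : ℝ) := by
        rw [show (-(1/4) : ℝ) = 3/4 - 1 by norm_num, Real.rpow_sub_one hp0.ne']; ring
    _ ≤ 8 * j * Real.exp (j / 4) ^ (-(1/4) : ℝ) := by
        refine mul_le_mul_of_nonneg_left ?_ (by positivity)
        exact Real.rpow_le_rpow_of_nonpos (Real.exp_pos _) (hG.lower p hp).le (by norm_num)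
    _ = _ := by rw [← Real.exp_mul]; ring_nf

lemma half_pow_le (j : ℕ) : (1/2 : ℝ) ^ j ≤ Real.exp (-(69/100) * j) := by
  rw [mul_comm, Real.exp_nat_mul]
  refine pow_le_pow_left₀ (by norm_num) ?_ j
  rw [← Real.log_le_iff_le_exp (by norm_num), one_div, Real.log_inv]
  linarith [Real.log_two_lt_d9, Real.log_two_gt_d9]

lemma eventually_sum_filter_dvd_le : ∀ᶠ j : ℕ in atTop, ∀ P ν, GoodWeight j P ν → ∀ r : ℕ,
    r ≠ 0 → Real.log r ≤ 68 / 100 * logSize j →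
    ∑ p ∈ P.filter (· ∣ r), ν p * (p : ℝ) ^ (3/4 : ℝ) ≤ 1 / numFactors j ∧
    ∑ p ∈ P.filter (· ∣ r), ν p ≤ 1 / numFactors j ∧
    Real.exp (-(39/100) * j) + 2 * ∑ p ∈ P.filter (· ∣ r), ν p ≤ Real.exp (-(385/1000) * j) := by
  filter_upwards [eventually_logSize_le, eventually_numFactors_le,
    eventually_mul_exp_le 0 10 (c := 585/10000) (d := 0) (by norm_num),
    eventually_mul_exp_le 1 20 (c := 39/100) (d := 385/1000) (by norm_num)]
    with j hL hJ hm2 hm1 P ν hG r hr hlog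
  have hJ0 : (0 : ℝ) < numFactors j := by exact_mod_cast one_le_numFactors j
  have hlog' : 3 / 2 * Real.log r ≤ 11/10 * Real.exp (2/1000 * j) := by
    have := Real.exp_pos (2/1000 * (j : ℝ)); linarith
  have h1 := hG.sum_filter_dvd_le hr (by positivity) (fun p hp => hG.mul_rpow_le hp)
  have h1' : ∑ p ∈ P.filter (· ∣ r), ν p * (p : ℝ) ^ (3/4 : ℝ) ≤ 1 / numFactors j := by
    rw [le_div_iff₀ hJ0]
    calc _ ≤ 11/10 * Real.exp (2/1000 * j) * (8 * j * Real.exp (-(1/16) * j)) *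
          Real.exp (11/10000 * j) := by
          gcongr
          exact h1.trans (by gcongr)
      _ = 88/10 * j * (Real.exp (2/1000 * j) * Real.exp (-(1/16) * j) *
          Real.exp (11/10000 * j)) := by ring
      _ = 88/10 * j * Real.exp (-(594/10000) * j) := by
          rw [← Real.exp_add, ← Real.exp_add]; ring_nf
      _ ≤ (0 + 10 * j) * Real.exp (-(585/10000) * j) := by
          have hj0 : (0 : ℝ) ≤ j := Nat.cast_nonneg j
          gcongr ?_ * Real.exp ?_ <;> linarith
      _ ≤ 1 := by simpa using hm2
  refine ⟨h1', le_trans (Finset.sum_le_sum fun p hp => ?_) h1', ?_⟩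
  · refine le_mul_of_one_le_right (hG.nonneg p) (Real.one_le_rpow ?_ (by norm_num))
    exact_mod_cast (hG.prime p (Finset.mem_filter.1 hp).1).one_le
  · have h2 := hG.sum_filter_dvd_le hr (z := ν) (A := 8 * j * Real.exp (-(69/100) * j))
      (by positivity) (fun p hp => (hG.le_pow p hp).trans (by gcongr; exact half_pow_le j))
    calc _ ≤ Real.exp (-(39/100) * j) +
          2 * (11/10 * Real.exp (2/1000 * j) * (8 * j * Real.exp (-(69/100) * j))) := by
          gcongr
          exact h2.trans (by gcongr)
      _ = Real.exp (-(39/100) * j) + 176/10 * j * Real.exp (-(688/1000) * j) := by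
          rw [show -(688/1000) * (j : ℝ) = 2/1000 * j + -(69/100) * j by ring, Real.exp_add]; ring
      _ ≤ Real.exp (-(39/100) * j) + 20 * j * Real.exp (-(39/100) * j) := by
          have hj0 : (0 : ℝ) ≤ j := Nat.cast_nonneg j
          gcongr ?_ + ?_ * Real.exp ?_ <;> linarith
      _ ≤ _ := by linarith

lemma sqrt_mul_one_add_le {r R θ : ℝ} (hr : 1 ≤ r) (hR : 1 ≤ R) (hrR : r ≤ R ^ 2)
    (hθ : |θ| ≤ 2 * R / r) : √r * (1 + |θ|) ≤ 3 * R ∧ √r * (1 + |θ|) ^ 2 ≤ 9 * R ^ 3 := by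
  have hs1 : √r ≤ R := Real.sqrt_le_iff.2 ⟨by linarith, hrR⟩
  have hs2 : √r / r ≤ 1 := by
    rw [div_le_one (by linarith)]
    exact Real.sqrt_le_iff.2 ⟨by linarith, by nlinarith⟩
  have h1 : √r * (1 + |θ|) ≤ 3 * R := by
    calc √r * (1 + |θ|) ≤ √r * (1 + 2 * R / r) := by gcongr
      _ = √r + 2 * R * (√r / r) := by ring
      _ ≤ R + 2 * R * 1 := by gcongr
      _ = _ := by ring
  have h2 : 1 + |θ| ≤ 3 * R := by
    have : 2 * R / r ≤ 2 * R := div_le_self (by linarith) hr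
    linarith
  refine ⟨h1, ?_⟩
  calc √r * (1 + |θ|) ^ 2 = (√r * (1 + |θ|)) * (1 + |θ|) := by ring
    _ ≤ (3 * R) * (3 * R) := by gcongr
    _ ≤ 9 * R ^ 3 := by nlinarith [sq_nonneg R]

lemma arc_error_le {r R θ L y : ℝ} (hr : 1 ≤ r) (hR : 1 ≤ R) (hrR : r ≤ R ^ 2)
    (hθ : |θ| ≤ 2 * R / r) (hRL : R ≤ Real.exp (34/100 * L)) (hL : 0 ≤ L)
    (hC : 200 * bumpConst ≤ Real.exp (15/1000 * L)) (hy : y ≤ Real.exp (-(385/1000) * L)) :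
    2 * √r * (bumpConst * (1 + |θ|) ^ 2 / Real.exp (5 * L) * 3 + bumpConst * (1 + |θ|) * y) ≤
      Real.exp (-(3/100) * L) := by
  have hbC := one_le_bumpConst
  obtain ⟨h1, h2⟩ := sqrt_mul_one_add_le hr hR hrR hθ
  have hR3 : R ^ 3 ≤ Real.exp (102/100 * L) := by
    calc R ^ 3 ≤ Real.exp (34/100 * L) ^ 3 := by gcongr
      _ = _ := by rw [← Real.exp_nat_mul]; push_cast; ring_nf
  calc 2 * √r * (bumpConst * (1 + |θ|) ^ 2 / Real.exp (5 * L) * 3 + bumpConst * (1 + |θ|) * y)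
      ≤ 2 * √r * (bumpConst * (1 + |θ|) ^ 2 / Real.exp (5 * L) * 3 +
          bumpConst * (1 + |θ|) * Real.exp (-(385/1000) * L)) := by gcongr
    _ = 6 * bumpConst * (√r * (1 + |θ|) ^ 2) / Real.exp (5 * L) +
          2 * bumpConst * (√r * (1 + |θ|)) * Real.exp (-(385/1000) * L) := by ring
    _ ≤ 6 * bumpConst * (9 * R ^ 3) / Real.exp (5 * L) +
          2 * bumpConst * (3 * R) * Real.exp (-(385/1000) * L) := by gcongr
    _ ≤ 6 * bumpConst * (9 * Real.exp (102/100 * L)) / Real.exp (5 * L) +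
          2 * bumpConst * (3 * Real.exp (34/100 * L)) * Real.exp (-(385/1000) * L) := by gcongr
    _ = 54 * bumpConst * Real.exp (-(398/100) * L) +
          6 * bumpConst * Real.exp (-(45/1000) * L) := by
        rw [show -(398/100) * L = 102/100 * L - 5 * L by ring, Real.exp_sub,
          show -(45/1000) * L = 34/100 * L + -(385/1000) * L by ring, Real.exp_add]
        ring
    _ ≤ 54 * bumpConst * Real.exp (-(45/1000) * L) +
          6 * bumpConst * Real.exp (-(45/1000) * L) :=
        add_le_add_left (mul_le_mul_of_nonneg_left (Real.exp_le_exp.2 (by linarith))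
          (by positivity)) _
    _ ≤ Real.exp (15/1000 * L) * Real.exp (-(45/1000) * L) := by
        rw [← add_mul]; gcongr; linarith
    _ = _ := by rw [← Real.exp_add]; ring_nf

lemma log_conductor_le {j : ℕ} {L r : ℝ} (hr : 0 < r) (hL : 0 ≤ L)
    (hlog : Real.log r ≤ 68/100 * L) (hLj : L ≤ Real.exp (2/1000 * j))
    (h11 : 11 ≤ Real.exp (3/1000 * j)) :
    Real.log (8 * r * (2 * Real.pi * Real.exp (5 * L) + 6)) ≤ Real.exp (5/1000 * j) := by
  have hT1 : 1 ≤ Real.exp (5 * L) := Real.one_le_exp (by positivity)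
  have h1 : 8 * r * (2 * Real.pi * Real.exp (5 * L) + 6) ≤ r * (Real.exp 5 * Real.exp (5 * L)) := by
    have h2 : (128 : ℝ) ≤ Real.exp 5 := by
      have : (2.7 : ℝ) ≤ Real.exp 1 := by linarith [Real.exp_one_gt_d9]
      calc (128 : ℝ) ≤ 2.7 ^ 5 := by norm_num
        _ ≤ Real.exp 1 ^ 5 := by gcongr
        _ = Real.exp 5 := by rw [← Real.exp_nat_mul]; norm_num
    have h3 : 2 * Real.pi * Real.exp (5 * L) ≤ 8 * Real.exp (5 * L) := by
      nlinarith [Real.pi_lt_four]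
    have : 8 * (2 * Real.pi * Real.exp (5 * L) + 6) ≤ Real.exp 5 * Real.exp (5 * L) := by nlinarith
    nlinarith
  refine (Real.log_le_log (by positivity) h1).trans ?_
  rw [Real.log_mul (by positivity) (by positivity), Real.log_mul (by positivity) (by positivity),
    Real.log_exp, Real.log_exp]
  have h3 : Real.exp (5/1000 * j) = Real.exp (3/1000 * j) * Real.exp (2/1000 * j) := by
    rw [← Real.exp_add]; ring_nf
  rw [h3]
  have : 1 ≤ Real.exp (2/1000 * (j : ℝ)) := Real.one_le_exp (by positivity)
  nlinarith

theorem eventually_arcBounds : ∀ᶠ j : ℕ in atTop, ∀ P ν N, GoodWeight j P ν → 1 ≤ N →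
    N ≤ Real.exp (102/100 * logSize j) → ArcBounds j P ν N := by
  filter_upwards [eventually_logSize_le, eventually_sum_filter_dvd_le,
    eventually_linear_le 11 0 (c := 3/1000) (by norm_num),
    eventually_le_exp_logSize (200 * bumpConst) (c := 15/1000) (by norm_num)]
    with j hLj hdiv h11 hC P ν N hG hN1 hN
  have hEL := exp_logSize (-(385/1000)) j
  have hL0 : 0 ≤ logSize j := (Nat.cast_nonneg j).trans (le_logSize j)
  have hJ1 := one_le_numFactors j
  replace hdiv := hdiv P ν hG
  rw [zero_mul, add_zero] at h11
  have hN0 : 0 < N := by linarith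
  have hbC := one_le_bumpConst
  have hT1 : 1 ≤ Real.exp (5 * logSize j) := Real.one_le_exp (by positivity)
  obtain ⟨R, hR⟩ : ∃ R, R = N ^ (1/3 : ℝ) := ⟨_, rfl⟩
  have hR1 : 1 ≤ R := hR ▸ Real.one_le_rpow hN1 (by norm_num)
  have hR2 : N ^ (2/3 : ℝ) = R ^ 2 := by
    rw [hR, ← Real.rpow_natCast, ← Real.rpow_mul hN0.le]; norm_num
  have hR3 : N = R ^ 3 := by
    rw [hR, ← Real.rpow_natCast, ← Real.rpow_mul hN0.le]; norm_num
  have hRle : R ≤ Real.exp (34/100 * logSize j) := by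
    rw [hR]
    calc N ^ (1/3 : ℝ) ≤ (Real.exp (102/100 * logSize j)) ^ (1/3 : ℝ) :=
          Real.rpow_le_rpow hN0.le hN (by norm_num)
      _ = _ := by rw [← Real.exp_mul]; ring_nf
  have hlogr : ∀ r : ℕ, r ≠ 0 → (r : ℝ) ≤ R ^ 2 → Real.log r ≤ 68/100 * logSize j := fun r hr hrR => by
    rw [← Real.log_exp (68/100 * logSize j)]
    refine Real.log_le_log (by positivity) (hrR.trans ?_)
    calc R ^ 2 ≤ Real.exp (34/100 * logSize j) ^ 2 := by gcongr
      _ = _ := by rw [← Real.exp_nat_mul]; push_cast; ring_nf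
  have hθ : ∀ r : ℕ, r ≠ 0 → ∀ β : ℝ, |β| ≤ 2 / (r * R ^ 2) → |β * N| ≤ 2 * R / r := by
    intro r hr β hβ
    have hr0 : (0 : ℝ) < r := by positivity
    rw [abs_mul, abs_of_pos hN0]
    calc |β| * N ≤ 2 / (r * R ^ 2) * N := by gcongr
      _ = 2 * R / r := by rw [hR3]; field_simp
  have hpow : ∀ x : ℝ, 0 ≤ x → x ≤ 1 / numFactors j → (1 + x) ^ numFactors j ≤ 3 := by
    intro x hx h
    have hJ0 : (0 : ℝ) < numFactors j := by exact_mod_cast hJ1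
    calc (1 + x) ^ numFactors j ≤ Real.exp x ^ numFactors j := by
          gcongr; linarith [Real.add_one_le_exp x]
      _ = Real.exp (numFactors j * x) := (Real.exp_nat_mul _ _).symm
      _ ≤ Real.exp 1 := by
          gcongr
          calc (numFactors j : ℝ) * x ≤ numFactors j * (1 / numFactors j) := by gcongr
            _ = 1 := by field_simp
      _ ≤ 3 := by linarith [Real.exp_one_lt_d9]
  constructor
  · intro r hr b hb hrN β hβ
    have hr0 : r ≠ 0 := NeZero.ne r
    have hr1 : (1 : ℝ) ≤ r := by exact_mod_cast Nat.pos_of_ne_zero hr0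
    rw [hR2] at hrN hβ
    obtain ⟨hd1, hd2, hd3⟩ := hdiv r hr0 (hlogr r hr0 hrN)
    have hθ' := hθ r hr0 β hβ
    have hm1 : 0 ≤ ∑ p ∈ P.filter (· ∣ r), ν p := Finset.sum_nonneg fun p _ => hG.nonneg p
    have hm2 : 0 ≤ ∑ p ∈ P.filter (· ∣ r), ν p * (p : ℝ) ^ (3/4 : ℝ) :=
      Finset.sum_nonneg fun p _ => mul_nonneg (hG.nonneg p) (by positivity)
    refine (hG.norm_soup_le r hb β hN0 hT1 (log_conductor_le (by positivity) hL0
      (hlogr r hr0 hrN) hLj h11) _).trans (add_le_add ?_ ?_)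
    · have h1 : |β * N| = |β| * N := by rw [abs_mul, abs_of_pos hN0]
      rw [h1]
      calc _ ≤ 4 * (r : ℝ) ^ (-(3/4) : ℝ) * (bumpConst / (1 + |β| * N)) * 3 := by
            gcongr; exact hpow _ hm2 hd1
        _ = _ := by ring
    · refine le_trans ?_ (arc_error_le hr1 hR1 hrN hθ' hRle hL0 hC (y := (Real.exp (-(39 / 100) * j) +
          2 * ∑ p ∈ P.filter (· ∣ r), ν p) ^ numFactors j) ?_)
      · gcongr
        exact hpow _ hm1 hd2
      · rw [← hEL]
        gcongr
  · intro r hr b hb hrN hrj β hβ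
    have hr0 : r ≠ 0 := NeZero.ne r
    have hr1 : (1 : ℝ) ≤ r := by exact_mod_cast Nat.pos_of_ne_zero hr0
    rw [hR2] at hrN hβ
    have hθ' := hθ r hr0 β hβ
    have hPr : ∀ p ∈ P, ¬ p ∣ r := fun p hp hd => by
      have h1 := hG.lower p hp
      have h2 : (p : ℝ) ≤ r := by exact_mod_cast Nat.le_of_dvd (Nat.pos_of_ne_zero hr0) hd
      linarith
    refine (hG.norm_soup_sub_le hPr hb β hN0 hT1 (log_conductor_le (by positivity) hL0
      (hlogr r hr0 hrN) hLj h11) _).trans (le_trans ?_ (arc_error_le hr1 hR1 hrN hθ' hRle hL0 hC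
      (y := Real.exp (-(39 / 100) * j) ^ numFactors j) ?_))
    · rw [avgErr]
      have h1 : 0 ≤ bumpConst * (1 + |β * N|) ^ 2 / Real.exp (5 * logSize j) := by positivity
      have h2 : 0 ≤ bumpConst * (1 + |β * N|) * Real.exp (-(39 / 100) * j) ^ numFactors j := by
        positivity
      nlinarith [Real.sqrt_nonneg (r : ℝ), mul_nonneg (Real.sqrt_nonneg (r : ℝ)) h1,
        mul_nonneg (Real.sqrt_nonneg (r : ℝ)) h2]
    · rw [← hEL]
      exact pow_le_pow_left₀ (Real.exp_pos _).le (Real.exp_le_exp.2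
        (by linarith [Nat.cast_nonneg (α := ℝ) j])) _

end

noncomputable section
open Complex MeasureTheory Set Filter Topology Metric

lemma GoodWeight.exp_pow_le_of_mem_support {j : ℕ} {P : Finset ℕ} {ν : ℕ → ℝ}
    (hG : GoodWeight j P ν) {k n : ℕ} (hn : n ∈ (mulCoeff P ν k).support) :
    Real.exp (j / 4) ^ k ≤ n ∧ ∀ p : ℕ, p.Prime → p ∣ n → p ∈ P := by
  induction k generalizing n with
  | zero =>
    have : n = 1 := by
      rw [mulCoeff, Finsupp.mem_support_iff, Finsupp.single_apply] at hn
      by_contra h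
      exact hn (if_neg fun h' => h h'.symm)
    subst this
    refine ⟨by simp, fun p hp hd => ?_⟩
    exact absurd (Nat.dvd_one.1 hd) hp.one_lt.ne'
  | succ k ih =>
    obtain ⟨p, hp, m, hm, rfl⟩ := exists_of_mem_support_mulCoeff_succ hn
    obtain ⟨h1, h2⟩ := ih hm
    refine ⟨?_, fun q hq hd => ?_⟩
    · rw [pow_succ', Nat.cast_mul]
      exact mul_le_mul (hG.lower p hp).le h1 (by positivity) (by positivity)
    · rcases (hq.dvd_mul).1 hd with h | h
      · rwa [(Nat.prime_dvd_prime_iff_eq hq (hG.prime p hp)).1 h]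
      · exact h2 q hq h

/-- A window of size about `N` on which the convolution power of `ν` has substantial mass. -/
structure Window (j : ℕ) (P : Finset ℕ) (ν : ℕ → ℝ) (N : ℝ) (s : Finset ℕ) (a : ℕ → ℝ) :
    Prop where
  exp_le : Real.exp (1/5 * logSize j) ≤ N
  le_exp : N ≤ Real.exp (102/100 * logSize j)
  nonneg : ∀ n, 0 ≤ a n
  le_div : ∀ n ∈ s, a n ≤ Real.exp (4/1000 * logSize j) / N
  sum_le : ∑ n ∈ s, a n ≤ 1
  le_sum : Real.exp (-(3/1000) * j) ≤ ∑ n ∈ s, a n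
  le_three_mul : ∀ n ∈ s, N ≤ 3 * n
  le_mul_three : ∀ n ∈ s, n ≤ 3 * N
  smooth : ∀ n ∈ s, ∀ p : ℕ, p.Prime → p ∣ n → (p : ℝ) ≤ Real.exp (4 * j)
  soup_eq : ∀ α : ℝ, soup P ν (numFactors j) N α =
    ∑ n ∈ s, (a n : ℂ) * cexp (2 * Real.pi * I * (α * n))

/-- Markov's inequality and the pigeonhole principle for a finitely supported probability. -/
lemma exists_nat_mass_le {c : ℕ →₀ ℝ} (hc : ∀ n, 0 ≤ c n) (h1 : (c.sum fun _ a => a) = 1)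
    {L : ℝ} (hL : 0 < L) (hlog : (c.sum fun n a => a * Real.log n) ≤ 1005/1000 * L) :
    ∃ k : ℕ, (k : ℝ) ≤ 101/100 * L + 1/2 ∧ 1 / (250 * (101/100 * L + 3/2)) ≤
      ∑ n ∈ c.support.filter (fun n : ℕ => |Real.log n - k| ≤ 1/2), c n := by
  set s := c.support.filter (fun n : ℕ => Real.log n ≤ 101/100 * L) with hs
  have hmass : 1 / 250 ≤ ∑ n ∈ s, c n := by
    have h2 : ∑ n ∈ c.support.filter (fun n : ℕ => ¬ (Real.log n ≤ 101/100 * L)), c n * (101/100 * L) ≤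
        1005/1000 * L := by
      calc ∑ n ∈ c.support.filter (fun n : ℕ => ¬ (Real.log n ≤ 101/100 * L)), c n * (101/100 * L)
          ≤ ∑ n ∈ c.support.filter (fun n : ℕ => ¬ (Real.log n ≤ 101/100 * L)), c n * Real.log n :=
            Finset.sum_le_sum fun n hn => mul_le_mul_of_nonneg_left
              (not_le.1 (Finset.mem_filter.1 hn).2).le (hc n)
        _ ≤ ∑ n ∈ c.support, c n * Real.log n :=
            Finset.sum_le_sum_of_subset_of_nonneg (Finset.filter_subset _ _)
              fun n _ _ => mul_nonneg (hc n) (Real.log_natCast_nonneg n)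
        _ ≤ _ := hlog
    rw [← Finset.sum_mul] at h2
    have h3 := Finset.sum_filter_add_sum_filter_not c.support
      (fun n : ℕ => Real.log n ≤ 101/100 * L) (fun n => c n)
    have h4 : ∑ n ∈ c.support, c n = 1 := h1
    rw [h4] at h3
    have h5 : (1 - 1 / 250) * (101/100 * L) > 1005/1000 * L := by linarith
    have h6 := lt_of_mul_lt_mul_right (h2.trans_lt h5) (by positivity)
    linarith
  set M := ⌊101/100 * L + 1/2⌋₊ with hM
  have hMle : (M : ℝ) ≤ 101/100 * L + 1/2 := Nat.floor_le (by positivity)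
  obtain ⟨k, hk, hsum⟩ := Finset.exists_le_sum_fiber_of_maps_to_of_nsmul_le_sum
    (s := s) (t := Finset.range (M + 1)) (f := fun n : ℕ => ⌊Real.log n + 1/2⌋₊)
    (w := fun n => c n) (b := 1 / (250 * (101/100 * L + 3/2)))
    (fun n hn => by
      rw [Finset.mem_range, Nat.lt_succ_iff]
      exact Nat.floor_le_floor (by linarith [(Finset.mem_filter.1 hn).2]))
    ⟨0, by simp⟩ (by
      refine le_trans ?_ hmass
      rw [Finset.card_range, nsmul_eq_mul]
      push_cast
      rw [mul_one_div, div_le_div_iff₀ (by positivity) (by norm_num)]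
      linarith)
  refine ⟨k, ?_, hsum.trans ?_⟩
  · have : (k : ℝ) ≤ M := by exact_mod_cast Nat.lt_succ_iff.1 (Finset.mem_range.1 hk)
    linarith
  · refine Finset.sum_le_sum_of_subset_of_nonneg (fun n hn => ?_) fun n _ _ => hc n
    obtain ⟨hn1, hn2⟩ := Finset.mem_filter.1 hn
    refine Finset.mem_filter.2 ⟨(Finset.mem_filter.1 hn1).1, ?_⟩
    have h0 := Real.log_natCast_nonneg n
    obtain ⟨h2, h3⟩ := (Nat.floor_eq_iff (by linarith)).1 hn2
    rw [abs_le]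
    constructor <;> linarith

theorem eventually_exists_window : ∀ᶠ j : ℕ in atTop, ∀ P ν, GoodWeight j P ν →
    ∃ N s a, Window j P ν N s a := by
  filter_upwards [eventually_logSize_le, eventually_ge_atTop 50,
    eventually_linear_le 1000 0 (c := 1/1000) (by norm_num),
    eventually_linear_le 0 42 (c := 1/1000) (by norm_num),
    eventually_le_exp_logSize 3 (c := 1/1000) (by norm_num)]
    with j hLj hj h1000 h42 h3 P ν hG
  have hj' : (50 : ℝ) ≤ j := by exact_mod_cast hj
  have hjL := le_logSize j
  have hexp4 := exp_logSize (1/4) j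
  have hexp3 := exp_logSize (3/1000) j
  have hJ1 := one_le_numFactors j
  have hlogsum : ((mulCoeff P ν (numFactors j)).sum fun n a => a * Real.log n) ≤
      1005/1000 * logSize j := by
    rw [sum_mulCoeff_log (fun p hp => (hG.prime p hp).pos) hG.sum_eq_one, logSize]
    nlinarith [mul_le_mul_of_nonneg_left hG.sum_log (Nat.cast_nonneg (α := ℝ) (numFactors j))]
  have hc0 : ∀ n, 0 ≤ mulCoeff P ν (numFactors j) n := mulCoeff_nonneg hG.nonneg _
  have hsum1 := sum_mulCoeff hG.sum_eq_one (numFactors j)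
  have hsupp := fun n (hn : n ∈ (mulCoeff P ν (numFactors j)).support) =>
    hG.exp_pow_le_of_mem_support hn
  have hmul := fun n (hn : 0 < n) => mul_mulCoeff_le hG.nonneg hG.prime (A := 8 * j) hG.le_div
    (by positivity) (numFactors j) hn
  have hsoup : ∀ N α, soup P ν (numFactors j) N α = _ := fun N α =>
    avgOp_pow_apply_one P ν (numFactors j)
      (fun n => cexp (2 * Real.pi * I * (α * n)) * bump (Real.log (n / N)))
  obtain ⟨k, hk, hmass⟩ := exists_nat_mass_le hc0 hsum1 (by linarith) hlogsum
  set c := mulCoeff P ν (numFactors j) with hc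
  set N := Real.exp k with hN
  have hN0 : 0 < N := Real.exp_pos _
  have hlogsupp : ∀ n ∈ c.support, 0 < n ∧ logSize j / 4 ≤ Real.log n := fun n hn => by
    have h1 := (hsupp n hn).1
    rw [show (j : ℝ) / 4 = 1 / 4 * j by ring, hexp4] at h1
    have h2 : (0 : ℝ) < n := (Real.exp_pos _).trans_le h1
    refine ⟨by exact_mod_cast h2, ?_⟩
    rw [← Real.log_exp (logSize j / 4)]
    exact Real.log_le_log (Real.exp_pos _) (by rwa [div_eq_inv_mul, ← one_div])
  have hlogdiv : ∀ n : ℕ, 0 < n → Real.log (n / N) = Real.log n - k := fun n hn => by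
    rw [Real.log_div (by positivity) hN0.ne', hN, Real.log_exp]
  have hsub : ∀ n ∈ c.support.filter (fun n : ℕ => bump (Real.log (n / N)) ≠ 0),
      n ∈ c.support ∧ |Real.log n - k| < 1 := fun n hn => by
    obtain ⟨h1, h2⟩ := Finset.mem_filter.1 hn
    refine ⟨h1, ?_⟩
    have h3 : Real.log (n / N) ∈ Function.support bump := h2
    rw [bump.support_eq, mem_ball_zero_iff, Real.norm_eq_abs, hlogdiv n (hlogsupp n h1).1] at h3
    exact h3
  have hexplog : ∀ n ∈ c.support, Real.exp (Real.log n) = n := fun n hn =>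
    Real.exp_log (by exact_mod_cast (hlogsupp n hn).1)
  have he3 : Real.exp 1 ≤ 3 := by linarith [Real.exp_one_lt_d9]
  have hb0 : ∀ x, 0 ≤ bump x := fun x => bump.nonneg
  have hb1 : ∀ x, bump x ≤ 1 := fun x => bump.le_one
  have hlower : ∀ n ∈ c.support.filter (fun n : ℕ => bump (Real.log (n / N)) ≠ 0),
      N ≤ 3 * n := fun n hn => by
    obtain ⟨h1, h2⟩ := hsub n hn
    rw [← hexplog n h1, hN]
    calc Real.exp k ≤ Real.exp (1 + Real.log n) :=
          Real.exp_le_exp.2 (by linarith [(abs_lt.1 h2).1])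
      _ ≤ _ := by rw [Real.exp_add]; gcongr
  refine ⟨N, c.support.filter (fun n : ℕ => bump (Real.log (n / N)) ≠ 0),
    fun n => c n * bump (Real.log (n / N)), ?_, ?_, fun n => mul_nonneg (hc0 n) (hb0 _), ?_, ?_, ?_,
    hlower, ?_, ?_, ?_⟩
  · have hpos : 0 < ∑ n ∈ c.support.filter (fun n : ℕ => |Real.log n - k| ≤ 1/2), c n :=
      lt_of_lt_of_le (by have : 0 < logSize j := by linarith
                         positivity) hmass
    obtain ⟨n, hn⟩ := Finset.nonempty_of_sum_ne_zero hpos.ne'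
    obtain ⟨h1, h2⟩ := Finset.mem_filter.1 hn
    have h3 := (hlogsupp n h1).2
    exact Real.exp_le_exp.2 (by linarith [(abs_le.1 h2).2])
  · exact Real.exp_le_exp.2 (by linarith)
  · intro n hn
    obtain ⟨h1, h2⟩ := hsub n hn
    obtain ⟨hn0, hlog⟩ := hlogsupp n h1
    have hn0' : (0 : ℝ) < n := by exact_mod_cast hn0
    have h4 : c n * n ≤ Real.exp (3/1000 * logSize j) := by
      rw [mul_comm, ← hexp3]
      refine (hmul n hn0).trans (pow_le_pow_left₀ (by positivity) ?_ _)
      have h5 : (n.primeFactors.card : ℝ) ≤ 3 / 2 * (2 * logSize j) := by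
        refine (card_primeFactors_le_log hn0.ne').trans ?_
        linarith [(abs_lt.1 h2).2]
      calc 8 * (j : ℝ) * n.primeFactors.card ≤ 8 * j * (3 / 2 * (2 * logSize j)) := by gcongr
        _ = (24 * j) * logSize j := by ring
        _ ≤ Real.exp (1/1000 * j) * Real.exp (2/1000 * j) := by
            exact mul_le_mul (by linarith) hLj (by linarith) (Real.exp_pos _).le
        _ = _ := by rw [← Real.exp_add]; ring_nf
    calc c n * bump (Real.log (n / N)) ≤ c n * 1 := mul_le_mul_of_nonneg_left (hb1 _) (hc0 n)
      _ ≤ Real.exp (3/1000 * logSize j) / n := by rw [mul_one, le_div_iff₀ hn0']; exact h4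
      _ ≤ Real.exp (3/1000 * logSize j) / (N / 3) := by
          gcongr; linarith [hlower n hn]
      _ = Real.exp (3/1000 * logSize j) * 3 / N := by field_simp
      _ ≤ Real.exp (3/1000 * logSize j) * Real.exp (1/1000 * logSize j) / N := by gcongr
      _ = _ := by rw [← Real.exp_add]; ring_nf
  · calc _ ≤ ∑ n ∈ c.support.filter (fun n : ℕ => bump (Real.log (n / N)) ≠ 0), c n :=
          Finset.sum_le_sum fun n _ => mul_le_of_le_one_right (hc0 n) (hb1 _)
      _ ≤ ∑ n ∈ c.support, c n :=
          Finset.sum_le_sum_of_subset_of_nonneg (Finset.filter_subset _ _) fun n _ _ => hc0 n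
      _ = 1 := hsum1
  · refine le_trans ?_ (hmass.trans ?_)
    · rw [show -(3/1000 : ℝ) * j = -(1/1000 * j + 2/1000 * j) by ring, Real.exp_neg, ← one_div]
      have : 0 < logSize j := by linarith
      refine one_div_le_one_div_of_le (by positivity) ?_
      rw [Real.exp_add]
      calc 250 * (101/100 * logSize j + 3/2) ≤ 1000 * logSize j := by linarith
        _ ≤ _ := by gcongr; linarith
    · have : ∀ n ∈ c.support.filter (fun n : ℕ => |Real.log n - k| ≤ 1/2),
          bump (Real.log (n / N)) = 1 := fun n hn => by
        obtain ⟨h1, h2⟩ := Finset.mem_filter.1 hn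
        refine bump.one_of_mem_closedBall ?_
        rw [mem_closedBall_zero_iff, Real.norm_eq_abs, hlogdiv n (hlogsupp n h1).1]
        exact h2
      calc _ = ∑ n ∈ c.support.filter (fun n : ℕ => |Real.log n - k| ≤ 1/2),
          c n * bump (Real.log (n / N)) :=
            Finset.sum_congr rfl fun n hn => by rw [this n hn, mul_one]
        _ ≤ _ := Finset.sum_le_sum_of_subset_of_nonneg (fun n hn => Finset.mem_filter.2
            ⟨(Finset.mem_filter.1 hn).1, by rw [this n hn]; exact one_ne_zero⟩)
            fun n _ _ => mul_nonneg (hc0 n) (hb0 _)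
  · intro n hn
    obtain ⟨h1, h2⟩ := hsub n hn
    rw [← hexplog n h1, hN]
    calc Real.exp (Real.log n) ≤ Real.exp (1 + k) :=
          Real.exp_le_exp.2 (by linarith [(abs_lt.1 h2).2])
      _ ≤ _ := by rw [Real.exp_add]; gcongr
  · intro n hn p hp hd
    exact hG.upper p ((hsupp n (hsub n hn).1).2 p hp hd)
  · intro α
    rw [hsoup, Finsupp.sum, Finset.sum_filter]
    refine Finset.sum_congr rfl fun n _ => ?_
    split_ifs with h
    · rw [real_smul]; push_cast; ring
    · rw [not_not.1 h]; simp

end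

noncomputable section
open Complex MeasureTheory Set Filter Topology Metric
open scoped ComplexConjugate

/-- `∑ a(n) e(α n)`. -/
def trigSum {ι : Type*} (s : Finset ι) (a : ι → ℝ) (k : ι → ℤ) (α : ℝ) : ℂ :=
  ∑ n ∈ s, (a n : ℂ) * cexp (2 * Real.pi * I * (α * k n))

section trigSum

variable {ι κ : Type*} (s : Finset ι) (a : ι → ℝ) (k : ι → ℤ)

lemma continuous_trigSum : Continuous (trigSum s a k) := by
  unfold trigSum
  fun_prop

lemma norm_trigSum_le (ha : ∀ n ∈ s, 0 ≤ a n) (α : ℝ) : ‖trigSum s a k α‖ ≤ ∑ n ∈ s, a n := by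
  refine (norm_sum_le _ _).trans (Finset.sum_le_sum fun n hn => ?_)
  rw [norm_mul, show 2 * (Real.pi : ℂ) * I * (α * k n) = ((2 * Real.pi * (α * k n) : ℝ) : ℂ) * I by
    push_cast; ring, norm_exp_ofReal_mul_I, mul_one, norm_real, Real.norm_eq_abs,
    abs_of_nonneg (ha n hn)]

lemma trigSum_mul (t : Finset κ) (b : κ → ℝ) (l : κ → ℤ) (α : ℝ) :
    trigSum s a k α * trigSum t b l α =
      trigSum (s ×ˢ t) (fun p => a p.1 * b p.2) (fun p => k p.1 + l p.2) α := by
  rw [trigSum, trigSum, trigSum, Finset.sum_mul_sum, Finset.sum_product]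
  refine Finset.sum_congr rfl fun n _ => Finset.sum_congr rfl fun m _ => ?_
  rw [mul_mul_mul_comm, ← Complex.exp_add]
  push_cast
  ring_nf

lemma conj_trigSum (α : ℝ) : conj (trigSum s a k α) = trigSum s a (fun n => -k n) α := by
  simp only [trigSum, map_sum, map_mul, conj_ofReal, ← Complex.exp_conj, conj_I, map_ofNat,
    map_intCast]
  refine Finset.sum_congr rfl fun n _ => ?_
  push_cast
  ring_nf

lemma trigSum_two_mul (α : ℝ) : trigSum s a k (2 * α) = trigSum s a (fun n => 2 * k n) α := by
  simp only [trigSum]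
  refine Finset.sum_congr rfl fun n _ => ?_
  push_cast
  ring_nf

lemma integral_cexp_intCast (c : ℝ) (m : ℤ) :
    ∫ α in c..c + 1, cexp (2 * Real.pi * I * (α * m)) = if m = 0 then 1 else 0 := by
  split_ifs with h
  · simp [h]
  · have h1 : 2 * Real.pi * I * m ≠ 0 := mul_ne_zero two_pi_I_ne_zero (by exact_mod_cast h)
    simp_rw [show ∀ α : ℝ, 2 * Real.pi * I * (α * m) = 2 * Real.pi * I * m * α from
      fun α => by ring]
    rw [integral_exp_mul_complex h1, div_eq_zero_iff]
    left
    rw [sub_eq_zero, Complex.exp_eq_exp_iff_exists_int]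
    exact ⟨m, by push_cast; ring⟩

lemma integral_trigSum (c : ℝ) :
    ∫ α in c..c + 1, trigSum s a k α = ((∑ n ∈ s with k n = 0, a n : ℝ) : ℂ) := by
  unfold trigSum
  rw [intervalIntegral.integral_finsetSum fun n _ =>
    (by fun_prop : Continuous _).intervalIntegrable _ _, Finset.sum_filter]
  push_cast
  refine Finset.sum_congr rfl fun n _ => ?_
  rw [intervalIntegral.integral_const_mul, integral_cexp_intCast]
  split_ifs <;> simp

lemma integral_gaussian_mul_cexp {η : ℝ} (hη : 0 < η) (m : ℝ) :
    ∫ β : ℝ, (Real.exp (-Real.pi * (β / η) ^ 2) : ℂ) * cexp (2 * Real.pi * I * (β * m)) =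
      ((η * Real.exp (-Real.pi * (η * m) ^ 2) : ℝ) : ℂ) := by
  have hη' : (η : ℂ) ≠ 0 := by exact_mod_cast hη.ne'
  have hπ : (Real.pi : ℂ) ≠ 0 := by exact_mod_cast Real.pi_ne_zero
  have h := fourierIntegral_gaussian (b := ((Real.pi / η ^ 2 : ℝ) : ℂ))
    (by rw [ofReal_re]; positivity) (2 * Real.pi * m)
  have h1 : ((Real.pi : ℂ) / ((Real.pi / η ^ 2 : ℝ) : ℂ)) ^ (1 / 2 : ℂ) = η := by
    rw [← ofReal_div, show Real.pi / (Real.pi / η ^ 2) = η ^ 2 by field_simp,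
      show (1 / 2 : ℂ) = ((1 / 2 : ℝ) : ℂ) by push_cast; rfl, ← ofReal_cpow (by positivity),
      ← Real.sqrt_eq_rpow, Real.sqrt_sq hη.le]
  rw [h1] at h
  rw [ofReal_mul, ofReal_exp]
  convert h using 3
  · rw [mul_comm, ofReal_exp]
    congr 2
    · ring
    · push_cast; field_simp
  · push_cast
    field_simp
    ring

lemma integrable_gaussian_mul {η : ℝ} (hη : 0 < η) {g : ℝ → ℂ} (hg : Continuous g) {B : ℝ}
    (hB : ∀ β, ‖g β‖ ≤ B) :
    Integrable fun β : ℝ => (Real.exp (-Real.pi * (β / η) ^ 2) : ℂ) * g β := by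
  have h1 : Integrable fun β : ℝ => Real.exp (-Real.pi * (β / η) ^ 2) := by
    have := integrable_exp_neg_mul_sq (b := Real.pi / η ^ 2) (by positivity)
    refine this.congr (Eventually.of_forall fun β => ?_)
    field_simp
  exact h1.ofReal.mul_bdd (c := B) hg.aestronglyMeasurable (Eventually.of_forall hB)

lemma integral_gaussian_mul_trigSum {η : ℝ} (hη : 0 < η) :
    ∫ β : ℝ, (Real.exp (-Real.pi * (β / η) ^ 2) : ℂ) * trigSum s a k β =
      ((η * ∑ n ∈ s, a n * Real.exp (-Real.pi * (η * k n) ^ 2) : ℝ) : ℂ) := by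
  simp only [trigSum, Finset.mul_sum]
  rw [integral_finsetSum]
  · push_cast
    refine Finset.sum_congr rfl fun n _ => ?_
    have := integral_gaussian_mul_cexp hη (k n)
    push_cast at this
    calc _ = ∫ β : ℝ, (a n : ℂ) * (cexp (-Real.pi * (β / η) ^ 2) *
          cexp (2 * Real.pi * I * (β * k n))) := by
          congr 1; ext β; ring
      _ = _ := by rw [integral_const_mul, this]; ring
  · intro n _
    refine integrable_gaussian_mul hη (by fun_prop) (B := |a n|) fun β => ?_
    rw [norm_mul, show 2 * (Real.pi : ℂ) * I * (β * k n) =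
      ((2 * Real.pi * (β * k n) : ℝ) : ℂ) * I by push_cast; ring, norm_exp_ofReal_mul_I, mul_one,
      norm_real, Real.norm_eq_abs]

end trigSum

/-- The weighted exponential sum `f(α) = ∑ a(n) e(α n)` over natural numbers. -/
def waveSum (s : Finset ℕ) (a : ℕ → ℝ) (α : ℝ) : ℂ := trigSum s a (fun n => n) α

/-- The integrand `f(α)² conj f(2α)` detecting `x + y = 2 z`. -/
def waveTriple (s : Finset ℕ) (a : ℕ → ℝ) (α : ℝ) : ℂ :=
  waveSum s a α ^ 2 * conj (waveSum s a (2 * α))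

section wave

variable {s : Finset ℕ} {a : ℕ → ℝ}

lemma waveTriple_eq (α : ℝ) : waveTriple s a α =
    trigSum ((s ×ˢ s) ×ˢ s) (fun p => a p.1.1 * a p.1.2 * a p.2)
      (fun p => (p.1.1 : ℤ) + p.1.2 + -(2 * (p.2 : ℤ))) α := by
  rw [waveTriple, waveSum, waveSum, trigSum_two_mul, conj_trigSum, sq, trigSum_mul, trigSum_mul]

lemma continuous_waveTriple : Continuous (waveTriple s a) := by
  simp_rw [funext (waveTriple_eq (s := s) (a := a))]
  exact continuous_trigSum _ _ _

lemma integral_waveTriple (c : ℝ) : ∫ α in c..c + 1, waveTriple s a α =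
    ((∑ p ∈ (s ×ˢ s) ×ˢ s with p.1.1 + p.1.2 = 2 * p.2, a p.1.1 * a p.1.2 * a p.2 : ℝ) : ℂ) := by
  simp_rw [waveTriple_eq]
  rw [integral_trigSum]
  congr 2
  ext p
  simp only [Finset.mem_filter, and_congr_right_iff]
  intro _
  omega

lemma integral_norm_waveSum_sq (c : ℝ) :
    ∫ α in c..c + 1, ‖waveSum s a α‖ ^ 2 = ∑ n ∈ s, a n ^ 2 := by
  have h1 : ∀ α, ((‖waveSum s a α‖ ^ 2 : ℝ) : ℂ) =
      trigSum (s ×ˢ s) (fun p => a p.1 * a p.2) (fun p => (p.1 : ℤ) + -p.2) α := fun α => by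
    rw [← trigSum_mul s a (fun n => (n : ℤ)) s a (fun n => -(n : ℤ)),
      ← conj_trigSum s a (fun n => (n : ℤ)), mul_conj', waveSum]
    push_cast
    rfl
  have h2 := integral_trigSum (s ×ˢ s) (fun p => a p.1 * a p.2) (fun p => (p.1 : ℤ) + -p.2) c
  simp_rw [← h1] at h2
  rw [intervalIntegral.integral_ofReal] at h2
  have h3 := ofReal_injective h2
  rw [h3, Finset.sum_filter, Finset.sum_product]
  refine Finset.sum_congr rfl fun n hn => ?_
  rw [Finset.sum_eq_single n]
  · simp [sq]
  · intro m _ hm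
    rw [if_neg]
    omega
  · intro h; exact absurd hn h

lemma norm_waveSum_le (ha : ∀ n, 0 ≤ a n) (h1 : ∑ n ∈ s, a n ≤ 1) (α : ℝ) :
    ‖waveSum s a α‖ ≤ 1 := (norm_trigSum_le s a _ (fun n _ => ha n) α).trans h1

lemma norm_waveTriple_le_one (ha : ∀ n, 0 ≤ a n) (h1 : ∑ n ∈ s, a n ≤ 1) (α : ℝ) :
    ‖waveTriple s a α‖ ≤ 1 := by
  rw [waveTriple, norm_mul, norm_pow, RCLike.norm_conj]
  exact mul_le_one₀ (pow_le_one₀ (norm_nonneg _) (norm_waveSum_le ha h1 _)) (norm_nonneg _)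
    (norm_waveSum_le ha h1 _)

end wave

end

noncomputable section
open Complex MeasureTheory Set Filter Topology Metric
open scoped ComplexConjugate

/-- The integrable majorant `(1 + |x|)^(-3/2)`. -/
def decay (x : ℝ) : ℝ := (1 + |x|) ^ (-(3/2) : ℝ)

/-- The total mass of `decay`. -/
def decayMass : ℝ := ∫ x, decay x

lemma decay_nonneg (x : ℝ) : 0 ≤ decay x := by unfold decay; positivity

lemma decayMass_nonneg : 0 ≤ decayMass := integral_nonneg decay_nonneg

lemma integrable_decay : Integrable decay := by
  have := integrable_one_add_norm (E := ℝ) (μ := volume) (r := 3/2) (by norm_num)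
  exact this

lemma decay_eq (x : ℝ) : decay x = 1 / √(1 + |x|) ^ 3 := by
  rw [decay, Real.rpow_neg (by positivity), one_div, Real.sqrt_eq_rpow, ← Real.rpow_natCast,
    ← Real.rpow_mul (by positivity)]
  norm_num

lemma integrable_decay_comp {N : ℝ} (hN : 0 < N) (c : ℝ) :
    Integrable fun α => decay (N * (α - c)) :=
  (integrable_decay.comp_mul_left' hN.ne').comp_sub_right c

lemma integral_decay_comp {N : ℝ} (hN : 0 < N) (c : ℝ) :
    ∫ α, decay (N * (α - c)) = decayMass / N := by
  rw [integral_sub_right_eq_self (fun α => decay (N * α)) c, Measure.integral_comp_mul_left,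
    abs_of_pos (inv_pos.2 hN), smul_eq_mul, decayMass]
  ring

lemma one_sub_exp_mul_le {h T : ℝ} (hh : 0 < h) (hT : 0 ≤ T) :
    (1 - Real.exp (-Real.pi * (T / h ^ 2) ^ 2)) * (1 / (1 + T) ^ 3) ≤ 4 / h ^ 3 * decay T := by
  rw [decay_eq, abs_of_nonneg hT]
  have hu2 : √(1 + T) ^ 2 = 1 + T := Real.sq_sqrt (by linarith)
  have hu0 : 0 < √(1 + T) := Real.sqrt_pos.2 (by linarith)
  set u := √(1 + T)
  have hv : T / h ^ 2 ≤ (u / h) ^ 2 := by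
    rw [div_pow, hu2]; gcongr; linarith
  have hv0 : 0 ≤ T / h ^ 2 := by positivity
  have h1 : 1 - Real.exp (-Real.pi * (T / h ^ 2) ^ 2) ≤ 4 * (u / h) ^ 3 := by
    have hw0 : 0 < u / h := by positivity
    rcases le_or_gt 1 (u / h) with h2 | h2
    · have : 1 ≤ (u / h) ^ 3 := one_le_pow₀ h2
      linarith [Real.exp_pos (-Real.pi * (T / h ^ 2) ^ 2)]
    · have h3 := Real.add_one_le_exp (-Real.pi * (T / h ^ 2) ^ 2)
      have h4 : (T / h ^ 2) ^ 2 ≤ (u / h) ^ 4 := by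
        calc (T / h ^ 2) ^ 2 ≤ ((u / h) ^ 2) ^ 2 := by gcongr
          _ = _ := by ring
      have h5 : (u / h) ^ 4 ≤ (u / h) ^ 3 := pow_le_pow_of_le_one hw0.le h2.le (by norm_num)
      nlinarith [Real.pi_lt_four, Real.pi_pos, sq_nonneg (T / h ^ 2)]
  calc _ ≤ 4 * (u / h) ^ 3 * (1 / (u ^ 2) ^ 3) := by rw [hu2]; gcongr
    _ = _ := by field_simp

lemma exp_neg_le_decay {h T τ : ℝ} (hh : 0 < h) (hτ : 1 ≤ τ) (hT : τ ^ 2 ≤ T) :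
    Real.exp (-Real.pi * (T / h ^ 2) ^ 2) ≤ 4 * h ^ 4 / τ * decay T := by
  have hT1 : 1 ≤ T := (one_le_pow₀ hτ).trans hT
  rw [decay_eq, abs_of_nonneg (by linarith)]
  have hu2 : √(1 + T) ^ 2 = 1 + T := Real.sq_sqrt (by linarith)
  have hu0 : 0 < √(1 + T) := Real.sqrt_pos.2 (by linarith)
  have hs2 : √T ^ 2 = T := Real.sq_sqrt (by linarith)
  have hsτ : τ ≤ √T := Real.le_sqrt_of_sq_le hT
  set u := √(1 + T)
  set v := √T
  have hv : u ≤ 3/2 * v := by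
    refine le_of_sq_le_sq ?_ (by linarith)
    nlinarith
  have hx : 0 < Real.pi * (T / h ^ 2) ^ 2 := by positivity
  have h1 : Real.exp (-Real.pi * (T / h ^ 2) ^ 2) ≤ 1 / (T / h ^ 2) ^ 2 := by
    rw [neg_mul, Real.exp_neg, ← one_div]
    refine one_div_le_one_div_of_le (by positivity) ?_
    have := Real.add_one_le_exp (Real.pi * (T / h ^ 2) ^ 2)
    nlinarith [Real.pi_gt_three, sq_nonneg (T / h ^ 2)]
  refine h1.trans ?_
  have h2 : u ^ 3 * τ ≤ 4 * T ^ 2 := by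
    calc u ^ 3 * τ ≤ (3/2 * v) ^ 3 * v := by gcongr
      _ = 27/8 * (v ^ 2) ^ 2 := by ring
      _ ≤ _ := by rw [hs2]; nlinarith [sq_nonneg T]
  rw [div_pow, one_div_div, div_mul_div_comm, mul_one, div_le_div_iff₀ (by positivity)
    (by positivity)]
  nlinarith [mul_le_mul_of_nonneg_left h2 (by positivity : 0 ≤ h ^ 4)]

section

variable {s : Finset ℕ} {a : ℕ → ℝ} {N : ℝ}

/-- The smoothed count of near-solutions of `x + y = 2 z`. -/
def smoothedCount (s : Finset ℕ) (a : ℕ → ℝ) (η : ℝ) : ℝ :=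
  η * ∑ p ∈ (s ×ˢ s) ×ˢ s, a p.1.1 * a p.1.2 * a p.2 *
    Real.exp (-Real.pi * (η * ((p.1.1 : ℤ) + p.1.2 + -(2 * (p.2 : ℤ)) : ℤ)) ^ 2)

lemma integral_gaussian_mul_waveTriple {η : ℝ} (hη : 0 < η) :
    ∫ β : ℝ, (Real.exp (-Real.pi * (β / η) ^ 2) : ℂ) * waveTriple s a β =
      (smoothedCount s a η : ℂ) := by
  simp_rw [waveTriple_eq]
  exact integral_gaussian_mul_trigSum _ _ _ hη

lemma norm_integral_waveTriple_sub_le (ha : ∀ n, 0 ≤ a n) (h1 : ∑ n ∈ s, a n ≤ 1) (hN : 0 < N)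
    {h τ K E : ℝ} (hh : 0 < h) (hτ : 1 ≤ τ) (hK : 0 ≤ K) (hE : 0 ≤ E)
    (hb : ∀ β, |β| ≤ τ ^ 2 / N → ‖waveTriple s a β‖ ≤ K * (1 / (1 + N * |β|) ^ 3) + E) :
    ‖(∫ β in Icc (-(τ ^ 2 / N)) (τ ^ 2 / N), waveTriple s a β) -
      (smoothedCount s a (h ^ 2 / N) : ℂ)‖ ≤
      ((4 * K / h ^ 3 + 4 * h ^ 4 / τ) * decayMass + 2 * E * τ ^ 2) / N := by
  set A := Icc (-(τ ^ 2 / N)) (τ ^ 2 / N) with hA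
  have hη : 0 < h ^ 2 / N := by positivity
  have hi1 : Integrable (A.indicator (waveTriple s a)) :=
    (continuous_waveTriple.continuousOn.integrableOn_Icc).integrable_indicator measurableSet_Icc
  have hi2 := integrable_gaussian_mul hη (continuous_waveTriple (s := s) (a := a))
    (norm_waveTriple_le_one ha h1)
  rw [← integral_gaussian_mul_waveTriple hη, ← integral_indicator measurableSet_Icc,
    ← integral_sub hi1 hi2]
  have hi3 : Integrable fun β => (4 * K / h ^ 3 + 4 * h ^ 4 / τ) * decay (N * (β - 0)) +
      A.indicator (fun _ => E) β :=
    ((integrable_decay_comp hN 0).const_mul _).add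
      ((integrable_indicator_iff measurableSet_Icc).2
        (integrableOn_const (by simp) (by simp)))
  refine (norm_integral_le_of_norm_le hi3 (Eventually.of_forall fun β => ?_)).trans (le_of_eq ?_)
  · rw [sub_zero]
    have hT : |N * β| = N * |β| := by rw [abs_mul, abs_of_pos hN]
    have hd : decay (N * |β|) = decay (N * β) := by rw [decay, decay, abs_mul, abs_mul, abs_abs]
    have hd0 := decay_nonneg (N * β)
    have hsq : (β / (h ^ 2 / N)) ^ 2 = (N * |β| / h ^ 2) ^ 2 := by
      rw [div_pow, div_pow, div_pow, mul_pow, sq_abs]; field_simp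
    rw [hsq]
    have he1 : Real.exp (-Real.pi * (N * |β| / h ^ 2) ^ 2) ≤ 1 :=
      Real.exp_le_one_iff.2 (by nlinarith [Real.pi_pos, sq_nonneg (N * |β| / h ^ 2)])
    by_cases hβ : β ∈ A
    · rw [indicator_of_mem hβ, indicator_of_mem hβ, ← one_sub_mul, norm_mul, ← ofReal_one,
        ← ofReal_sub, norm_real, Real.norm_eq_abs, abs_of_nonneg (by linarith)]
      have h2 := one_sub_exp_mul_le hh (T := N * |β|) (by positivity)
      rw [hd] at h2
      calc _ ≤ (1 - Real.exp (-Real.pi * (N * |β| / h ^ 2) ^ 2)) *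
            (K * (1 / (1 + N * |β|) ^ 3) + E) := by
            gcongr
            exact hb β (abs_le.2 hβ)
        _ = K * ((1 - Real.exp (-Real.pi * (N * |β| / h ^ 2) ^ 2)) * (1 / (1 + N * |β|) ^ 3)) +
            (1 - Real.exp (-Real.pi * (N * |β| / h ^ 2) ^ 2)) * E := by ring
        _ ≤ K * (4 / h ^ 3 * decay (N * β)) + 1 * E := by
            gcongr
            linarith [Real.exp_pos (-Real.pi * (N * |β| / h ^ 2) ^ 2)]
        _ = 4 * K / h ^ 3 * decay (N * β) + E := by ring
        _ ≤ _ := by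
            gcongr
            have : 0 ≤ 4 * h ^ 4 / τ := by positivity
            linarith
    · rw [indicator_of_notMem hβ, indicator_of_notMem hβ, zero_sub, norm_neg, norm_mul, norm_real,
        Real.norm_eq_abs, abs_of_pos (Real.exp_pos _), add_zero]
      have h3 : τ ^ 2 ≤ N * |β| := by
        have : ¬ |β| ≤ τ ^ 2 / N := fun h => hβ (abs_le.1 h)
        rw [not_le, div_lt_iff₀ hN] at this
        linarith
      have h2 := exp_neg_le_decay hh hτ h3
      rw [hd] at h2
      calc _ ≤ 4 * h ^ 4 / τ * decay (N * β) * 1 := by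
            gcongr
            exact norm_waveTriple_le_one ha h1 β
        _ ≤ _ := by
            rw [mul_one]
            gcongr
            have : 0 ≤ 4 * K / h ^ 3 := by positivity
            linarith
  · rw [integral_add ((integrable_decay_comp hN 0).const_mul _)
      ((integrable_indicator_iff measurableSet_Icc).2
        (integrableOn_const (by simp) (by simp))), integral_const_mul,
      integral_decay_comp hN, integral_indicator measurableSet_Icc, setIntegral_const,
      measureReal_def, Real.volume_Icc, ENNReal.toReal_ofReal (by
        have : 0 ≤ τ ^ 2 / N := by positivity
        linarith), smul_eq_mul]
    field_simp
    ring

lemma le_smoothedCount (ha : ∀ n, 0 ≤ a n) (hN : 0 < N) {H : ℝ} (hH : 1 ≤ H)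
    (hs : ∀ n ∈ s, (n : ℝ) ≤ 3 * N) :
    Real.exp (-4 * Real.pi) * (∑ n ∈ s, a n) ^ 3 / (16 * H * N) ≤ smoothedCount s a (H / N) := by
  set M := ⌊3 * H⌋₊ with hM
  have hMH : (M : ℝ) ≤ 3 * H := Nat.floor_le (by positivity)
  have hmaps : ∀ n ∈ s, ⌊(n : ℝ) * (H / N)⌋₊ ∈ Finset.range (M + 1) := fun n hn => by
    rw [Finset.mem_range, Nat.lt_succ_iff]
    refine Nat.floor_le_floor ?_
    calc (n : ℝ) * (H / N) ≤ 3 * N * (H / N) := by gcongr; exact hs n hn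
      _ = 3 * H := by field_simp
  have hcube : ∑ i ∈ Finset.range (M + 1),
      (∑ n ∈ s.filter (fun n : ℕ => ⌊(n : ℝ) * (H / N)⌋₊ = i), a n) ^ 3 *
      Real.exp (-4 * Real.pi) ≤ ∑ p ∈ (s ×ˢ s) ×ˢ s, a p.1.1 * a p.1.2 * a p.2 *
    Real.exp (-Real.pi * (H / N * ((p.1.1 : ℤ) + p.1.2 + -(2 * (p.2 : ℤ)) : ℤ)) ^ 2) := by
    have h1 : ∀ p ∈ (s ×ˢ s) ×ˢ s, 0 ≤ a p.1.1 * a p.1.2 * a p.2 *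
        Real.exp (-Real.pi * (H / N * ((p.1.1 : ℤ) + p.1.2 + -(2 * (p.2 : ℤ)) : ℤ)) ^ 2) :=
      fun p _ => mul_nonneg (mul_nonneg (mul_nonneg (ha _) (ha _)) (ha _)) (Real.exp_pos _).le
    have hmaps' : ∀ p ∈ (s ×ˢ s) ×ˢ s, ⌊(p.2 : ℝ) * (H / N)⌋₊ ∈ Finset.range (M + 1) :=
      fun p hp => hmaps _ (Finset.mem_product.1 hp).2
    rw [← Finset.sum_fiberwise_of_maps_to hmaps']
    refine Finset.sum_le_sum fun i _ => ?_
    set t := s.filter fun n : ℕ => ⌊(n : ℝ) * (H / N)⌋₊ = i with ht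
    have h2 : (∑ n ∈ t, a n) ^ 3 * Real.exp (-4 * Real.pi) =
        ∑ p ∈ (t ×ˢ t) ×ˢ t, a p.1.1 * a p.1.2 * a p.2 * Real.exp (-4 * Real.pi) := by
      rw [← Finset.sum_mul, pow_succ, sq, Finset.sum_mul_sum, ← Finset.sum_product',
        Finset.sum_mul_sum, ← Finset.sum_product']
    rw [h2]
    refine (Finset.sum_le_sum fun p hp => ?_).trans
      (Finset.sum_le_sum_of_subset_of_nonneg (fun p hp => ?_)
        fun p hp _ => h1 p (Finset.mem_filter.1 hp).1)
    · refine mul_le_mul_of_nonneg_left (Real.exp_le_exp.2 ?_)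
        (mul_nonneg (mul_nonneg (ha _) (ha _)) (ha _))
      simp only [Finset.mem_product, ht, Finset.mem_filter] at hp
      obtain ⟨⟨⟨_, e1⟩, ⟨_, e2⟩⟩, ⟨_, e3⟩⟩ := hp
      have hf : ∀ n : ℕ, ⌊(n : ℝ) * (H / N)⌋₊ = i → (i : ℝ) ≤ n * (H / N) ∧ n * (H / N) < i + 1 :=
        fun n hn => (Nat.floor_eq_iff (by positivity)).1 hn
      obtain ⟨l1, u1⟩ := hf _ e1
      obtain ⟨l2, u2⟩ := hf _ e2
      obtain ⟨l3, u3⟩ := hf _ e3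
      have h3 : |H / N * ((p.1.1 : ℤ) + p.1.2 + -(2 * (p.2 : ℤ)) : ℤ)| ≤ 2 := by
        push_cast
        rw [abs_le]
        constructor <;> nlinarith
      have h4 := sq_le_sq' (abs_le.1 h3).1 (abs_le.1 h3).2
      nlinarith [Real.pi_pos]
    · simp only [Finset.mem_product, ht, Finset.mem_filter] at hp ⊢
      exact ⟨⟨⟨hp.1.1.1, hp.1.2.1⟩, hp.2.1⟩, hp.2.2⟩
  rw [← Finset.sum_mul] at hcube
  have hpow := pow_sum_div_card_le_sum_pow (s := Finset.range (M + 1))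
    (f := fun i => ∑ n ∈ s.filter (fun n : ℕ => ⌊(n : ℝ) * (H / N)⌋₊ = i), a n)
    (fun i _ => Finset.sum_nonneg fun n _ => ha n) 2
  rw [Finset.sum_fiberwise_of_maps_to hmaps, Finset.card_range] at hpow
  have hw : 0 ≤ ∑ n ∈ s, a n := Finset.sum_nonneg fun n _ => ha n
  have hM4 : ((M + 1 : ℕ) : ℝ) ≤ 4 * H := by push_cast; linarith
  have hM0 : (0 : ℝ) < (M + 1 : ℕ) := by positivity
  calc Real.exp (-4 * Real.pi) * (∑ n ∈ s, a n) ^ 3 / (16 * H * N)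
      = H / N * ((∑ n ∈ s, a n) ^ (2 + 1) / (4 * H) ^ 2 * Real.exp (-4 * Real.pi)) := by
        field_simp; ring
    _ ≤ H / N * ((∑ n ∈ s, a n) ^ (2 + 1) / ((M + 1 : ℕ) : ℝ) ^ 2 *
        Real.exp (-4 * Real.pi)) := by gcongr
    _ ≤ H / N * ((∑ i ∈ Finset.range (M + 1),
      (∑ n ∈ s.filter (fun n : ℕ => ⌊(n : ℝ) * (H / N)⌋₊ = i), a n) ^ 3) *
        Real.exp (-4 * Real.pi)) := by gcongr
    _ ≤ _ := by
        rw [smoothedCount]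
        gcongr

end

end

noncomputable section
open Complex MeasureTheory Set Filter Topology Metric
open scoped ComplexConjugate

/-- The function `μ² / φ²` restricted to odd numbers. -/
def oddSqInv (m : ℕ) : ℝ :=
  if Odd m then |(ArithmeticFunction.moebius m : ℝ)| / (m.totient : ℝ) ^ 2 else 0

lemma oddSqInv_nonneg (m : ℕ) : 0 ≤ oddSqInv m := by
  unfold oddSqInv; split_ifs <;> positivity

lemma sum_range_inv_even_sq_le (n : ℕ) :
    ∑ k ∈ Finset.range n, 1 / (2 * (k : ℝ) + 2) ^ 2 ≤ 1 / 2 - 1 / (2 * (2 * (n : ℝ) + 1)) := by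
  induction n with
  | zero => norm_num
  | succ n ih =>
    rw [Finset.sum_range_succ]
    have h : 1 / (2 * (n : ℝ) + 2) ^ 2 ≤
        1 / (2 * (2 * (n : ℝ) + 1)) - 1 / (2 * (2 * ((n + 1 : ℕ) : ℝ) + 1)) := by
      push_cast
      rw [div_sub_div _ _ (by positivity) (by positivity), div_le_div_iff₀ (by positivity)
        (by positivity)]
      nlinarith
    linarith

lemma sum_oddSqInv_le (R : ℕ) : ∑ m ∈ Finset.Icc 1 R, oddSqInv m ≤ Real.exp (1 / 2) := by
  set P := (Finset.Icc 3 R).filter fun p => p.Prime with hP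
  set T := (Finset.Icc 1 R).filter fun m => Odd m ∧ Squarefree m with hT
  have hprime : ∀ m ∈ T, ∀ p ∈ m.primeFactors, p ∈ P := fun m hm p hp => by
    rw [hT, Finset.mem_filter, Finset.mem_Icc] at hm
    have hpp := Nat.prime_of_mem_primeFactors hp
    have hpd := Nat.dvd_of_mem_primeFactors hp
    rw [hP, Finset.mem_filter, Finset.mem_Icc]
    refine ⟨⟨?_, (Nat.le_of_dvd (by omega) hpd).trans hm.1.2⟩, hpp⟩
    have h2 := hpp.two_le
    rcases h2.lt_or_eq with h | h
    · exact h
    · exact absurd (h ▸ hpd) (Nat.two_dvd_ne_zero.2 (Nat.odd_iff.1 hm.2.1))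
  have hval : ∀ m ∈ T, oddSqInv m = ∏ p ∈ m.primeFactors, 1 / ((p : ℝ) - 1) ^ 2 := fun m hm => by
    have hm' := hm
    rw [hT, Finset.mem_filter, Finset.mem_Icc] at hm'
    obtain ⟨⟨hm1, -⟩, ho, hsq⟩ := hm'
    have hφ : (m.totient : ℝ) = ∏ p ∈ m.primeFactors, ((p : ℝ) - 1) := by
      rw [Nat.totient_eq_div_primeFactors_mul, Nat.prod_primeFactors_of_squarefree hsq,
        Nat.div_self (by omega), one_mul, Nat.cast_prod]
      refine Finset.prod_congr rfl fun p hp => ?_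
      rw [Nat.cast_pred (Nat.prime_of_mem_primeFactors hp).pos]
    have hμ : |(ArithmeticFunction.moebius m : ℝ)| = 1 := by
      have := ArithmeticFunction.abs_moebius_eq_one_of_squarefree hsq
      exact_mod_cast this
    rw [oddSqInv, if_pos ho, hμ, hφ, ← Finset.prod_pow, Finset.prod_div_distrib,
      Finset.prod_const_one]
  have hinj : Set.InjOn Nat.primeFactors T := fun m hm n hn h => by
    have hm' := (Finset.mem_filter.1 hm).2.2
    have hn' := (Finset.mem_filter.1 hn).2.2
    rw [← Nat.prod_primeFactors_of_squarefree hm', h, Nat.prod_primeFactors_of_squarefree hn']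
  calc ∑ m ∈ Finset.Icc 1 R, oddSqInv m = ∑ m ∈ T, oddSqInv m := by
        refine (Finset.sum_subset (Finset.filter_subset _ _) fun m hm hm' => ?_).symm
        rw [Finset.mem_filter, not_and] at hm'
        have := hm' hm
        rw [oddSqInv]
        split_ifs with ho
        · have hs : ¬ Squarefree m := fun h => this ⟨ho, h⟩
          rw [ArithmeticFunction.moebius_eq_zero_of_not_squarefree hs]
          simp
        · rfl
    _ = ∑ m ∈ T, ∏ p ∈ m.primeFactors, 1 / ((p : ℝ) - 1) ^ 2 := Finset.sum_congr rfl hval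
    _ = ∑ t ∈ T.image Nat.primeFactors, ∏ p ∈ t, 1 / ((p : ℝ) - 1) ^ 2 :=
        (Finset.sum_image (f := fun t : Finset ℕ => ∏ p ∈ t, 1 / ((p : ℝ) - 1) ^ 2) hinj).symm
    _ ≤ ∑ t ∈ P.powerset, ∏ p ∈ t, 1 / ((p : ℝ) - 1) ^ 2 := by
        refine Finset.sum_le_sum_of_subset_of_nonneg (fun t ht => ?_)
          fun t _ _ => Finset.prod_nonneg fun p _ => by positivity
        obtain ⟨m, hm, rfl⟩ := Finset.mem_image.1 ht
        exact Finset.mem_powerset.2 fun p hp => hprime m hm p hp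
    _ = ∏ p ∈ P, (1 + 1 / ((p : ℝ) - 1) ^ 2) := (Finset.prod_one_add P).symm
    _ ≤ ∏ p ∈ P, Real.exp (1 / ((p : ℝ) - 1) ^ 2) :=
        Finset.prod_le_prod (fun p _ => by positivity) fun p _ => by
          rw [add_comm]; exact Real.add_one_le_exp _
    _ = Real.exp (∑ p ∈ P, 1 / ((p : ℝ) - 1) ^ 2) := (Real.exp_sum _ _).symm
    _ ≤ Real.exp (1 / 2) := by
        refine Real.exp_le_exp.2 ?_
        have h1 : P ⊆ (Finset.range R).image fun k => 2 * k + 3 := fun p hp => by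
          rw [hP, Finset.mem_filter, Finset.mem_Icc] at hp
          have ho := hp.2.odd_of_ne_two (by omega)
          obtain ⟨k, hk⟩ := ho
          exact Finset.mem_image.2 ⟨k - 1, Finset.mem_range.2 (by omega), by omega⟩
        refine (Finset.sum_le_sum_of_subset_of_nonneg h1 fun _ _ _ => by positivity).trans ?_
        rw [Finset.sum_image fun x _ y _ h => by simpa using h]
        refine le_trans (le_of_eq ?_) ((sum_range_inv_even_sq_le R).trans ?_)
        · refine Finset.sum_congr rfl fun k _ => ?_
          push_cast
          ring_nf
        · have : (0 : ℝ) ≤ 1 / (2 * (2 * (R : ℝ) + 1)) := by positivity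
          linarith

/-- The coefficient of the major arc with denominator `r`. -/
def arcCoeff (r : ℕ) : ℂ := ramCoeff r ^ 2 * conj (ramCoeff (r / r.gcd 2))

lemma norm_ramCoeff (r : ℕ) :
    ‖ramCoeff r‖ = |(ArithmeticFunction.moebius r : ℝ)| / r.totient := by
  rw [ramCoeff, norm_div, norm_intCast, norm_natCast]

lemma totient_mul_norm_arcCoeff_le {r : ℕ} (hr : 0 < r) :
    r.totient * ‖arcCoeff r‖ ≤ if Odd r then oddSqInv r else oddSqInv (r / 2) := by
  have hμ : ∀ n : ℕ, |(ArithmeticFunction.moebius n : ℝ)| ≤ 1 := fun n => by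
    have := ArithmeticFunction.abs_moebius_le_one (n := n)
    exact_mod_cast this
  have hφ : (0 : ℝ) < r.totient := by exact_mod_cast Nat.totient_pos.2 hr
  rw [arcCoeff, norm_mul, norm_pow, norm_conj, norm_ramCoeff, norm_ramCoeff]
  split_ifs with ho
  · have hg : r.gcd 2 = 1 := Nat.coprime_two_right.2 ho
    rw [hg, Nat.div_one, oddSqInv, if_pos ho]
    have h1 := hμ r
    have h0 := abs_nonneg (ArithmeticFunction.moebius r : ℝ)
    have h3 : |(ArithmeticFunction.moebius r : ℝ)| ^ 2 ≤ 1 := pow_le_one₀ h0 h1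
    calc (r.totient : ℝ) * ((|(ArithmeticFunction.moebius r : ℝ)| / r.totient) ^ 2 *
          (|(ArithmeticFunction.moebius r : ℝ)| / r.totient))
        = |(ArithmeticFunction.moebius r : ℝ)| ^ 2 *
          (|(ArithmeticFunction.moebius r : ℝ)| / (r.totient : ℝ) ^ 2) := by field_simp
      _ ≤ 1 * (|(ArithmeticFunction.moebius r : ℝ)| / (r.totient : ℝ) ^ 2) := by gcongr
      _ = _ := one_mul _
  · rw [Nat.not_odd_iff_even] at ho
    obtain ⟨m, rfl⟩ := ho.two_dvd
    have hg : (2 * m).gcd 2 = 2 := Nat.gcd_eq_right (Dvd.intro _ rfl)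
    rw [hg, Nat.mul_div_cancel_left _ two_pos, oddSqInv]
    split_ifs with hm
    · have hc : Nat.Coprime 2 m := Nat.coprime_two_left.2 hm
      have ht : (2 * m).totient = m.totient := by rw [Nat.totient_mul hc]; simp
      rw [ht] at hφ ⊢
      have h1 := hμ (2 * m)
      have h0 := abs_nonneg (ArithmeticFunction.moebius (2 * m) : ℝ)
      have h3 : |(ArithmeticFunction.moebius (2 * m) : ℝ)| ^ 2 ≤ 1 := pow_le_one₀ h0 h1
      calc (m.totient : ℝ) * ((|(ArithmeticFunction.moebius (2 * m) : ℝ)| / m.totient) ^ 2 *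
            (|(ArithmeticFunction.moebius m : ℝ)| / m.totient))
          = |(ArithmeticFunction.moebius (2 * m) : ℝ)| ^ 2 *
            (|(ArithmeticFunction.moebius m : ℝ)| / (m.totient : ℝ) ^ 2) := by field_simp
        _ ≤ 1 * (|(ArithmeticFunction.moebius m : ℝ)| / (m.totient : ℝ) ^ 2) := by gcongr
        _ = _ := one_mul _
    · rw [Nat.not_odd_iff_even] at hm
      have hs : ¬ Squarefree (2 * m) := fun h => by
        obtain ⟨k, rfl⟩ := hm.two_dvd
        have := h 2 ⟨k, by ring⟩
        simp at this
      rw [ArithmeticFunction.moebius_eq_zero_of_not_squarefree hs]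
      simp

lemma norm_sum_arcCoeff_sub_two_le {R : ℕ} (hR : 2 ≤ R) :
    ‖∑ r ∈ Finset.Icc 1 R, (r.totient : ℂ) * arcCoeff r - 2‖ ≤ 13 / 10 := by
  have hsplit : ∀ f : ℕ → ℂ, ∑ r ∈ Finset.Icc 1 R, f r = f 1 + f 2 + ∑ r ∈ Finset.Icc 3 R, f r := by
    intro f
    rw [← Finset.insert_Icc_add_one_left_eq_Icc (by omega : 1 ≤ R), Finset.sum_insert (by simp),
      ← Finset.insert_Icc_add_one_left_eq_Icc (by omega : 1 + 1 ≤ R), Finset.sum_insert (by simp)]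
    ring_nf
  have h1 : ((1 : ℕ).totient : ℂ) * arcCoeff 1 = 1 := by simp [arcCoeff, ramCoeff]
  have h2 : ((2 : ℕ).totient : ℂ) * arcCoeff 2 = 1 := by
    simp [arcCoeff, ramCoeff, ArithmeticFunction.moebius_apply_prime Nat.prime_two]
  rw [hsplit, h1, h2, show (1 + 1 + ∑ r ∈ Finset.Icc 3 R, (r.totient : ℂ) * arcCoeff r) - 2 =
    ∑ r ∈ Finset.Icc 3 R, (r.totient : ℂ) * arcCoeff r by ring]
  have h3 : ∑ m ∈ Finset.Icc 2 R, oddSqInv m ≤ Real.exp (1 / 2) - 1 := by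
    have := sum_oddSqInv_le R
    rw [← Finset.insert_Icc_add_one_left_eq_Icc (by omega : 1 ≤ R),
      Finset.sum_insert (by simp)] at this
    have h4 : oddSqInv 1 = 1 := by simp [oddSqInv]
    norm_num at this h4 ⊢
    linarith
  have hexp : Real.exp (1 / 2) ≤ 1.65 := by
    have h := Real.exp_one_lt_d9
    have h5 : Real.exp (1 / 2) ^ 2 = Real.exp 1 := by
      rw [← Real.exp_nat_mul]; norm_num
    by_contra! hc
    nlinarith
  calc ‖∑ r ∈ Finset.Icc 3 R, (r.totient : ℂ) * arcCoeff r‖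
      ≤ ∑ r ∈ Finset.Icc 3 R, r.totient * ‖arcCoeff r‖ := by
        refine (norm_sum_le _ _).trans (le_of_eq (Finset.sum_congr rfl fun r _ => ?_))
        rw [norm_mul, Complex.norm_natCast]
    _ ≤ ∑ r ∈ Finset.Icc 3 R, if Odd r then oddSqInv r else oddSqInv (r / 2) :=
        Finset.sum_le_sum fun r hr =>
          totient_mul_norm_arcCoeff_le (by have := Finset.mem_Icc.1 hr; omega)
    _ = ∑ r ∈ (Finset.Icc 3 R).filter (fun r => Odd r), oddSqInv r +
        ∑ r ∈ (Finset.Icc 3 R).filter (fun r => ¬ Odd r), oddSqInv (r / 2) := Finset.sum_ite ..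
    _ ≤ ∑ m ∈ Finset.Icc 2 R, oddSqInv m + ∑ m ∈ Finset.Icc 2 R, oddSqInv m := by
        refine add_le_add (Finset.sum_le_sum_of_subset_of_nonneg (fun r hr => ?_)
          fun _ _ _ => oddSqInv_nonneg _) ?_
        · have := Finset.mem_Icc.1 (Finset.mem_filter.1 hr).1
          exact Finset.mem_Icc.2 (by omega)
        · have hinj : Set.InjOn (fun r => r / 2) ((Finset.Icc 3 R).filter fun r => ¬ Odd r) := by
            intro x hx y hy h
            have h1 := Nat.not_odd_iff.1 (Finset.mem_filter.1 hx).2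
            have h2 := Nat.not_odd_iff.1 (Finset.mem_filter.1 hy).2
            dsimp only at h
            omega
          rw [← Finset.sum_image (f := oddSqInv) hinj]
          refine Finset.sum_le_sum_of_subset_of_nonneg (fun m hm => ?_)
            fun _ _ _ => oddSqInv_nonneg _
          obtain ⟨r, hr, rfl⟩ := Finset.mem_image.1 hm
          have h1 := Nat.not_odd_iff.1 (Finset.mem_filter.1 hr).2
          have := Finset.mem_Icc.1 (Finset.mem_filter.1 hr).1
          exact Finset.mem_Icc.2 (by omega)
    _ ≤ 13 / 10 := by linarith

end

noncomputable section
open Complex MeasureTheory Set Filter Topology Metric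
open scoped ComplexConjugate

lemma exists_two_mul_div_eq {r : ℕ} (hr : 0 < r) {b : ℤ} (hb : IsUnit (b : ZMod r)) :
    ∃ c : ℤ, IsUnit (c : ZMod (r / r.gcd 2)) ∧
      2 * ((b : ℝ) / r) = (c : ℝ) / ((r / r.gcd 2 : ℕ) : ℝ) := by
  have hg : 0 < r.gcd 2 := Nat.gcd_pos_of_pos_left _ hr
  obtain ⟨m, hm⟩ := Nat.gcd_dvd_left r 2
  obtain ⟨k, hk⟩ := Nat.gcd_dvd_right r 2
  have hco := Nat.coprime_div_gcd_div_gcd (m := r) (n := 2) hg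
  have hm' : r / r.gcd 2 = m := Nat.div_eq_of_eq_mul_right hg hm
  have hk' : 2 / r.gcd 2 = k := Nat.div_eq_of_eq_mul_right hg hk
  rw [hm', hk'] at hco
  rw [hm']
  refine ⟨k * b, ?_, ?_⟩
  · rw [ZMod.coe_int_isUnit_iff_isCoprime] at hb ⊢
    refine IsCoprime.mul_right (Nat.isCoprime_iff_coprime.2 hco) ?_
    rw [hm] at hb
    push_cast at hb
    exact hb.of_mul_left_right
  · have hm0 : (m : ℝ) ≠ 0 := by
      rintro h
      rw [Nat.cast_eq_zero] at h
      rw [h] at hm; omega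
    have hg0 : (r.gcd 2 : ℝ) ≠ 0 := by exact_mod_cast hg.ne'
    have h1 : (r : ℝ) = r.gcd 2 * m := by exact_mod_cast hm
    have h2 : (2 : ℝ) = r.gcd 2 * k := by exact_mod_cast hk
    rw [h1]
    push_cast
    rw [← mul_div_assoc, div_eq_div_iff (mul_ne_zero hg0 hm0) hm0]
    linear_combination (b : ℝ) * m * h2

section arcs

variable {j : ℕ} {P : Finset ℕ} {ν : ℕ → ℝ} {N : ℝ} {s : Finset ℕ} {a : ℕ → ℝ}

lemma Window.soup_eq_waveSum (hW : Window j P ν N s a) (α : ℝ) :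
    soup P ν (numFactors j) N α = waveSum s a α := by
  rw [hW.soup_eq, waveSum, trigSum]
  push_cast
  rfl

lemma Window.one_le (hW : Window j P ν N s a) : 1 ≤ N :=
  (Real.one_le_exp (mul_nonneg (by norm_num) (by unfold logSize; positivity))).trans hW.exp_le

lemma ArcBounds.norm_waveSum_le (hA : ArcBounds j P ν N) (hW : Window j P ν N s a) {r : ℕ}
    (hr : 0 < r) {b : ℤ} (hb : IsUnit (b : ZMod r)) (hrN : (r : ℝ) ≤ N ^ (2/3 : ℝ)) {β : ℝ}
    (hβ : |β| ≤ 1 / (r * N ^ (2/3 : ℝ))) :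
    ‖waveSum s a (b / r + β)‖ ≤ 24 * bumpConst * (r : ℝ) ^ (-(3/4) : ℝ) / (1 + N * |β|) +
      Real.exp (-(3/100) * logSize j) ∧
    ‖waveSum s a (2 * (b / r + β))‖ ≤ 24 * bumpConst * (r : ℝ) ^ (-(3/4) : ℝ) / (1 + N * |β|) +
      Real.exp (-(3/100) * logSize j) := by
  have hN := hW.one_le
  have hC := one_le_bumpConst
  have hNp : 0 < N ^ (2/3 : ℝ) := by positivity
  have hr0 : (0 : ℝ) < r := by exact_mod_cast hr
  have : NeZero r := ⟨hr.ne'⟩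
  constructor
  · have h := hA.norm_le r b hb hrN β (hβ.trans (by gcongr; norm_num))
    rw [hW.soup_eq_waveSum] at h
    refine h.trans ?_
    rw [mul_comm |β|]
    gcongr
    norm_num
  · obtain ⟨c, hc, he⟩ := exists_two_mul_div_eq hr hb
    have hg : 0 < r.gcd 2 := Nat.gcd_pos_of_pos_left _ hr
    have hg2 : r.gcd 2 ≤ 2 := Nat.le_of_dvd two_pos (Nat.gcd_dvd_right _ _)
    have hm : 0 < r / r.gcd 2 := Nat.div_pos (Nat.le_of_dvd hr (Nat.gcd_dvd_left _ _)) hg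
    have : NeZero (r / r.gcd 2) := ⟨hm.ne'⟩
    have hmr : ((r / r.gcd 2 : ℕ) : ℝ) ≤ r := by exact_mod_cast Nat.div_le_self _ _
    have hrm : (r : ℝ) / 2 ≤ ((r / r.gcd 2 : ℕ) : ℝ) := by
      rw [Nat.cast_div (Nat.gcd_dvd_left _ _) (by positivity)]
      gcongr
      exact_mod_cast hg2
    have hm0 : (0 : ℝ) < ((r / r.gcd 2 : ℕ) : ℝ) := by exact_mod_cast hm
    have h2β : |2 * β| = 2 * |β| := by rw [abs_mul, abs_two]
    have h := hA.norm_le (r / r.gcd 2) c hc (hmr.trans hrN) (2 * β) (by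
      rw [h2β]
      calc 2 * |β| ≤ 2 * (1 / (r * N ^ (2/3 : ℝ))) := by gcongr
        _ = 2 / (r * N ^ (2/3 : ℝ)) := by ring
        _ ≤ _ := by gcongr)
    rw [hW.soup_eq_waveSum, ← he, ← mul_add] at h
    refine h.trans ?_
    have h34 : ((r / r.gcd 2 : ℕ) : ℝ) ^ (-(3/4) : ℝ) ≤ 2 * (r : ℝ) ^ (-(3/4) : ℝ) := by
      calc ((r / r.gcd 2 : ℕ) : ℝ) ^ (-(3/4) : ℝ) ≤ ((r : ℝ) / 2) ^ (-(3/4) : ℝ) :=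
            Real.rpow_le_rpow_of_nonpos (by positivity) hrm (by norm_num)
        _ = (2 : ℝ) ^ (3/4 : ℝ) * (r : ℝ) ^ (-(3/4) : ℝ) := by
            rw [Real.div_rpow hr0.le (by norm_num), Real.rpow_neg (by norm_num : (0:ℝ) ≤ 2)]
            field_simp
        _ ≤ (2 : ℝ) ^ (1 : ℝ) * (r : ℝ) ^ (-(3/4) : ℝ) := by
            gcongr <;> norm_num
        _ = _ := by rw [Real.rpow_one]
    rw [h2β]
    have hab := abs_nonneg β
    calc 12 * bumpConst * ((r / r.gcd 2 : ℕ) : ℝ) ^ (-(3/4) : ℝ) / (1 + 2 * |β| * N) +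
          Real.exp (-(3/100) * logSize j)
        ≤ 12 * bumpConst * (2 * (r : ℝ) ^ (-(3/4) : ℝ)) / (1 + N * |β|) +
          Real.exp (-(3/100) * logSize j) := by
          have : N * |β| ≤ 2 * |β| * N := by nlinarith
          gcongr
      _ = _ := by ring

/-- The constant in the bound for `waveTriple` near a rational. -/
def arcConst : ℝ := 8 * (24 * bumpConst) ^ 3

lemma arcConst_nonneg : 0 ≤ arcConst := by
  have := one_le_bumpConst
  unfold arcConst; positivity

lemma ArcBounds.norm_waveTriple_le (hA : ArcBounds j P ν N) (hW : Window j P ν N s a) {r : ℕ}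
    (hr : 0 < r) {b : ℤ} (hb : IsUnit (b : ZMod r)) (hrN : (r : ℝ) ≤ N ^ (2/3 : ℝ)) {β : ℝ}
    (hβ : |β| ≤ 1 / (r * N ^ (2/3 : ℝ))) :
    ‖waveTriple s a (b / r + β)‖ ≤
      arcConst * (r : ℝ) ^ (-(9/4) : ℝ) * (1 / (1 + N * |β|) ^ 3) +
      2 * Real.exp (-(3/100) * logSize j) * ‖waveSum s a (b / r + β)‖ ^ 2 := by
  have hN := hW.one_le
  have hC := one_le_bumpConst
  obtain ⟨h1, h2⟩ := hA.norm_waveSum_le hW hr hb hrN hβ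
  have hr0 : (0 : ℝ) < r := by exact_mod_cast hr
  set E := Real.exp (-(3/100) * logSize j)
  set B := 24 * bumpConst * (r : ℝ) ^ (-(3/4) : ℝ) / (1 + N * |β|) with hB
  have hE : 0 < E := Real.exp_pos _
  have hab := abs_nonneg β
  have hB0 : 0 ≤ B := by positivity
  have hB3 : arcConst * (r : ℝ) ^ (-(9/4) : ℝ) * (1 / (1 + N * |β|) ^ 3) = 8 * B ^ 3 := by
    have : (r : ℝ) ^ (-(9/4) : ℝ) = ((r : ℝ) ^ (-(3/4) : ℝ)) ^ 3 := by
      rw [← Real.rpow_natCast, ← Real.rpow_mul hr0.le]; norm_num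
    rw [this, arcConst, hB]
    field_simp
  rw [hB3, waveTriple, norm_mul, norm_pow, RCLike.norm_conj]
  set u := ‖waveSum s a (b / r + β)‖
  set v := ‖waveSum s a (2 * (b / r + β))‖
  have hu : 0 ≤ u := norm_nonneg _
  have hv : 0 ≤ v := norm_nonneg _
  by_cases hBE : E ≤ B
  · calc u ^ 2 * v ≤ (2 * B) ^ 2 * (2 * B) := by
          gcongr <;> linarith
      _ = 8 * B ^ 3 := by ring
      _ ≤ _ := le_add_of_nonneg_right (by positivity)
  · calc u ^ 2 * v ≤ u ^ 2 * (2 * E) := by gcongr; linarith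
      _ = 2 * E * u ^ 2 := by ring
      _ ≤ _ := le_add_of_nonneg_left (by positivity)

lemma ArcBounds.norm_waveTriple_sub_le (hA : ArcBounds j P ν N) (hW : Window j P ν N s a) {r : ℕ}
    (hr : 0 < r) {b : ℤ} (hb : IsUnit (b : ZMod r)) (hrN : (r : ℝ) ≤ N ^ (2/3 : ℝ))
    (hrj : (r : ℝ) ≤ Real.exp (j / 4)) {β : ℝ} (hβ : |β| ≤ 1 / (r * N ^ (2/3 : ℝ))) :
    ‖waveTriple s a (b / r + β) - arcCoeff r * waveTriple s a β‖ ≤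
      3 * Real.exp (-(3/100) * logSize j) := by
  have hN := hW.one_le
  have hNp : 0 < N ^ (2/3 : ℝ) := by positivity
  have hr0 : (0 : ℝ) < r := by exact_mod_cast hr
  have : NeZero r := ⟨hr.ne'⟩
  have h1 := hA.norm_sub_le r b hb hrN hrj β (hβ.trans (by gcongr; norm_num))
  obtain ⟨c, hc, he⟩ := exists_two_mul_div_eq hr hb
  have hg : 0 < r.gcd 2 := Nat.gcd_pos_of_pos_left _ hr
  have hm : 0 < r / r.gcd 2 := Nat.div_pos (Nat.le_of_dvd hr (Nat.gcd_dvd_left _ _)) hg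
  have : NeZero (r / r.gcd 2) := ⟨hm.ne'⟩
  have hmr : ((r / r.gcd 2 : ℕ) : ℝ) ≤ r := by exact_mod_cast Nat.div_le_self _ _
  have hm0 : (0 : ℝ) < ((r / r.gcd 2 : ℕ) : ℝ) := by exact_mod_cast hm
  have h2 := hA.norm_sub_le (r / r.gcd 2) c hc (hmr.trans hrN) (hmr.trans hrj) (2 * β) (by
    rw [abs_mul, abs_two]
    calc 2 * |β| ≤ 2 * (1 / (r * N ^ (2/3 : ℝ))) := by gcongr
      _ = 2 / (r * N ^ (2/3 : ℝ)) := by ring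
      _ ≤ _ := by gcongr)
  rw [← he, ← mul_add] at h2
  simp only [hW.soup_eq_waveSum] at h1 h2
  rw [waveTriple, waveTriple, arcCoeff]
  set x := waveSum s a (b / r + β)
  set y := waveSum s a (2 * (b / r + β))
  set x' := ramCoeff r * waveSum s a β with hx'
  set y' := ramCoeff (r / r.gcd 2) * waveSum s a (2 * β) with hy'
  have hf := _root_.norm_waveSum_le hW.nonneg hW.sum_le
  have nx : ‖x‖ ≤ 1 := hf _
  have ny : ‖y‖ ≤ 1 := hf _
  have nx' : ‖x'‖ ≤ 1 := by
    rw [hx', norm_mul]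
    exact mul_le_one₀ (norm_ramCoeff_le_one _) (norm_nonneg _) (hf _)
  have e1 : x ^ 2 * conj y - ramCoeff r ^ 2 * conj (ramCoeff (r / r.gcd 2)) *
      (waveSum s a β ^ 2 * conj (waveSum s a (2 * β))) =
      (x - x') * (x + x') * conj y + x' ^ 2 * conj (y - y') := by
    rw [map_sub, hy', map_mul, hx']
    ring
  rw [e1]
  calc _ ≤ ‖(x - x') * (x + x') * conj y‖ + ‖x' ^ 2 * conj (y - y')‖ := norm_add_le _ _
    _ = ‖x - x'‖ * ‖x + x'‖ * ‖y‖ + ‖x'‖ ^ 2 * ‖y - y'‖ := by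
        rw [norm_mul, norm_mul, norm_mul, norm_pow, RCLike.norm_conj, RCLike.norm_conj]
    _ ≤ ‖x - x'‖ * 2 * 1 + 1 ^ 2 * ‖y - y'‖ := by
        gcongr
        exact (norm_add_le _ _).trans (by linarith)
    _ ≤ _ := by linarith

end arcs

/-- The circle method, abstractly: integration over finitely many disjoint arcs of equal length
on which `g` resembles a multiple of its restriction to the central arc. -/
lemma norm_integral_sub_le_of_arcs {ι : Type*} (A : Finset ι) (c : ι → ℝ) (w : ι → ℂ) {g : ℝ → ℂ}
    (hg : Continuous g) {Ω : Set ℝ} (hΩ : MeasurableSet Ω) (hΩ' : IntegrableOn g Ω)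
    {η e : ℝ} (hη : 0 ≤ η)
    (hsub : ∀ i ∈ A, Icc (c i - η) (c i + η) ⊆ Ω)
    (hdisj : ∀ i ∈ A, ∀ k ∈ A, i ≠ k → 2 * η < |c i - c k|)
    (harc : ∀ i ∈ A, ∀ β, |β| ≤ η → ‖g (c i + β) - w i * g β‖ ≤ e)
    {Ψ : ℝ → ℝ} (hΨ : IntegrableOn Ψ Ω) (hΨ0 : ∀ α, 0 ≤ Ψ α)
    (hoff : ∀ α ∈ Ω, (∀ i ∈ A, η < |α - c i|) → ‖g α‖ ≤ Ψ α) :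
    ‖(∫ α in Ω, g α) - (∑ i ∈ A, w i) * ∫ β in Icc (-η) η, g β‖ ≤
      A.card * (2 * η * e) + ∫ α in Ω, Ψ α := by
  set U := ⋃ i ∈ A, Icc (c i - η) (c i + η) with hU
  have hUm : MeasurableSet U := A.measurableSet_biUnion fun i _ => measurableSet_Icc
  have hUs : U ⊆ Ω := iUnion₂_subset hsub
  have hsplit : ∫ α in Ω, g α = (∫ α in U, g α) + ∫ α in Ω \ U, g α := by
    rw [← setIntegral_union disjoint_sdiff_right (hΩ.diff hUm) (hΩ'.mono_set hUs)
      (hΩ'.mono_set sdiff_subset), union_sdiff_cancel hUs]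
  have hUint : ∫ α in U, g α = ∑ i ∈ A, ∫ α in Icc (c i - η) (c i + η), g α := by
    refine integral_biUnion_finset A (fun i _ => measurableSet_Icc) (fun i hi k hk hik => ?_)
      fun i _ => hg.continuousOn.integrableOn_Icc
    refine Set.disjoint_left.2 fun x hx hx' => ?_
    have h := hdisj i hi k hk hik
    have : |c i - c k| ≤ 2 * η := by
      rw [abs_le]; constructor <;> linarith [hx.1, hx.2, hx'.1, hx'.2]
    linarith
  have hshift : ∀ i, ∫ α in Icc (c i - η) (c i + η), g α = ∫ β in Icc (-η) η, g (c i + β) := by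
    intro i
    rw [integral_Icc_eq_integral_Ioc, integral_Icc_eq_integral_Ioc,
      ← intervalIntegral.integral_of_le (by linarith),
      ← intervalIntegral.integral_of_le (by linarith),
      intervalIntegral.integral_comp_add_left (fun x => g x)]
    rfl
  have hmain : ‖(∫ α in U, g α) - (∑ i ∈ A, w i) * ∫ β in Icc (-η) η, g β‖ ≤
      A.card * (2 * η * e) := by
    rw [hUint, Finset.sum_mul, ← Finset.sum_sub_distrib, ← nsmul_eq_mul, ← Finset.sum_const]
    refine norm_sum_le_of_le _ fun i hi => ?_
    rw [hshift, ← integral_const_mul, ← integral_sub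
      (by fun_prop : Continuous fun β => g (c i + β)).continuousOn.integrableOn_Icc
      ((hg.continuousOn.integrableOn_Icc).const_mul _)]
    refine (norm_setIntegral_le_of_norm_le_const (C := e) (s := Icc (-η) η) (by simp) fun β hβ =>
      harc i hi β (abs_le.2 hβ)).trans (le_of_eq ?_)
    rw [measureReal_def, Real.volume_Icc, ENNReal.toReal_ofReal (by linarith)]
    ring
  have hrest : ‖∫ α in Ω \ U, g α‖ ≤ ∫ α in Ω, Ψ α := by
    calc ‖∫ α in Ω \ U, g α‖ ≤ ∫ α in Ω \ U, Ψ α := by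
          refine norm_integral_le_of_norm_le (hΨ.mono_set sdiff_subset)
            ((ae_restrict_iff' (hΩ.diff hUm)).2 (Eventually.of_forall fun α hα => ?_))
          refine hoff α hα.1 fun i hi => ?_
          by_contra! hc
          refine hα.2 (mem_iUnion₂.2 ⟨i, hi, ?_⟩)
          rw [abs_le] at hc
          exact ⟨by linarith [hc.1], by linarith [hc.2]⟩
      _ ≤ _ := setIntegral_mono_set hΨ (Eventually.of_forall hΨ0)
          (Eventually.of_forall sdiff_subset)
  rw [hsplit, add_sub_right_comm]
  exact (norm_add_le _ _).trans (add_le_add hmain hrest)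

end

noncomputable section
open Complex MeasureTheory Set Filter Topology Metric
open scoped ComplexConjugate

/-- The reduced fractions `b / r` in `[0, 1)` with `r ≤ R`, as pairs `⟨r, b⟩`. -/
def arcIndex (R : ℕ) : Finset (Σ _ : ℕ, ℕ) :=
  (Finset.Icc 1 R).sigma fun r => (Finset.range r).filter r.Coprime

lemma mem_arcIndex {R : ℕ} {i : Σ _ : ℕ, ℕ} :
    i ∈ arcIndex R ↔ 1 ≤ i.1 ∧ i.1 ≤ R ∧ i.2 < i.1 ∧ i.1.Coprime i.2 := by
  simp [arcIndex, and_assoc]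

lemma sum_arcIndex (R : ℕ) (w : ℕ → ℂ) :
    ∑ i ∈ arcIndex R, w i.1 = ∑ r ∈ Finset.Icc 1 R, (r.totient : ℂ) * w r := by
  rw [arcIndex, Finset.sum_sigma]
  refine Finset.sum_congr rfl fun r _ => ?_
  simp only [Finset.sum_const, nsmul_eq_mul, Nat.totient_eq_card_coprime]

lemma card_arcIndex_le (R : ℕ) : (arcIndex R).card ≤ R ^ 2 := by
  rw [arcIndex, Finset.card_sigma, sq]
  calc ∑ r ∈ Finset.Icc 1 R, ((Finset.range r).filter r.Coprime).card
      ≤ ∑ r ∈ Finset.Icc 1 R, R := Finset.sum_le_sum fun r hr =>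
        (Finset.card_filter_le _ _).trans (by simpa using (Finset.mem_Icc.1 hr).2)
    _ = R * R := by simp

lemma one_div_mul_le_abs_sub {R : ℕ} {i k : Σ _ : ℕ, ℕ} (hi : i ∈ arcIndex R)
    (hk : k ∈ arcIndex R) (hik : i ≠ k) :
    1 / (R : ℝ) ^ 2 ≤ |(i.2 : ℝ) / i.1 - (k.2 : ℝ) / k.1| := by
  obtain ⟨i1, iR, -, ic⟩ := mem_arcIndex.1 hi
  obtain ⟨k1, kR, -, kc⟩ := mem_arcIndex.1 hk
  have hi0 : (0 : ℝ) < i.1 := by exact_mod_cast i1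
  have hk0 : (0 : ℝ) < k.1 := by exact_mod_cast k1
  have hne : (i.2 : ℤ) * k.1 - i.1 * k.2 ≠ 0 := fun h => by
    have h1 : i.2 * k.1 = i.1 * k.2 := by exact_mod_cast sub_eq_zero.1 h
    have h2 : i.1 ∣ k.1 := ic.dvd_of_dvd_mul_left (Dvd.intro _ h1.symm)
    have h3 : k.1 ∣ i.1 := kc.dvd_of_dvd_mul_right (Dvd.intro_left _ h1)
    have h4 := Nat.dvd_antisymm h2 h3
    refine hik (Sigma.ext h4 (heq_of_eq ?_))
    rw [← h4, mul_comm] at h1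
    exact Nat.eq_of_mul_eq_mul_left i1 h1
  have h1 : (1 : ℝ) ≤ |(i.2 : ℝ) * k.1 - i.1 * k.2| := by exact_mod_cast Int.one_le_abs hne
  rw [div_sub_div _ _ hi0.ne' hk0.ne', abs_div, abs_of_pos (mul_pos hi0 hk0)]
  have h2 : (i.1 : ℝ) * k.1 ≤ (R : ℝ) ^ 2 := by
    rw [sq]
    have := Nat.mul_le_mul iR kR
    exact_mod_cast this
  gcongr

/-- The majorant of the integrand on the minor arcs. -/
def minorMajorant (N : ℝ) (n : ℕ) (α : ℝ) : ℝ :=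
  ∑ r ∈ Finset.Icc 1 n, ∑ b ∈ Finset.Icc (-(2 * r : ℤ)) (2 * r),
    (r : ℝ) ^ (-(203/100) : ℝ) * decay (N * (α - (b : ℝ) / r))

lemma minorMajorant_nonneg (N : ℝ) (n : ℕ) (α : ℝ) : 0 ≤ minorMajorant N n α :=
  Finset.sum_nonneg fun r _ => Finset.sum_nonneg fun b _ =>
    mul_nonneg (by positivity) (decay_nonneg _)

lemma integrable_minorMajorant {N : ℝ} (hN : 0 < N) (n : ℕ) : Integrable (minorMajorant N n) :=
  integrable_finsetSum _ fun _ _ => integrable_finsetSum _ fun _ _ =>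
    (integrable_decay_comp hN _).const_mul _

/-- A multiple of the total mass of `decay` bounding `N ∫ minorMajorant N n`. -/
def minorConst : ℝ := 5 * (∑' r : ℕ, (r : ℝ) ^ (-(103/100) : ℝ)) * decayMass

lemma integral_minorMajorant_le {N : ℝ} (hN : 0 < N) (n : ℕ) :
    ∫ α, minorMajorant N n α ≤ minorConst / N := by
  have hint : ∫ α, minorMajorant N n α = ∑ r ∈ Finset.Icc 1 n,
      ∑ b ∈ Finset.Icc (-(2 * r : ℤ)) (2 * r), (r : ℝ) ^ (-(203/100) : ℝ) * (decayMass / N) := by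
    unfold minorMajorant
    rw [integral_finsetSum _ fun r _ => integrable_finsetSum _ fun b _ =>
      (integrable_decay_comp hN _).const_mul _]
    refine Finset.sum_congr rfl fun r _ => ?_
    rw [integral_finsetSum _ fun b _ => (integrable_decay_comp hN _).const_mul _]
    refine Finset.sum_congr rfl fun b _ => ?_
    rw [integral_const_mul, integral_decay_comp hN]
  have hsum : Summable fun r : ℕ => (r : ℝ) ^ (-(103/100) : ℝ) :=
    Real.summable_nat_rpow.2 (by norm_num)
  have hd := decayMass_nonneg
  rw [hint]
  calc _ ≤ ∑ r ∈ Finset.Icc 1 n, 5 * (r : ℝ) ^ (-(103/100) : ℝ) * (decayMass / N) := by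
        refine Finset.sum_le_sum fun r hr => ?_
        have hr1 : 1 ≤ r := (Finset.mem_Icc.1 hr).1
        have hr0 : (0 : ℝ) < r := by exact_mod_cast hr1
        rw [Finset.sum_const, nsmul_eq_mul, ← mul_assoc]
        refine mul_le_mul_of_nonneg_right ?_ (by positivity)
        have h1 : (r : ℝ) ^ (-(103/100) : ℝ) = r * (r : ℝ) ^ (-(203/100) : ℝ) := by
          rw [← Real.rpow_one_add' hr0.le (by norm_num)]; norm_num
        rw [h1, ← mul_assoc]
        gcongr
        rw [Int.card_Icc]
        have : (2 * (r : ℤ) + 1 - -(2 * r)).toNat = 4 * r + 1 := by omega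
        rw [this]
        have : (1 : ℝ) ≤ r := by exact_mod_cast hr1
        push_cast
        linarith
    _ = 5 * (∑ r ∈ Finset.Icc 1 n, (r : ℝ) ^ (-(103/100) : ℝ)) * (decayMass / N) := by
        rw [Finset.mul_sum, Finset.sum_mul]
    _ ≤ 5 * (∑' r : ℕ, (r : ℝ) ^ (-(103/100) : ℝ)) * (decayMass / N) := by
        gcongr
        exact hsum.sum_le_tsum _ fun r _ => by positivity
    _ = _ := by rw [minorConst]; ring

section arcs

variable {j : ℕ} {P : Finset ℕ} {ν : ℕ → ℝ} {N : ℝ} {s : Finset ℕ} {a : ℕ → ℝ}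

lemma rpow_mul_one_div_pow_le {r : ℕ} (hr : 0 < r) {T : ℝ} (hT : 0 ≤ T) {j : ℕ}
    (h : Real.exp (j / 4) < r ∨ Real.exp j < T) :
    (r : ℝ) ^ (-(9/4) : ℝ) * (1 / (1 + T) ^ 3) ≤
      Real.exp (-(55/1000) * j) * ((r : ℝ) ^ (-(203/100) : ℝ) * decay T) := by
  have hr0 : (0 : ℝ) < r := by exact_mod_cast hr
  have hr1 : (1 : ℝ) ≤ r := by exact_mod_cast hr
  have h3 : 1 / (1 + T) ^ 3 = (1 + T) ^ (-(3/2) : ℝ) * decay T := by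
    rw [decay, abs_of_nonneg hT, ← Real.rpow_add (by positivity), one_div, ← Real.rpow_natCast,
      ← Real.rpow_neg (by positivity)]
    norm_num
  have h94 : (r : ℝ) ^ (-(9/4) : ℝ) = (r : ℝ) ^ (-(22/100) : ℝ) * (r : ℝ) ^ (-(203/100) : ℝ) := by
    rw [← Real.rpow_add hr0]; norm_num
  have hd := decay_nonneg T
  rw [h3, h94]
  have hkey : (r : ℝ) ^ (-(22/100) : ℝ) * (1 + T) ^ (-(3/2) : ℝ) ≤ Real.exp (-(55/1000) * j) := by
    have e1 : (r : ℝ) ^ (-(22/100) : ℝ) ≤ 1 := Real.rpow_le_one_of_one_le_of_nonpos hr1 (by norm_num)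
    have e2 : (1 + T) ^ (-(3/2) : ℝ) ≤ 1 :=
      Real.rpow_le_one_of_one_le_of_nonpos (by linarith) (by norm_num)
    rcases h with h | h
    · calc _ ≤ (Real.exp (j / 4)) ^ (-(22/100) : ℝ) * 1 := by
            refine mul_le_mul ?_ e2 (by positivity) (by positivity)
            exact Real.rpow_le_rpow_of_nonpos (Real.exp_pos _) h.le (by norm_num)
        _ = Real.exp (-(55/1000) * j) := by
            rw [mul_one, ← Real.exp_mul]; ring_nf
    · calc _ ≤ 1 * (Real.exp j) ^ (-(3/2) : ℝ) := by
            refine mul_le_mul e1 ?_ (by positivity) zero_le_one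
            exact Real.rpow_le_rpow_of_nonpos (Real.exp_pos _) (by linarith) (by norm_num)
        _ ≤ _ := by
            rw [one_mul, ← Real.exp_mul]
            refine Real.exp_le_exp.2 ?_
            have : (0 : ℝ) ≤ j := by positivity
            linarith
  calc _ = (r : ℝ) ^ (-(22/100) : ℝ) * (1 + T) ^ (-(3/2) : ℝ) *
        ((r : ℝ) ^ (-(203/100) : ℝ) * decay T) := by ring
    _ ≤ _ := by gcongr

lemma ArcBounds.norm_waveTriple_le_of_minor (hA : ArcBounds j P ν N) (hW : Window j P ν N s a)
    (hN : 4 * Real.exp (4 * j) ≤ N) {α : ℝ}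
    (hα : α ∈ Ico (-(Real.exp j / N)) (1 - Real.exp j / N))
    (hoff : ∀ i ∈ arcIndex ⌊Real.exp (j / 4)⌋₊, Real.exp j / N < |α - (i.2 : ℝ) / i.1|) :
    ‖waveTriple s a α‖ ≤ arcConst * Real.exp (-(55/1000) * j) *
        minorMajorant N ⌊N ^ (2/3 : ℝ)⌋₊ α +
      2 * Real.exp (-(3/100) * logSize j) * ‖waveSum s a α‖ ^ 2 := by
  have hN1 := hW.one_le
  have hN0 : 0 < N := by linarith
  set M := N ^ (2/3 : ℝ) with hM
  have hM1 : 1 ≤ M := Real.one_le_rpow hN1 (by norm_num)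
  obtain ⟨q, hq, hqn⟩ := Real.exists_rat_abs_sub_le_and_den_le α (Nat.floor_pos.2 hM1)
  set r := q.den with hr
  set b := q.num with hb
  have hr0 : 0 < r := q.den_pos
  have hrp : (0 : ℝ) < r := by exact_mod_cast hr0
  have hr1 : (1 : ℝ) ≤ r := by exact_mod_cast hr0
  have hrM : (r : ℝ) ≤ M := (Nat.cast_le.2 hqn).trans (Nat.floor_le (by linarith))
  have hqe : (q : ℝ) = (b : ℝ) / r := by rw [Rat.cast_def]
  have hco : IsUnit (b : ZMod r) := by
    rw [ZMod.coe_int_isUnit_iff_isCoprime, isCoprime_comm, Int.isCoprime_iff_gcd_eq_one]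
    exact q.reduced
  rw [hqe] at hq
  set β := α - (b : ℝ) / r with hβ
  have hαβ : α = (b : ℝ) / r + β := by rw [hβ]; ring
  have hq' : |β| ≤ 1 / (r * M) := by
    refine hq.trans ?_
    rw [mul_comm (_ + 1)]
    gcongr
    exact (Nat.lt_floor_add_one M).le
  have hβ1 : |β| ≤ 1 := hq'.trans (by
    rw [div_le_one (by positivity)]; nlinarith)
  set η := Real.exp j / N with hη
  have hη0 : 0 < η := by positivity
  have hjj : (0 : ℝ) ≤ j := by positivity
  have hη2 : 2 * η * Real.exp (j / 4) ≤ 1 / 2 := by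
    rw [hη, mul_div_assoc', div_mul_eq_mul_div, div_le_iff₀ hN0]
    have : Real.exp j * Real.exp (j / 4) ≤ Real.exp (4 * j) := by
      rw [← Real.exp_add]; exact Real.exp_le_exp.2 (by linarith)
    nlinarith [Real.exp_pos (4 * (j : ℝ))]
  have hη1 : η ≤ 1 := by
    have : 1 ≤ Real.exp ((j : ℝ) / 4) := Real.one_le_exp (by positivity)
    nlinarith
  have hcase : Real.exp (j / 4) < r ∨ Real.exp j < N * |β| := by
    by_contra! hc
    obtain ⟨c1, c2⟩ := hc
    have c2' : |β| ≤ η := by rw [hη, le_div_iff₀ hN0]; linarith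
    have h2 : 2 * η * r ≤ 1 / 2 := le_trans (by gcongr) hη2
    have hb0 : 0 ≤ b := by
      have h1 : -(2 * η) ≤ (b : ℝ) / r := by linarith [hα.1, (abs_le.1 c2').2]
      rw [le_div_iff₀ hrp] at h1
      have h3 : (-1 : ℝ) < b := by linarith
      have : (-1 : ℤ) < b := by exact_mod_cast h3
      omega
    have hbr : b < r := by
      have h1 : (b : ℝ) / r < 1 := by linarith [hα.2, (abs_le.1 c2').1]
      rw [div_lt_one hrp] at h1
      exact_mod_cast h1
    have hbn : ((b.natAbs : ℕ) : ℝ) = b := by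
      rw [← Int.cast_natCast, Int.natAbs_of_nonneg hb0]
    have := hoff ⟨r, b.natAbs⟩ (mem_arcIndex.2 ⟨hr0, Nat.le_floor c1, by dsimp only; omega,
      q.reduced.symm⟩)
    dsimp only at this
    rw [hbn] at this
    linarith
  have h1 := hA.norm_waveTriple_le hW hr0 hco hrM hq'
  rw [← hαβ] at h1
  refine h1.trans (add_le_add_left ?_ _)
  rw [mul_assoc, mul_assoc]
  refine mul_le_mul_of_nonneg_left ?_ arcConst_nonneg
  refine (rpow_mul_one_div_pow_le hr0 (by positivity) hcase).trans ?_
  refine mul_le_mul_of_nonneg_left ?_ (Real.exp_pos _).le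
  have hdec : decay (N * |β|) = decay (N * β) := by
    rw [decay, decay, abs_mul, abs_mul, abs_abs]
  rw [hdec, minorMajorant]
  have hbm : b ∈ Finset.Icc (-(2 * r : ℤ)) (2 * r) := by
    have h2 : |(b : ℝ) / r| ≤ 2 := by
      rw [abs_le] at hβ1 ⊢
      constructor <;> linarith [hα.1, hα.2, hβ1.1, hβ1.2]
    rw [abs_div, abs_of_pos hrp, div_le_iff₀ hrp] at h2
    have h3 : |b| ≤ 2 * (r : ℤ) := by exact_mod_cast h2
    exact Finset.mem_Icc.2 (abs_le.1 h3)
  refine le_trans ?_ (Finset.single_le_sum (f := fun r : ℕ =>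
    ∑ b ∈ Finset.Icc (-(2 * r : ℤ)) (2 * r),
      (r : ℝ) ^ (-(203/100) : ℝ) * decay (N * (α - (b : ℝ) / r))) (fun r _ =>
      Finset.sum_nonneg fun b _ => mul_nonneg (by positivity) (decay_nonneg _))
      (Finset.mem_Icc.2 ⟨hr0, hqn⟩))
  exact Finset.single_le_sum (f := fun b : ℤ =>
      (r : ℝ) ^ (-(203/100) : ℝ) * decay (N * (α - (b : ℝ) / r))) (fun b _ =>
      mul_nonneg (by positivity) (decay_nonneg _)) hbm

end arcs

end

noncomputable section
open Complex MeasureTheory Set Filter Topology Metric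
open scoped ComplexConjugate

/-- The weighted number of solutions of `x + y = 2 z`. -/
def tripleCount (s : Finset ℕ) (a : ℕ → ℝ) : ℝ :=
  ∑ p ∈ (s ×ˢ s) ×ˢ s with p.1.1 + p.1.2 = 2 * p.2, a p.1.1 * a p.1.2 * a p.2

section arcs

variable {j : ℕ} {P : Finset ℕ} {ν : ℕ → ℝ} {N : ℝ} {s : Finset ℕ} {a : ℕ → ℝ}

lemma continuous_waveSum : Continuous (waveSum s a) := continuous_trigSum _ _ _

lemma Window.sum_sq_le (hW : Window j P ν N s a) :
    ∑ n ∈ s, a n ^ 2 ≤ Real.exp (4/1000 * logSize j) / N := by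
  have hN : 0 < N := by linarith [hW.one_le]
  calc ∑ n ∈ s, a n ^ 2 ≤ ∑ n ∈ s, Real.exp (4/1000 * logSize j) / N * a n :=
        Finset.sum_le_sum fun n hn => by
          rw [sq]; exact mul_le_mul_of_nonneg_right (hW.le_div n hn) (hW.nonneg n)
    _ = Real.exp (4/1000 * logSize j) / N * ∑ n ∈ s, a n := by rw [Finset.mul_sum]
    _ ≤ Real.exp (4/1000 * logSize j) / N * 1 := by gcongr; exact hW.sum_le
    _ = _ := mul_one _

lemma exp_mul_le_rpow (hN : 4 * Real.exp (4 * j) ≤ N) {x y : ℝ} (hy : 0 ≤ y) (hxy : x ≤ 4 * y) :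
    Real.exp (x * j) ≤ N ^ y := by
  have h1 : Real.exp (4 * j) ≤ N := by linarith [Real.exp_pos (4 * (j : ℝ))]
  calc Real.exp (x * j) ≤ Real.exp (4 * j * y) := by
        refine Real.exp_le_exp.2 ?_
        nlinarith [(Nat.cast_nonneg j : (0 : ℝ) ≤ j)]
    _ = (Real.exp (4 * j)) ^ y := Real.exp_mul _ _
    _ ≤ N ^ y := Real.rpow_le_rpow (Real.exp_pos _).le h1 hy

lemma exp_div_le_one_div (hN : 4 * Real.exp (4 * j) ≤ N) {r : ℕ} (hr : 0 < r)
    (hrj : (r : ℝ) ≤ Real.exp (j / 4)) :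
    Real.exp j / N ≤ 1 / (r * N ^ (2/3 : ℝ)) := by
  have hN0 : 0 < N := by linarith [Real.exp_pos (4 * (j : ℝ))]
  have hr0 : (0 : ℝ) < r := by exact_mod_cast hr
  have h1 := exp_mul_le_rpow hN (x := 5/4) (y := 1/3) (by norm_num) (by norm_num)
  have h2 : N ^ (1/3 : ℝ) * N ^ (2/3 : ℝ) = N := by
    rw [← Real.rpow_add hN0]; norm_num
  rw [div_le_div_iff₀ hN0 (by positivity), one_mul]
  calc Real.exp j * (r * N ^ (2/3 : ℝ)) ≤ Real.exp j * (Real.exp (j / 4) * N ^ (2/3 : ℝ)) := by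
        gcongr
    _ = Real.exp (5/4 * j) * N ^ (2/3 : ℝ) := by
        rw [← mul_assoc, ← Real.exp_add]; ring_nf
    _ ≤ N ^ (1/3 : ℝ) * N ^ (2/3 : ℝ) := by gcongr
    _ = N := h2

lemma ArcBounds.norm_tripleCount_sub_le (hA : ArcBounds j P ν N) (hW : Window j P ν N s a)
    (hN : 4 * Real.exp (4 * j) ≤ N) :
    ‖(tripleCount s a : ℂ) - (∑ r ∈ Finset.Icc 1 ⌊Real.exp (j / 4)⌋₊, (r.totient : ℂ) * arcCoeff r) *
      ∫ β in Icc (-(Real.exp j / N)) (Real.exp j / N), waveTriple s a β‖ ≤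
      (6 * Real.exp (-(3/100) * logSize j) * Real.exp (3/2 * j) +
        arcConst * Real.exp (-(55/1000) * j) * minorConst +
        2 * Real.exp (-(3/100) * logSize j) * Real.exp (4/1000 * logSize j)) / N := by
  set η := Real.exp j / N with hη
  set E := Real.exp (-(3/100) * logSize j) with hE
  set R := ⌊Real.exp ((j : ℝ) / 4)⌋₊ with hR
  have hE0 : 0 < E := Real.exp_pos _
  have hN0 : 0 < N := by linarith [Real.exp_pos (4 * (j : ℝ))]
  have hη0 : 0 < η := by positivity
  have hjj : (0 : ℝ) ≤ j := by positivity
  have hRle : (R : ℝ) ≤ Real.exp (j / 4) := Nat.floor_le (Real.exp_pos _).le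
  have hηR : 2 * η * Real.exp (j / 2) ≤ 1 / 2 := by
    rw [hη, mul_div_assoc', div_mul_eq_mul_div, div_le_iff₀ hN0]
    have : Real.exp j * Real.exp (j / 2) ≤ Real.exp (4 * j) := by
      rw [← Real.exp_add]; exact Real.exp_le_exp.2 (by linarith)
    nlinarith [Real.exp_pos (4 * (j : ℝ))]
  have hR2 : (R : ℝ) ^ 2 ≤ Real.exp (j / 2) := by
    calc (R : ℝ) ^ 2 ≤ Real.exp (j / 4) ^ 2 := by gcongr
      _ = Real.exp (j / 2) := by rw [← Real.exp_nat_mul]; push_cast; ring_nf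
  have hint : tripleCount s a = ∫ α in Ico (-η) (1 - η), waveTriple s a α := by
    rw [integral_Ico_eq_integral_Ioc, ← intervalIntegral.integral_of_le (by linarith),
      show 1 - η = -η + 1 by ring, integral_waveTriple]
    rfl
  have hcoe : ∀ i ∈ arcIndex R, (i.1 : ℝ) ≤ Real.exp (j / 4) := fun i hi =>
    (Nat.cast_le.2 (mem_arcIndex.1 hi).2.1).trans hRle
  have hgc := continuous_waveTriple (s := s) (a := a)
  have hfc : Continuous fun α => ‖waveSum s a α‖ ^ 2 := continuous_waveSum.norm.pow 2
  have hi1 : IntegrableOn (fun α => arcConst * Real.exp (-(55/1000) * j) *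
      minorMajorant N ⌊N ^ (2/3 : ℝ)⌋₊ α) (Ico (-η) (1 - η)) :=
    ((integrable_minorMajorant hN0 _).const_mul _).integrableOn
  have hi2 : IntegrableOn (fun α => 2 * E * ‖waveSum s a α‖ ^ 2) (Ico (-η) (1 - η)) :=
    ((hfc.continuousOn.integrableOn_Icc).mono_set Ico_subset_Icc_self).const_mul _
  have key := norm_integral_sub_le_of_arcs (arcIndex R) (fun i => (i.2 : ℝ) / i.1)
    (fun i => arcCoeff i.1) hgc (Ω := Ico (-η) (1 - η)) measurableSet_Ico
    ((hgc.continuousOn.integrableOn_Icc).mono_set Ico_subset_Icc_self) (η := η) (e := 3 * E)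
    hη0.le (fun i hi x hx => by
      obtain ⟨i1, iR, ib, -⟩ := mem_arcIndex.1 hi
      have hi0 : (0 : ℝ) < i.1 := by exact_mod_cast i1
      have h1 : (0 : ℝ) ≤ (i.2 : ℝ) / i.1 := by positivity
      have h2 : (i.2 : ℝ) / i.1 ≤ 1 - 1 / i.1 := by
        rw [div_le_iff₀ hi0, sub_mul, one_div, inv_mul_cancel₀ hi0.ne', one_mul]
        have : (i.2 : ℝ) + 1 ≤ i.1 := by exact_mod_cast ib
        linarith
      have h3 : 2 * η < 1 / i.1 := by
        rw [lt_div_iff₀ hi0]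
        have h4 : (i.1 : ℝ) ≤ Real.exp (j / 2) :=
          (hcoe i hi).trans (Real.exp_le_exp.2 (by linarith))
        have : 2 * η * i.1 ≤ 2 * η * Real.exp (j / 2) := by gcongr
        linarith
      exact ⟨by linarith [hx.1], by linarith [hx.2]⟩)
    (fun i hi k hk hik => by
      refine lt_of_lt_of_le ?_ (one_div_mul_le_abs_sub hi hk hik)
      have hR0 : (0 : ℝ) < R := by
        have := (mem_arcIndex.1 hi).1.trans (mem_arcIndex.1 hi).2.1
        exact_mod_cast this
      rw [lt_div_iff₀ (by positivity)]
      have : 2 * η * (R : ℝ) ^ 2 ≤ 2 * η * Real.exp (j / 2) := by gcongr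
      linarith)
    (fun i hi β hβ => by
      obtain ⟨i1, iR, ib, ic⟩ := mem_arcIndex.1 hi
      have hrj := hcoe i hi
      have h1 := hA.norm_waveTriple_sub_le hW i1 (b := (i.2 : ℤ))
        (by rw [ZMod.coe_int_isUnit_iff_isCoprime]; exact Nat.isCoprime_iff_coprime.2 ic)
        (hrj.trans (by
          have := exp_mul_le_rpow hN (x := 1/4) (y := 2/3) (by norm_num) (by norm_num)
          rwa [one_div_mul_eq_div] at this)) hrj
        (hβ.trans (exp_div_le_one_div hN i1 hrj))
      rwa [Int.cast_natCast] at h1)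
    (hi1.add hi2)
    (fun α => add_nonneg (mul_nonneg (mul_nonneg arcConst_nonneg (Real.exp_pos _).le)
      (minorMajorant_nonneg _ _ _)) (by positivity))
    (fun α hα hoff => hA.norm_waveTriple_le_of_minor hW hN hα hoff)
  rw [← hint, sum_arcIndex] at key
  refine key.trans ?_
  have hint2 : ∫ α in Ico (-η) (1 - η), ‖waveSum s a α‖ ^ 2 ≤
      Real.exp (4/1000 * logSize j) / N := by
    rw [integral_Ico_eq_integral_Ioc, ← intervalIntegral.integral_of_le (by linarith),
      show 1 - η = -η + 1 by ring, integral_norm_waveSum_sq]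
    exact hW.sum_sq_le
  have hint3 : ∫ α in Ico (-η) (1 - η), minorMajorant N ⌊N ^ (2/3 : ℝ)⌋₊ α ≤ minorConst / N :=
    (setIntegral_le_integral (integrable_minorMajorant hN0 _)
      (Eventually.of_forall fun α => minorMajorant_nonneg _ _ _)).trans
      (integral_minorMajorant_le hN0 _)
  have hΨ : ∫ α in Ico (-η) (1 - η), (((fun α => arcConst * Real.exp (-(55/1000) * j) *
      minorMajorant N ⌊N ^ (2/3 : ℝ)⌋₊ α) + fun α => 2 * E * ‖waveSum s a α‖ ^ 2) : ℝ → ℝ) α ≤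
      arcConst * Real.exp (-(55/1000) * j) * (minorConst / N) +
        2 * E * (Real.exp (4/1000 * logSize j) / N) := by
    rw [integral_add' hi1 hi2, integral_const_mul, integral_const_mul]
    have := arcConst_nonneg
    gcongr
  have hcard : ((arcIndex R).card : ℝ) * (2 * η * (3 * E)) ≤
      6 * E * Real.exp (3/2 * j) / N := by
    calc ((arcIndex R).card : ℝ) * (2 * η * (3 * E))
        ≤ Real.exp (j / 2) * (2 * η * (3 * E)) := by
          gcongr
          refine le_trans ?_ hR2
          exact_mod_cast card_arcIndex_le R
      _ = 6 * E * (Real.exp (j / 2) * Real.exp j) / N := by rw [hη]; ring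
      _ = _ := by rw [← Real.exp_add]; ring_nf
  calc _ ≤ 6 * E * Real.exp (3/2 * j) / N + (arcConst * Real.exp (-(55/1000) * j) *
        (minorConst / N) + 2 * E * (Real.exp (4/1000 * logSize j) / N)) := add_le_add hcard hΨ
    _ = _ := by ring

lemma ArcBounds.norm_centralIntegral_sub_le (hA : ArcBounds j P ν N) (hW : Window j P ν N s a)
    (hN : 4 * Real.exp (4 * j) ≤ N) :
    ‖(∫ β in Icc (-(Real.exp j / N)) (Real.exp j / N), waveTriple s a β) -
      (smoothedCount s a (Real.exp (3/100 * j) / N) : ℂ)‖ ≤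
      ((4 * arcConst * Real.exp (-(45/1000) * j) + 4 * Real.exp (-(44/100) * j)) * decayMass +
        4 * Real.exp (-(3/100) * logSize j) * Real.exp j) / N := by
  have hN0 : 0 < N := by linarith [Real.exp_pos (4 * (j : ℝ))]
  have hjj : (0 : ℝ) ≤ j := by positivity
  have hτ : Real.exp (j / 2) ^ 2 = Real.exp j := by
    rw [← Real.exp_nat_mul]; push_cast; ring_nf
  have hh : Real.exp (15/1000 * j) ^ 2 = Real.exp (3/100 * j) := by
    rw [← Real.exp_nat_mul]; push_cast; ring_nf
  have key := _root_.norm_integral_waveTriple_sub_le hW.nonneg hW.sum_le hN0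
    (h := Real.exp (15/1000 * j)) (τ := Real.exp (j / 2)) (K := arcConst)
    (E := 2 * Real.exp (-(3/100) * logSize j)) (Real.exp_pos _)
    (Real.one_le_exp (by positivity)) arcConst_nonneg (by positivity) (fun β hβ => by
      rw [hτ] at hβ
      have h1 := hA.norm_waveTriple_le hW one_pos (b := 0) (by
          rw [ZMod.coe_int_isUnit_iff_isCoprime]; exact isCoprime_one_left)
        (by rw [Nat.cast_one]; exact Real.one_le_rpow hW.one_le (by norm_num))
        (hβ.trans (exp_div_le_one_div hN one_pos
          (by rw [Nat.cast_one]; exact Real.one_le_exp (by positivity))))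
      simp only [Int.cast_zero, zero_div, zero_add, Nat.cast_one, Real.one_rpow, mul_one] at h1
      refine h1.trans (add_le_add_right ?_ _)
      have h2 := _root_.norm_waveSum_le hW.nonneg hW.sum_le β
      calc _ ≤ 2 * Real.exp (-(3/100) * logSize j) * 1 := by
            gcongr
            exact pow_le_one₀ (norm_nonneg _) h2
        _ = _ := mul_one _)
  rw [hτ, hh] at key
  refine key.trans (le_of_eq ?_)
  have e1 : 4 * arcConst / Real.exp (15/1000 * j) ^ 3 =
      4 * arcConst * Real.exp (-(45/1000) * j) := by
    rw [← Real.exp_nat_mul, div_eq_mul_inv, ← Real.exp_neg]; push_cast; ring_nf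
  have e2 : 4 * Real.exp (15/1000 * j) ^ 4 / Real.exp (j / 2) =
      4 * Real.exp (-(44/100) * j) := by
    rw [← Real.exp_nat_mul, mul_div_assoc, ← Real.exp_sub]; push_cast; ring_nf
  rw [e1, e2]
  ring

lemma ArcBounds.le_tripleCount (hA : ArcBounds j P ν N) (hW : Window j P ν N s a)
    (hN : 4 * Real.exp (4 * j) ≤ N) (hj : 4 ≤ j) (hL : 100 * j ≤ logSize j) :
    (7/10 * (Real.exp (-4 * Real.pi) / 16) * Real.exp (-(39/1000) * j) -
      (33/10 * (4 * (arcConst + 1) * decayMass + 4) + arcConst * minorConst + 8) *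
        Real.exp (-(45/1000) * j)) / N ≤ tripleCount s a := by
  have hN0 : 0 < N := by linarith [Real.exp_pos (4 * (j : ℝ))]
  have hjj : (0 : ℝ) ≤ j := by positivity
  have h1 := hA.norm_tripleCount_sub_le hW hN
  have h2 := hA.norm_centralIntegral_sub_le hW hN
  have hR : 2 ≤ ⌊Real.exp ((j : ℝ) / 4)⌋₊ := by
    refine Nat.le_floor ?_
    have : (1 : ℝ) ≤ (j : ℝ) / 4 := by
      have : (4 : ℝ) ≤ j := by exact_mod_cast hj
      linarith
    have h3 := Real.add_one_le_exp ((j : ℝ) / 4)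
    push_cast
    linarith
  have h3 := norm_sum_arcCoeff_sub_two_le hR
  have h4 := le_smoothedCount hW.nonneg hN0 (H := Real.exp (3/100 * j))
    (Real.one_le_exp (by positivity)) hW.le_mul_three
  set C := ∑ r ∈ Finset.Icc 1 ⌊Real.exp ((j : ℝ) / 4)⌋₊, (r.totient : ℂ) * arcCoeff r
  set M := ∫ β in Icc (-(Real.exp j / N)) (Real.exp j / N), waveTriple s a β
  set G := smoothedCount s a (Real.exp (3/100 * j) / N)
  set S := tripleCount s a
  set x := Real.exp (-(45/1000) * (j : ℝ)) with hx
  have hd := decayMass_nonneg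
  have hm : 0 ≤ minorConst := by
    unfold minorConst
    have : 0 ≤ ∑' r : ℕ, (r : ℝ) ^ (-(103/100) : ℝ) := tsum_nonneg fun r => by positivity
    positivity
  have hK := arcConst_nonneg
  have hexp : ∀ c d : ℝ, c ≤ d → Real.exp (c * j) ≤ Real.exp (d * j) := fun c d h =>
    Real.exp_le_exp.2 (by nlinarith)
  have hE1 : Real.exp (-(3/100) * logSize j) * Real.exp (3/2 * j) ≤ x := by
    rw [← Real.exp_add, hx]; exact Real.exp_le_exp.2 (by linarith)
  have hE2 : Real.exp (-(3/100) * logSize j) * Real.exp (4/1000 * logSize j) ≤ x := by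
    rw [← Real.exp_add, hx]; exact Real.exp_le_exp.2 (by linarith)
  have hE3 : Real.exp (-(3/100) * logSize j) * Real.exp j ≤ x := by
    rw [← Real.exp_add, hx]; exact Real.exp_le_exp.2 (by linarith)
  have hC : ‖C‖ ≤ 33/10 := by
    calc ‖C‖ = ‖(C - 2) + 2‖ := by rw [sub_add_cancel]
      _ ≤ ‖C - 2‖ + ‖(2 : ℂ)‖ := norm_add_le _ _
      _ ≤ 33/10 := by rw [Complex.norm_ofNat]; linarith
  have hG : Real.exp (-4 * Real.pi) / 16 * Real.exp (-(39/1000) * j) / N ≤ G := by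
    refine le_trans ?_ h4
    calc Real.exp (-4 * Real.pi) / 16 * Real.exp (-(39/1000) * j) / N
        = Real.exp (-4 * Real.pi) * (Real.exp (-(3/1000) * j)) ^ 3 /
          (16 * Real.exp (3/100 * j) * N) := by
          rw [← Real.exp_nat_mul, eq_div_iff (by positivity)]
          have : Real.exp ((3 : ℕ) * (-(3/1000) * j)) =
              Real.exp (-(39/1000) * j) * Real.exp (3/100 * j) := by
            rw [← Real.exp_add]; push_cast; ring_nf
          rw [this]
          field_simp
      _ ≤ _ := by gcongr; exact hW.le_sum
  have hG0 : 0 ≤ G := le_trans (by positivity) hG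
  have h1' : ‖(S : ℂ) - C * M‖ ≤ (arcConst * minorConst + 8) * x / N := by
    refine h1.trans ?_
    gcongr
    have := hexp (-(55/1000)) (-(45/1000)) (by norm_num)
    have h5 : arcConst * Real.exp (-(55/1000) * j) * minorConst ≤ arcConst * x * minorConst := by
      gcongr
    linarith
  have h2' : ‖M - G‖ ≤ (4 * (arcConst + 1) * decayMass + 4) * x / N := by
    refine h2.trans ?_
    gcongr
    have := hexp (-(44/100)) (-(45/1000)) (by norm_num)
    have h5 : (4 * arcConst * x + 4 * Real.exp (-(44/100) * j)) * decayMass ≤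
        (4 * arcConst * x + 4 * x) * decayMass := by
      gcongr
    linarith
  have hre : (S : ℝ) = ((S : ℂ) - C * M).re + (C * (M - G)).re + ((C - 2) * G).re + 2 * G := by
    have : (S : ℂ) = ((S : ℂ) - C * M) + C * (M - G) + (C - 2) * G + 2 * G := by ring
    have h := congrArg Complex.re this
    simpa using h
  have b1 := (abs_le.1 (abs_re_le_norm ((S : ℂ) - C * M))).1
  have b2 := (abs_le.1 (abs_re_le_norm (C * (M - G)))).1
  have b3 := (abs_le.1 (abs_re_le_norm ((C - 2) * (G : ℂ)))).1
  rw [norm_mul] at b2 b3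
  rw [norm_real, Real.norm_eq_abs, abs_of_nonneg hG0] at b3
  have b2' : ‖C‖ * ‖M - G‖ ≤ 33/10 * ((4 * (arcConst + 1) * decayMass + 4) * x / N) := by gcongr
  have b3' : ‖C - 2‖ * G ≤ 13/10 * G := by gcongr
  have : (7/10 * (Real.exp (-4 * Real.pi) / 16) * Real.exp (-(39/1000) * j) -
      (33/10 * (4 * (arcConst + 1) * decayMass + 4) + arcConst * minorConst + 8) * x) / N =
      7/10 * (Real.exp (-4 * Real.pi) / 16 * Real.exp (-(39/1000) * j) / N) -
      33/10 * ((4 * (arcConst + 1) * decayMass + 4) * x / N) -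
      (arcConst * minorConst + 8) * x / N := by ring
  rw [this]
  linarith

end arcs

end

noncomputable section
open Complex MeasureTheory Set Filter Topology Metric

lemma eventually_le_tripleCount : ∀ᶠ j : ℕ in atTop, ∀ P ν N s a, ArcBounds j P ν N →
    Window j P ν N s a → Real.exp (-(40/1000) * j) / N ≤ tripleCount s a := by
  set c := 7/10 * (Real.exp (-4 * Real.pi) / 16) with hc
  have hc0 : 0 < c := by positivity
  set b := 33/10 * (4 * (arcConst + 1) * decayMass + 4) + arcConst * minorConst + 8 with hb
  filter_upwards [eventually_mul_exp_le (2 * |b| / c) 0 (c := 6/1000) (d := 0) (by norm_num),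
    eventually_linear_le (2 / c) 0 (c := 1/1000) (by norm_num),
    eventually_linear_le 100 0 (c := 1/1000) (by norm_num),
    eventually_le_exp_logSize 2 (c := 5/100) (by norm_num), eventually_ge_atTop 4]
    with j h1 h2 h3 h4 hj P ν N s a hA hW
  have hL : 100 * (j : ℝ) ≤ logSize j := by
    have h5 := exp_le_numFactors j
    rw [zero_mul, add_zero] at h3
    have h6 : (1/1000 : ℝ) * j = j / 1000 := by ring
    rw [h6] at h3
    rw [logSize, mul_comm]
    gcongr
    exact h3.trans h5
  have hN : 4 * Real.exp (4 * j) ≤ N := by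
    refine le_trans ?_ hW.exp_le
    have h5 : (4 : ℝ) ≤ Real.exp (5/100 * logSize j) ^ 2 := by nlinarith
    calc 4 * Real.exp (4 * j) ≤ Real.exp (5/100 * logSize j) ^ 2 * Real.exp (4 * j) := by gcongr
      _ = Real.exp (1/10 * logSize j + 4 * j) := by
        rw [← Real.exp_nat_mul, ← Real.exp_add]; push_cast; ring_nf
      _ ≤ _ := Real.exp_le_exp.2 (by linarith)
  refine le_trans ?_ (hA.le_tripleCount hW hN hj hL)
  have hN0 : 0 < N := lt_of_lt_of_le (by positivity) hN
  gcongr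
  have e1 : Real.exp (-(45/1000) * j) = Real.exp (-(6/1000) * j) * Real.exp (-(39/1000) * j) := by
    rw [← Real.exp_add]; ring_nf
  have e2 : Real.exp (-(40/1000) * j) * Real.exp (1/1000 * j) = Real.exp (-(39/1000) * j) := by
    rw [← Real.exp_add]; ring_nf
  rw [zero_mul, add_zero, div_mul_eq_mul_div, neg_zero, zero_mul, Real.exp_zero,
    div_le_one hc0] at h1
  rw [zero_mul, add_zero, div_le_iff₀ hc0] at h2
  rw [e1]
  have h5 : b * Real.exp (-(6/1000) * j) ≤ c / 2 := by
    have := mul_le_mul_of_nonneg_right (le_abs_self b) (Real.exp_pos (-(6/1000) * (j : ℝ))).le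
    linarith
  have h6 : Real.exp (-(40/1000) * j) ≤ c / 2 * Real.exp (-(39/1000) * j) := by
    rw [← e2]
    have := mul_le_mul_of_nonneg_left h2 (Real.exp_pos (-(40/1000) * (j : ℝ))).le
    nlinarith
  have h7 := mul_le_mul_of_nonneg_right h5 (Real.exp_pos (-(39/1000) * (j : ℝ))).le
  rw [← hc, ← hb, ← mul_assoc]
  linarith

lemma Window.tripleCount_le {j : ℕ} {P : Finset ℕ} {ν : ℕ → ℝ} {N : ℝ} {s : Finset ℕ} {a : ℕ → ℝ}
    (hW : Window j P ν N s a) {D : ℕ}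
    (hD : ∀ x ∈ s, ∀ y ∈ s, ∀ z ∈ s, x + y = 2 * z → (x + y) / x.gcd y < D) :
    tripleCount s a ≤ (D : ℝ) ^ 2 * (4 * N) * (Real.exp (4/1000 * logSize j) / N) ^ 3 := by
  have hN := hW.one_le
  have hpos : ∀ n ∈ s, 0 < n := fun n hn => by
    have := hW.le_three_mul n hn
    have : (0 : ℝ) < n := by linarith
    exact_mod_cast this
  rw [tripleCount]
  set F := ((s ×ˢ s) ×ˢ s).filter (fun p => p.1.1 + p.1.2 = 2 * p.2) with hF
  have hcard : F.card ≤ (((Finset.range D) ×ˢ (Finset.range D)) ×ˢ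
      (Finset.range (⌊3 * N⌋₊ + 1))).card := by
    refine Finset.card_le_card_of_injOn
      (fun p => ((p.1.1 / p.1.1.gcd p.1.2, p.1.2 / p.1.1.gcd p.1.2), p.1.1.gcd p.1.2)) ?_ ?_
    · rintro ⟨⟨x, y⟩, z⟩ hp
      simp only [hF, Finset.coe_filter, Finset.mem_product, mem_ofPred_eq] at hp
      obtain ⟨⟨⟨hx, hy⟩, hz⟩, he⟩ := hp
      have h1 := hD x hx y hy z hz he
      have h2 : x / x.gcd y ≤ (x + y) / x.gcd y := Nat.div_le_div_right (by omega)
      have h3 : y / x.gcd y ≤ (x + y) / x.gcd y := Nat.div_le_div_right (by omega)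
      simp only [Finset.coe_product, Set.mem_prod, Finset.coe_range, mem_Iio]
      refine ⟨⟨by omega, by omega⟩, Nat.lt_succ_of_le (Nat.le_floor ?_)⟩
      refine le_trans ?_ (hW.le_mul_three x hx)
      exact_mod_cast Nat.gcd_le_left y (hpos x hx)
    · rintro ⟨⟨x, y⟩, z⟩ hp ⟨⟨x', y'⟩, z'⟩ hp' h
      simp only [hF, Finset.coe_filter, Finset.mem_product, mem_ofPred_eq] at hp hp'
      simp only [Prod.mk.injEq] at h
      obtain ⟨⟨h1, h2⟩, h3⟩ := h
      have e1 := Nat.div_mul_cancel (Nat.gcd_dvd_left x y)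
      have e2 := Nat.div_mul_cancel (Nat.gcd_dvd_right x y)
      rw [h1, h3, Nat.div_mul_cancel (Nat.gcd_dvd_left x' y')] at e1
      rw [h2, h3, Nat.div_mul_cancel (Nat.gcd_dvd_right x' y')] at e2
      have := hp.2
      have := hp'.2
      simp only [Prod.mk.injEq]
      refine ⟨⟨by omega, by omega⟩, by omega⟩
  rw [Finset.card_product, Finset.card_product, Finset.card_range, Finset.card_range] at hcard
  have hcard' : (F.card : ℝ) ≤ D ^ 2 * (4 * N) := by
    calc (F.card : ℝ) ≤ ((D * D * (⌊3 * N⌋₊ + 1) : ℕ) : ℝ) := by exact_mod_cast hcard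
      _ = D ^ 2 * (⌊3 * N⌋₊ + 1) := by push_cast; ring
      _ ≤ _ := by
        have := Nat.floor_le (show 0 ≤ 3 * N by linarith)
        gcongr
        linarith
  calc _ ≤ ∑ p ∈ F, (Real.exp (4/1000 * logSize j) / N) ^ 3 := by
        refine Finset.sum_le_sum fun p hp => ?_
        simp only [hF, Finset.mem_filter, Finset.mem_product] at hp
        have h0 : 0 ≤ Real.exp (4/1000 * logSize j) / N := by positivity
        rw [pow_three, ← mul_assoc]
        exact mul_le_mul (mul_le_mul (hW.le_div _ hp.1.1.1) (hW.le_div _ hp.1.1.2)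
          (hW.nonneg _) h0) (hW.le_div _ hp.1.2) (hW.nonneg _) (by positivity)
    _ = F.card * (Real.exp (4/1000 * logSize j) / N) ^ 3 := by
        rw [Finset.sum_const, nsmul_eq_mul]
    _ ≤ _ := by gcongr

/-- There are smooth solutions of large height. -/
lemma GRH.eventually_exists_coprime (h : GRH) : ∀ᶠ j : ℕ in atTop, ∃ x y : ℕ,
    0 < x ∧ 0 < y ∧ x.Coprime y ∧ Real.exp (1/100 * logSize j) ≤ (x + y : ℕ) ∧
    ∀ p : ℕ, p.Prime → p ∣ x * y * (x + y) → (p : ℝ) ≤ Real.exp (4 * j) := by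
  filter_upwards [h.exists_goodWeight, eventually_exists_window, eventually_arcBounds,
    eventually_le_tripleCount, eventually_le_exp_logSize 17 (c := 1/100) (by norm_num),
    eventually_ge_atTop 1] with j ⟨P, ν, hG⟩ hwin harc htri h17 hj
  obtain ⟨N, s, a, hW⟩ := hwin P ν hG
  have hN := hW.one_le
  have hT := htri P ν N s a (harc P ν N hG hN hW.le_exp) hW
  have hpos : ∀ n ∈ s, 0 < n := fun n hn => by
    have := hW.le_three_mul n hn
    have : (0 : ℝ) < n := by linarith
    exact_mod_cast this
  obtain ⟨x, hx, y, hy, z, hz, he, hD⟩ : ∃ x ∈ s, ∃ y ∈ s, ∃ z ∈ s, x + y = 2 * z ∧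
      ⌈Real.exp (1/100 * logSize j)⌉₊ ≤ (x + y) / x.gcd y := by
    by_contra! hcon
    have hU := hW.tripleCount_le hcon
    have hE : 1 ≤ Real.exp (1/100 * logSize j) :=
      Real.one_le_exp (mul_nonneg (by norm_num) ((Nat.cast_nonneg j).trans (le_logSize j)))
    have hc : (⌈Real.exp (1/100 * logSize j)⌉₊ : ℝ) ≤ 2 * Real.exp (1/100 * logSize j) := by
      have := (Nat.ceil_lt_add_one (Real.exp_pos (1/100 * logSize j)).le).le
      linarith
    set E := Real.exp (1/100 * logSize j) with hEdef
    have h1 := hT.trans hU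
    have h2 : Real.exp (-(40/1000) * j) ≤ 16 * E ^ 2 * Real.exp (4/1000 * logSize j) ^ 3 / N := by
      rw [div_le_iff₀ (by positivity)] at h1
      refine h1.trans ?_
      calc _ ≤ (2 * E) ^ 2 * (4 * N) * (Real.exp (4/1000 * logSize j) / N) ^ 3 * N := by gcongr
        _ = _ := by field_simp; ring
    rw [le_div_iff₀ (by positivity)] at h2
    have h3 : Real.exp (4/1000 * logSize j) ≤ E := Real.exp_le_exp.2
      (by linarith [le_logSize j, (Nat.cast_nonneg j : (0 : ℝ) ≤ j)])
    have h4 : Real.exp (-(40/1000) * j) * E ^ 4 ≥ 1 := by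
      rw [hEdef, ← Real.exp_nat_mul, ← Real.exp_add]
      refine Real.one_le_exp ?_
      push_cast
      linarith [le_logSize j]
    have h5 : E ^ 20 ≤ N := by
      refine le_trans (le_of_eq ?_) hW.exp_le
      rw [hEdef, ← Real.exp_nat_mul]; push_cast; ring_nf
    have h6 : Real.exp (-(40/1000) * j) * E ^ 20 ≤ 16 * E ^ 5 := by
      calc _ ≤ Real.exp (-(40/1000) * j) * N := by gcongr
        _ ≤ _ := h2
        _ ≤ 16 * E ^ 2 * E ^ 3 := by gcongr
        _ = _ := by ring
    have h7 : E ^ 16 ≤ 16 * E ^ 5 := by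
      calc E ^ 16 = 1 * E ^ 16 := by ring
        _ ≤ Real.exp (-(40/1000) * j) * E ^ 4 * E ^ 16 := by gcongr
        _ = Real.exp (-(40/1000) * j) * E ^ 20 := by ring
        _ ≤ _ := h6
    have h8 : 17 * E ^ 5 ≤ E ^ 16 := by
      calc 17 * E ^ 5 ≤ E * E ^ 5 := by gcongr
        _ = E ^ 6 := by ring
        _ ≤ E ^ 16 := pow_le_pow_right₀ hE (by norm_num)
    have : 0 < E ^ 5 := by positivity
    linarith
  have hg : 0 < x.gcd y := Nat.gcd_pos_of_pos_left _ (hpos x hx)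
  have hadd : x / x.gcd y + y / x.gcd y = (x + y) / x.gcd y :=
    (Nat.add_div_of_dvd_right (Nat.gcd_dvd_left x y)).symm
  refine ⟨x / x.gcd y, y / x.gcd y, Nat.div_pos (Nat.gcd_le_left y (hpos x hx)) hg,
    Nat.div_pos (Nat.gcd_le_right x (hpos y hy)) hg, Nat.coprime_div_gcd_div_gcd hg, ?_, ?_⟩
  · rw [hadd]
    exact (Nat.le_ceil _).trans (by exact_mod_cast hD)
  · intro p hp hd
    rw [hadd, hp.dvd_mul, hp.dvd_mul] at hd
    rcases hd with (hd | hd) | hd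
    · exact hW.smooth x hx p hp (hd.trans (Nat.div_dvd_of_dvd (Nat.gcd_dvd_left x y)))
    · exact hW.smooth y hy p hp (hd.trans (Nat.div_dvd_of_dvd (Nat.gcd_dvd_right x y)))
    · have hd' := hd.trans (Nat.div_dvd_of_dvd
        (Nat.dvd_add (Nat.gcd_dvd_left x y) (Nat.gcd_dvd_right x y)))
      rw [he, hp.dvd_mul] at hd'
      rcases hd' with hd' | hd'
      · rw [(Nat.prime_dvd_prime_iff_eq hp Nat.prime_two).1 hd', Nat.cast_ofNat]
        have : (1 : ℝ) ≤ j := by exact_mod_cast hj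
        linarith [Real.add_one_le_exp (4 * (j : ℝ))]
      · exact hW.smooth z hz p hp hd'

end

noncomputable section
open Complex MeasureTheory Set Filter Topology Metric

lemma smoothness_le {X Y Z : ℤ} {B : ℕ} (h : ∀ p : ℕ, p.Prime → (p : ℤ) ∣ X * Y * Z → p ≤ B) :
    smoothness X Y Z ≤ B := by
  rw [smoothness]
  rcases Set.eq_empty_or_nonempty {p : ℕ | p.Prime ∧ (p : ℤ) ∣ X * Y * Z} with h0 | h0
  · rw [h0]; simp
  · exact csSup_le h0 fun p hp => h p hp.1 hp.2

lemma le_smoothness {X Y Z : ℤ} (h0 : X * Y * Z ≠ 0) {p : ℕ} (hp : p.Prime)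
    (hd : (p : ℤ) ∣ X * Y * Z) : p ≤ smoothness X Y Z := by
  refine le_csSup ⟨(X * Y * Z).natAbs, fun q hq => ?_⟩ ⟨hp, hd⟩
  exact Nat.le_of_dvd (Int.natAbs_pos.2 h0) (Int.natCast_dvd.1 hq.2)

lemma radical_le_four_pow_smoothness {X Y Z : ℤ} (h0 : X * Y * Z ≠ 0) :
    radical X Y Z ≤ 4 ^ smoothness X Y Z := by
  refine le_trans ?_ (primorial_le_four_pow _)
  rw [radical, primorial]
  refine Finset.prod_le_prod_of_subset_of_one_le' (fun p hp => ?_)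
    fun p hp _ => (Finset.mem_filter.1 hp).2.one_lt.le
  have hp' := Nat.prime_of_mem_primeFactors hp
  exact Finset.mem_filter.2 ⟨Finset.mem_range.2 (Nat.lt_succ_of_le (le_smoothness h0 hp'
    (Int.natCast_dvd.2 (Nat.dvd_of_mem_primeFactors hp)))), hp'⟩

lemma finite_setOf_height_le (B : ℝ) :
    {T : ℤ × ℤ × ℤ | (height T.1 T.2.1 T.2.2 : ℝ) ≤ B}.Finite := by
  refine ((finite_Icc (-⌊B⌋) ⌊B⌋).prod ((finite_Icc (-⌊B⌋) ⌊B⌋).prod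
    (finite_Icc (-⌊B⌋) ⌊B⌋))).subset ?_
  rintro ⟨X, Y, Z⟩ hT
  have h := Int.le_floor.2 (mem_ofPred_eq ▸ hT)
  simp only [height, max_le_iff, abs_le] at h
  exact ⟨⟨h.1.1, h.1.2⟩, ⟨h.2.1.1, h.2.1.2⟩, ⟨h.2.2.1, h.2.2.2⟩⟩

/-- Primitive solutions whose smoothness is below a power of the logarithm of the height. -/
def smoothSolutions (κ : ℝ) : Set (ℤ × ℤ × ℤ) :=
  {T | IsPrimitiveSolution T.1 T.2.1 T.2.2 ∧
    (smoothness T.1 T.2.1 T.2.2 : ℝ) < (Real.log (height T.1 T.2.1 T.2.2)) ^ κ}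

lemma GRH.infinite_smoothSolutions (h : GRH) : (smoothSolutions 4001).Infinite := by
  intro hfin
  obtain ⟨B, hB⟩ := (hfin.image fun T => (height T.1 T.2.1 T.2.2 : ℝ)).bddAbove
  obtain ⟨j, ⟨x, y, hx, hy, hxy, hH, hp⟩, hlarge, hj⟩ := (h.eventually_exists_coprime.and
    ((eventually_le_exp_logSize (B + 1) (c := 1/100) (by norm_num)).and
      (eventually_ge_atTop 100))).exists
  have hheight : height (x : ℤ) y (x + y : ℤ) = ((x + y : ℕ) : ℤ) := by
    simp only [height]
    have h1 : |(x : ℤ)| = x := abs_of_nonneg (by positivity)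
    have h2 : |(y : ℤ)| = y := abs_of_nonneg (by positivity)
    have h3 : |(x + y : ℤ)| = x + y := abs_of_nonneg (by positivity)
    rw [h1, h2, h3]
    push_cast
    omega
  have hmem : ((x : ℤ), (y : ℤ), (x + y : ℤ)) ∈ smoothSolutions 4001 := by
    refine ⟨⟨rfl, by positivity, ?_⟩, ?_⟩
    · have h1 : Int.gcd (x : ℤ) y = 1 := by rwa [Int.gcd_natCast_natCast]
      have : Int.gcd (y : ℤ) (x + y) = 1 := by
        rw [Int.gcd_comm] at h1
        simpa using h1
      simp [this]
    · have hj' : (100 : ℝ) ≤ j := by exact_mod_cast hj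
      have hS : (smoothness (x : ℤ) y (x + y) : ℝ) ≤ Real.exp (4 * j) := by
        refine le_trans ?_ (Nat.floor_le (Real.exp_pos (4 * (j : ℝ))).le)
        exact_mod_cast smoothness_le fun p hpp hd =>
          Nat.le_floor (hp p hpp (by exact_mod_cast hd))
      have hlog : Real.exp (j / 1000) ≤ Real.log (height (x : ℤ) y (x + y) : ℝ) := by
        rw [hheight, Int.cast_natCast, Real.le_log_iff_exp_le (by positivity)]
        refine le_trans (Real.exp_le_exp.2 ?_) hH
        rw [logSize]
        have := exp_le_numFactors j
        nlinarith [Real.exp_pos ((j : ℝ) / 1000)]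
      refine hS.trans_lt (lt_of_lt_of_le ?_
        (Real.rpow_le_rpow (Real.exp_pos _).le hlog (by norm_num)))
      rw [← Real.exp_mul]
      exact Real.exp_lt_exp.2 (by linarith)
  have := hB (mem_image_of_mem _ hmem)
  simp only [hheight, Int.cast_natCast] at this
  linarith

lemma finite_smoothSolutions_of_le {κ κ' : ℝ} (hle : κ ≤ κ') (h : (smoothSolutions κ').Finite) :
    (smoothSolutions κ).Finite := by
  refine (h.union (finite_setOf_height_le (Real.exp 1))).subset fun T hT => ?_
  by_cases hH : (height T.1 T.2.1 T.2.2 : ℝ) ≤ Real.exp 1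
  · exact Or.inr hH
  · have h1 : 1 ≤ Real.log (height T.1 T.2.1 T.2.2 : ℝ) :=
      (Real.le_log_iff_exp_le ((Real.exp_pos 1).trans (not_le.1 hH))).2 (not_le.1 hH).le
    exact Or.inl ⟨hT.1, hT.2.trans_le (Real.rpow_le_rpow_of_exponent_le h1 hle)⟩

lemma finite_smoothSolutions_half (habc : ∃ κ₁ : ℝ, 0 < κ₁ ∧ ∀ ε > (0 : ℝ),
      {T : ℤ × ℤ × ℤ | IsPrimitiveSolution T.1 T.2.1 T.2.2 ∧
        (radical T.1 T.2.1 T.2.2 : ℝ) ≤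
          (height T.1 T.2.1 T.2.2 : ℝ) ^ (κ₁ - ε)}.Finite) :
    (smoothSolutions (1/2)).Finite := by
  obtain ⟨κ, hκ, h⟩ := habc
  set B := Real.exp ((2 * Real.log 4 / κ) ^ 2)
  refine ((h (κ / 2) (by positivity)).union (finite_setOf_height_le B)).subset fun T hT => ?_
  by_cases hH : (height T.1 T.2.1 T.2.2 : ℝ) ≤ B
  · exact Or.inr hH
  refine Or.inl ⟨hT.1, ?_⟩
  have hH0 : 0 < (height T.1 T.2.1 T.2.2 : ℝ) := (Real.exp_pos _).trans (not_le.1 hH)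
  set l := Real.log (height T.1 T.2.1 T.2.2 : ℝ) with hl
  have h1 : (2 * Real.log 4 / κ) ^ 2 ≤ l :=
    (Real.le_log_iff_exp_le hH0).2 (not_le.1 hH).le
  have hl0 : 0 ≤ l := (sq_nonneg _).trans h1
  have h2 : 2 * Real.log 4 / κ ≤ Real.sqrt l := Real.le_sqrt_of_sq_le h1
  have h3 : (smoothness T.1 T.2.1 T.2.2 : ℝ) ≤ Real.sqrt l := by
    rw [Real.sqrt_eq_rpow]; exact hT.2.le
  have h4 : Real.log 4 ≤ κ / 2 * Real.sqrt l := by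
    rw [div_le_iff₀ hκ] at h2; linarith
  have h5 : 0 ≤ Real.log 4 := Real.log_nonneg (by norm_num)
  calc (radical T.1 T.2.1 T.2.2 : ℝ) ≤ (4 : ℝ) ^ smoothness T.1 T.2.1 T.2.2 := by
        exact_mod_cast radical_le_four_pow_smoothness hT.1.2.1
    _ = Real.exp (smoothness T.1 T.2.1 T.2.2 * Real.log 4) := by
        rw [Real.exp_nat_mul, Real.exp_log (by norm_num)]
    _ ≤ Real.exp (l * (κ - κ / 2)) := by
        refine Real.exp_le_exp.2 ?_
        calc _ ≤ Real.sqrt l * (κ / 2 * Real.sqrt l) := by gcongr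
          _ = κ / 2 * (Real.sqrt l * Real.sqrt l) := by ring
          _ = _ := by rw [Real.mul_self_sqrt hl0]; ring
    _ = _ := by rw [hl, Real.rpow_def_of_pos hH0]

end

theorem alphabet_soup (hGRH : GRH)
    (habc : ∃ κ₁ : ℝ, 0 < κ₁ ∧ ∀ ε > (0 : ℝ),
      {T : ℤ × ℤ × ℤ | IsPrimitiveSolution T.1 T.2.1 T.2.2 ∧
        (radical T.1 T.2.1 T.2.2 : ℝ) ≤
          (height T.1 T.2.1 T.2.2 : ℝ) ^ (κ₁ - ε)}.Finite) :
    ∃ κ₀ : ℝ, 0 < κ₀ ∧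
      (∀ ε > (0 : ℝ), {T : ℤ × ℤ × ℤ | IsPrimitiveSolution T.1 T.2.1 T.2.2 ∧
        (smoothness T.1 T.2.1 T.2.2 : ℝ) <
          (Real.log (height T.1 T.2.1 T.2.2)) ^ (κ₀ - ε)}.Finite) ∧
      (∀ ε > (0 : ℝ), {T : ℤ × ℤ × ℤ | IsPrimitiveSolution T.1 T.2.1 T.2.2 ∧
        (smoothness T.1 T.2.1 T.2.2 : ℝ) <
          (Real.log (height T.1 T.2.1 T.2.2)) ^ (κ₀ + ε)}.Infinite) := by
  set A := {κ : ℝ | (smoothSolutions κ).Infinite} with hA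
  have hne : A.Nonempty := ⟨4001, hGRH.infinite_smoothSolutions⟩
  have hlow : ∀ κ ∈ A, 1/2 ≤ κ := fun κ hκ => by
    by_contra! hlt
    exact hκ (finite_smoothSolutions_of_le hlt.le (finite_smoothSolutions_half habc))
  have hbdd : BddBelow A := ⟨1/2, hlow⟩
  refine ⟨sInf A, lt_of_lt_of_le (by norm_num) (le_csInf hne hlow), fun ε hε => ?_, fun ε hε => ?_⟩
  · by_contra hinf
    have := csInf_le hbdd (show sInf A - ε ∈ A from hinf)
    linarith
  · obtain ⟨κ, hκ, hlt⟩ := exists_lt_of_csInf_lt hne (show sInf A < sInf A + ε by linarith)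
    exact fun hfin => hκ (finite_smoothSolutions_of_le hlt.le hfin)
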